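/- Let f : X ⇢ B be a dominant rational map between smooth complex projective varieties with dim X > dim B, and let D be an ample divisor on X. If B is not uniruled, then the restriction f|_D is still dominant. -/

import Mathlib

/-!
Foundations for formalizing "Rational maps from punctual Hilbert schemes of K3 surfaces"
(Chen). We work with schemes over `Spec ℂ`.

Notions missing from Mathlib are given best-effort definitions:
* `ProjLine` is `ℙ¹_ℂ`, and rational curves / uniruledness / rational connectedness are
  defined via non-constant morphisms from `ProjLine`.
* A variety is an integral separated scheme of finite type over `ℂ`; "projective" is
  rendered as properness (projectivity of morphisms is not available in Mathlib).
* A K3 surface is a smooth proper integral surface over `ℂ`; the two cohomological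
  conditions (trivial canonical bundle and `H¹(S, O_S) = 0`), which are not expressible
  in current Mathlib (no sheaf cohomology / canonical sheaf), are replaced by the
  consequence actually relevant to rational curves: `S` is not uniruled.
-/

open AlgebraicGeometry CategoryTheory CategoryTheory.Limits

noncomputable section

/-- `Spec ℂ`. -/
def SpecC : Scheme := Spec (CommRingCat.of ℂ)

attribute [local instance] MvPolynomial.gradedAlgebra

/-- The projective line over `ℂ`, as `Proj ℂ[X₀, X₁]`. -/
def ProjLine : Scheme := Proj (MvPolynomial.homogeneousSubmodule (Fin 2) ℂ)

/-- The dimension of a scheme: the Krull dimension of its underlying topological space. -/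
def AlgebraicGeometry.Scheme.dimension (X : Scheme) : WithBot ℕ∞ := topologicalKrullDim X

/-- A complex variety: an integral separated scheme of finite type over `Spec ℂ`. -/
structure Variety where
  X : Scheme
  structMap : X ⟶ SpecC
  isIntegral : IsIntegral X
  isSeparated : X.IsSeparated
  locallyOfFiniteType : LocallyOfFiniteType structMap
  quasiCompact : QuasiCompact structMap

/-- The dimension of a variety. -/
def Variety.dim (V : Variety) : WithBot ℕ∞ := V.X.dimension

/-- A variety "is a point" if it is zero-dimensional. -/
def Variety.IsPoint (V : Variety) : Prop := V.dim = 0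

/-- `Z ⊆ X` is (the image of) a rational curve: the image of a non-constant morphism
from `ℙ¹`. -/
def IsRationalCurveImage (X : Scheme) (Z : Set X) : Prop :=
  ∃ f : ProjLine ⟶ X, (Set.range f.base).Nontrivial ∧ Z = Set.range f.base

/-- A scheme contains infinitely many (possibly singular) rational curves if the set of
images of non-constant morphisms `ℙ¹ ⟶ X` is infinite. -/
def HasInfinitelyManyRationalCurves (X : Scheme) : Prop :=
  { Z : Set X | IsRationalCurveImage X Z }.Infinite

/-- `X` is uniruled: every point of some dense open subset lies on a rational curve. -/
def Uniruled (X : Scheme) : Prop :=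
  ∃ U : Set X, IsOpen U ∧ Dense U ∧
    ∀ x ∈ U, ∃ f : ProjLine ⟶ X, (Set.range f.base).Nontrivial ∧ x ∈ Set.range f.base

/-- `X` is rationally connected: any two points of some dense open subset are contained
in the image of a non-constant morphism `ℙ¹ ⟶ X`. -/
def RationallyConnected (X : Scheme) : Prop :=
  ∃ U : Set X, IsOpen U ∧ Dense U ∧
    ∀ x ∈ U, ∀ y ∈ U, ∃ f : ProjLine ⟶ X,
      (Set.range f.base).Nontrivial ∧ x ∈ Set.range f.base ∧ y ∈ Set.range f.base

/-- A partial map is dominant if its image is dense. -/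
def AlgebraicGeometry.Scheme.PartialMap.Dominant {X Y : Scheme} (f : X.PartialMap Y) : Prop :=
  Dense (Set.range f.hom.base)

/-- A rational map is dominant if some representative partial map has dense image. -/
def AlgebraicGeometry.Scheme.RationalMap.Dominant {X Y : Scheme} (f : X ⤏ Y) : Prop :=
  ∃ g : X.PartialMap Y, g.toRationalMap = f ∧ g.Dominant

/-- The set of closed points of a scheme. -/
def closedPts (X : Scheme) : Set X := { x | IsClosed ({x} : Set X) }

/-- A K3 surface: a smooth proper (in lieu of projective) integral surface over `ℂ`.
The cohomological parts of the definition of a K3 surface (triviality of the canonical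
bundle and `H¹(S, O_S) = 0`) are not expressible in current Mathlib; we record instead
the consequence relevant for the geometry of rational curves: `S` is not uniruled. -/
structure K3Surface extends Variety where
  proper : IsProper structMap
  smooth : IsSmooth structMap
  dim_two : X.dimension = 2
  notUniruled : ¬ Uniruled X

end

noncomputable section
open AlgebraicGeometry CategoryTheory CategoryTheory.Limits
structure AmpleDivisorApprox (X : Variety) where
  D : Scheme
  ι : D ⟶ X.X
  closedImmersion : IsClosedImmersion ι
  codim_one : D.dimension + 1 = X.X.dimension
  positive : ∀ T : Set X.X, IsClosed T → IsIrreducible T →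
    1 ≤ topologicalKrullDim T → (T ∩ Set.range ι.base).Nonempty

/-- Newton polygon argument. -/
theorem newton_slope (Q N : Set (ℕ × ℕ)) (i0 j0 : ℕ) (hj : (0, j0) ∈ Q) (hi : (i0, 0) ∈ Q)
    (hmin : ∀ m ∈ Q, m.2 = 0 → i0 ≤ m.1)
    (ha : ∀ n ∈ N, n.1 = 0 → j0 < n.2)
    (hb : ∃ n ∈ N, n.2 = 0 ∧ n.1 ≤ i0) :
    ∃ p q e : ℕ, 0 < p ∧ 0 < q ∧ (∀ m ∈ Q, e ≤ p * m.1 + q * m.2) ∧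
      (∀ n ∈ N, e ≤ p * n.1 + q * n.2) ∧ (∃ n ∈ N, p * n.1 + q * n.2 = e) ∧
      (∀ n ∈ N, p * n.1 + q * n.2 = e → ∃ m ∈ Q, p * m.1 + q * m.2 = e ∧ m.1 < n.1) := by
  classical
  let w : ℝ → ℕ × ℕ → ℝ := fun a x => a * x.1 + x.2
  have hw : ∀ x, Continuous (fun a => w a x) := fun x => by unfold w; fun_prop
  let F : Set (ℕ × ℕ) := N ∩ (Set.Iic i0 ×ˢ Set.Iic j0)
  have hF : F.Finite := Set.Finite.inter_of_right ((Set.finite_Iic i0).prod (Set.finite_Iic j0)) _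
  have hout : ∀ a : ℝ, 0 < a → ∀ n ∈ N, n ∉ F → ∃ m ∈ Q, w a m < w a n := by
    intro a h0 n hn hnF
    by_cases h1 : n.1 ≤ i0
    · by_cases h2 : n.2 ≤ j0
      · exact absurd ⟨hn, h1, h2⟩ hnF
      · refine ⟨_, hj, ?_⟩
        have : (j0 : ℝ) < n.2 := by exact_mod_cast not_le.mp h2
        have h3 : 0 ≤ a * n.1 := by positivity
        simp only [w]; push_cast; linarith
    · refine ⟨_, hi, ?_⟩
      have : (i0 : ℝ) < n.1 := by exact_mod_cast not_le.mp h1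
      have h4 : (0 : ℝ) ≤ n.2 := by positivity
      simp only [w]; push_cast; nlinarith
  have hlarge : ∀ a : ℝ, j0 < a → ∀ n ∈ N, ∃ m ∈ Q, w a m < w a n := by
    intro a h0 n hn
    refine ⟨_, hj, ?_⟩
    have hj0 : (0 : ℝ) ≤ j0 := by positivity
    simp only [w]; push_cast
    rcases Nat.eq_zero_or_pos n.1 with h | h
    · have : (j0 : ℝ) < n.2 := by exact_mod_cast ha n hn h
      rw [h]; push_cast; linarith
    · have h' : (1 : ℝ) ≤ n.1 := by exact_mod_cast h
      have h4 : (0 : ℝ) ≤ n.2 := by positivity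
      nlinarith
  let C : Set ℝ := ⋃ n ∈ F, ⋂ m ∈ Q, {a | w a n ≤ w a m}
  have hCcl : IsClosed C := by
    refine hF.isClosed_biUnion fun n _ => isClosed_biInter fun m _ => ?_
    exact isClosed_le (hw n) (hw m)
  have hCmem : ∀ a, a ∈ C ↔ ∃ n ∈ F, ∀ m ∈ Q, w a n ≤ w a m := by
    intro a; simp [C]
  have hout2 : ∀ a : ℝ, 0 < a → a ∉ C → ∀ n ∈ N, ∃ m ∈ Q, w a m < w a n := by
    intro a h0 hc n hn
    by_cases hnF : n ∈ F
    · rw [hCmem] at hc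
      push Not at hc
      exact hc n hnF
    · exact hout a h0 n hn hnF
  let a0 : ℝ := 1 / (i0 + 1)
  have ha0 : 0 < a0 := by positivity
  have ha0C : a0 ∈ C := by
    rw [hCmem]
    obtain ⟨n, hn, hn2, hn1⟩ := hb
    refine ⟨n, ⟨hn, hn1, by simp [hn2]⟩, fun m hm => ?_⟩
    have h1 : (n.1 : ℝ) ≤ i0 := by exact_mod_cast hn1
    simp only [w, hn2]
    rcases Nat.eq_zero_or_pos m.2 with h | h
    · have : (n.1 : ℝ) ≤ m.1 := by exact_mod_cast hn1.trans (hmin m hm h)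
      rw [h]; gcongr
    · have h' : (1 : ℝ) ≤ m.2 := by exact_mod_cast h
      have h5 : a0 * n.1 ≤ 1 := by
        simp only [a0]; rw [div_mul_eq_mul_div, div_le_one (by positivity)]; linarith
      have h6 : 0 ≤ a0 * m.1 := by positivity
      push_cast; linarith
  have hCle : ∀ a ∈ C, a ≤ j0 := by
    intro a hac
    by_contra hlt
    rw [hCmem] at hac
    obtain ⟨n, hn, h⟩ := hac
    obtain ⟨m, hm, hm'⟩ := hlarge a (not_le.mp hlt) n hn.1
    exact absurd (h m hm) (not_le.mpr hm')
  obtain ⟨a1, ha1, hmax⟩ := (isCompact_Icc (a := a0) (b := (j0 : ℝ))).inter_right hCcl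
    |>.exists_isGreatest ⟨a0, ⟨⟨le_rfl, hCle _ ha0C⟩, ha0C⟩⟩
  have ha1pos : 0 < a1 := lt_of_lt_of_le ha0 ha1.1.1
  have hgt : ∀ a, a1 < a → a ∉ C := by
    intro a h hc
    exact absurd (hmax ⟨⟨ha1.1.1.trans h.le, hCle _ hc⟩, hc⟩) (not_le.mpr h)
  obtain ⟨n0, hn0, hn0m⟩ := (hCmem _).1 ha1.2
  have hle : ∀ n ∈ N, w a1 n0 ≤ w a1 n := by
    intro n hn
    have : ∀ᶠ a in nhdsWithin a1 (Set.Ioi a1), w a1 n0 ≤ w a n := by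
      filter_upwards [self_mem_nhdsWithin] with a (haa : a1 < a)
      obtain ⟨m, hm, hlt⟩ := hout2 a (ha1pos.trans haa) (hgt a haa) n hn
      refine (hn0m m hm).trans (le_trans ?_ hlt.le)
      simp only [w]; gcongr
    exact ge_of_tendsto (((hw n).tendsto a1).mono_left nhdsWithin_le_nhds) this
  have hstep : ∀ n ∈ N, w a1 n = w a1 n0 → ∃ m ∈ Q, w a1 m = w a1 n0 ∧ m.1 < n.1 := by
    intro n hn hne
    let M : Set (ℕ × ℕ) := {m ∈ Q | m.1 < n.1 ∧ (m.2 : ℝ) ≤ w (a1 + 1) n}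
    have hM : M.Finite := by
      refine ((Set.finite_Iio n.1).prod (Set.finite_Iic ⌊w (a1+1) n⌋₊)).subset ?_
      rintro m ⟨_, h1, h2⟩
      exact ⟨h1, Nat.le_floor h2⟩
    let Z : Set ℝ := ⋃ m ∈ M, {a | w a m ≤ w a n}
    have hZ : IsClosed Z := hM.isClosed_biUnion fun m _ => isClosed_le (hw m) (hw n)
    have hsub : ∀ᶠ a in nhdsWithin a1 (Set.Ioi a1), a ∈ Z := by
      filter_upwards [Ioc_mem_nhdsGT (show a1 < a1 + 1 by linarith)] with a haa
      obtain ⟨m, hm, hlt⟩ := hout2 a (ha1pos.trans haa.1) (hgt a haa.1) n hn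
      have h1 : w a1 n ≤ w a1 m := hne ▸ hn0m m hm
      have hmn : (m.1 : ℝ) < n.1 := by
        simp only [w] at hlt h1
        by_contra hc
        push Not at hc
        nlinarith [haa.1]
      simp only [Z, Set.mem_iUnion]
      refine ⟨m, ⟨hm, by exact_mod_cast hmn, ?_⟩, hlt.le⟩
      have : w a n ≤ w (a1 + 1) n := by simp only [w]; gcongr; exact haa.2
      have h3 : (m.2 : ℝ) ≤ w a m := by
        have : 0 ≤ a * m.1 := mul_nonneg (ha1pos.trans haa.1).le (by positivity)
        simp only [w]; linarith
      linarith
    have : a1 ∈ Z := hZ.mem_of_tendsto (f := id) (b := nhdsWithin a1 (Set.Ioi a1))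
      (Filter.tendsto_id.mono_left nhdsWithin_le_nhds) hsub
    simp only [Z, Set.mem_iUnion] at this
    obtain ⟨m, hm, hmle⟩ := this
    refine ⟨m, hm.1, le_antisymm (hne ▸ hmle) (hn0m m hm.1), hm.2.1⟩
  obtain ⟨m0, hm0, hm0e, hm0l⟩ := hstep n0 hn0.1 rfl
  -- rational slope
  have hsl : a1 * ((n0.1 - m0.1 : ℕ) : ℝ) = ((m0.2 - n0.2 : ℕ) : ℝ) := by
    have h1 : a1 * ((n0.1 : ℝ) - m0.1) = (m0.2 : ℝ) - n0.2 := by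
      simp only [w] at hm0e; linarith
    have h2 : (m0.1 : ℝ) < n0.1 := by exact_mod_cast hm0l
    have h3 : n0.2 ≤ m0.2 := by
      have : (0 : ℝ) ≤ (m0.2 : ℝ) - n0.2 := by rw [← h1]; apply mul_nonneg ha1pos.le; linarith
      have : (n0.2 : ℝ) ≤ m0.2 := by linarith
      exact_mod_cast this
    rw [Nat.cast_sub hm0l.le, Nat.cast_sub h3, h1]
  set q := n0.1 - m0.1 with hq
  set p := m0.2 - n0.2 with hp
  have hq0 : 0 < q := by omega
  have hq0' : (0 : ℝ) < q := by exact_mod_cast hq0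
  have hp0 : 0 < p := by
    have : (0 : ℝ) < p := by rw [← hsl]; positivity
    exact_mod_cast this
  have key : ∀ x : ℕ × ℕ, ((p * x.1 + q * x.2 : ℕ) : ℝ) = q * w a1 x := by
    intro x; push_cast; rw [← hsl]; simp only [w]; ring
  have keyle : ∀ x y : ℕ × ℕ, w a1 x ≤ w a1 y → p * x.1 + q * x.2 ≤ p * y.1 + q * y.2 := by
    intro x y h
    have : ((p * x.1 + q * x.2 : ℕ) : ℝ) ≤ ((p * y.1 + q * y.2 : ℕ) : ℝ) := by
      rw [key, key]; gcongr
    exact_mod_cast this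
  have keyeq : ∀ x y : ℕ × ℕ, w a1 x = w a1 y ↔ p * x.1 + q * x.2 = p * y.1 + q * y.2 := by
    intro x y
    refine ⟨fun h => le_antisymm (keyle _ _ h.le) (keyle _ _ h.ge), fun h => ?_⟩
    have : q * w a1 x = q * w a1 y := by rw [← key, ← key, h]
    exact mul_left_cancel₀ hq0'.ne' this
  refine ⟨p, q, p * n0.1 + q * n0.2, hp0, hq0, fun m hm => keyle _ _ (hn0m m hm),
    fun n hn => keyle _ _ (hle n hn), ⟨n0, hn0.1, rfl⟩, fun n hn h => ?_⟩
  obtain ⟨m, hm, h1, h2⟩ := hstep n hn ((keyeq _ _).2 h)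
  exact ⟨m, hm, (keyeq _ _).1 h1, h2⟩

section PartTwo
open PowerSeries

/-- lattice points of weight `n`. -/
def wtSet (p q n : ℕ) : Finset (ℕ × ℕ) :=
  ((Finset.range (n + 1)) ×ˢ (Finset.range (n + 1))).filter (fun x => p * x.1 + q * x.2 = n)

theorem mem_wtSet {p q n : ℕ} (hp : 0 < p) (hq : 0 < q) (x : ℕ × ℕ) :
    x ∈ wtSet p q n ↔ p * x.1 + q * x.2 = n := by
  simp only [wtSet, Finset.mem_filter, Finset.mem_product, Finset.mem_range, and_iff_right_iff_imp]
  rintro rfl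
  constructor <;> nlinarith [Nat.zero_le x.1, Nat.zero_le x.2, Nat.zero_le (p * x.1),
    Nat.zero_le (q * x.2)]

variable {k : Type*} [Field k]

/-- The substitution `s = u τ^p`, `t = τ^q`. -/
noncomputable def newtonSubstFun (p q : ℕ) (F : PowerSeries (PowerSeries k)) :
    PowerSeries (Polynomial k) :=
  PowerSeries.mk fun n => ∑ x ∈ wtSet p q n, Polynomial.monomial x.1 (coeff x.2 (coeff x.1 F))

noncomputable def newtonSubst (p q : ℕ) (hp : 0 < p) (hq : 0 < q) :
    PowerSeries (PowerSeries k) →+* PowerSeries (Polynomial k) where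
  toFun := newtonSubstFun p q
  map_zero' := by ext; simp [newtonSubstFun]
  map_add' F G := by ext n : 1; simp [newtonSubstFun, Finset.sum_add_distrib]
  map_one' := by
    ext n : 1
    simp only [newtonSubstFun, coeff_mk, coeff_one]
    split_ifs with h
    · subst h
      rw [Finset.sum_eq_single (0, 0)]
      · simp
      · intro b hb hne
        rw [mem_wtSet hp hq] at hb
        exfalso; apply hne
        have h1 : p * b.1 = 0 := by omega
        have h2 : q * b.2 = 0 := by omega
        ext
        · simpa [hp.ne'] using h1
        · simpa [hq.ne'] using h2
      · intro hb; exact absurd ((mem_wtSet hp hq _).2 (by simp)) hb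
    · apply Finset.sum_eq_zero
      intro x hx
      rw [mem_wtSet hp hq] at hx
      split_ifs with h1
      · rw [coeff_one]
        split_ifs with h2
        · exfalso; apply h; rw [← hx, h1, h2]; simp
        · simp
      · simp
  map_mul' F G := by
    ext n : 1
    simp only [newtonSubstFun, coeff_mk, coeff_mul, map_sum, Finset.sum_mul_sum]
    simp only [Finset.sum_sigma', Polynomial.monomial_mul_monomial]
    refine Finset.sum_bij'
      (fun x _ => ⟨(p * x.2.1.1 + q * x.2.2.1, p * x.2.1.2 + q * x.2.2.2),
        ⟨(x.2.1.1, x.2.2.1), (x.2.1.2, x.2.2.2)⟩⟩)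
      (fun y _ => ⟨(y.2.1.1 + y.2.2.1, y.2.1.2 + y.2.2.2), ⟨(y.2.1.1, y.2.2.1), (y.2.1.2, y.2.2.2)⟩⟩)
      ?_ ?_ ?_ ?_ ?_
    · rintro ⟨⟨i, j⟩, ⟨⟨i1, i2⟩, ⟨j1, j2⟩⟩⟩ h
      simp only [Finset.mem_sigma, mem_wtSet hp hq, Finset.HasAntidiagonal.mem_antidiagonal] at h ⊢
      obtain ⟨h1, h2, h3⟩ := h
      subst h2 h3
      refine ⟨by rw [← h1]; ring, trivial, trivial⟩
    · rintro ⟨⟨n1, n2⟩, ⟨⟨i1, j1⟩, ⟨i2, j2⟩⟩⟩ h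
      simp only [Finset.mem_sigma, mem_wtSet hp hq, Finset.HasAntidiagonal.mem_antidiagonal] at h ⊢
      obtain ⟨h1, h2, h3⟩ := h
      subst h2 h3
      refine ⟨by rw [← h1]; ring, trivial, trivial⟩
    · rintro ⟨⟨i, j⟩, ⟨⟨i1, i2⟩, ⟨j1, j2⟩⟩⟩ h
      simp only [Finset.mem_sigma, mem_wtSet hp hq, Finset.HasAntidiagonal.mem_antidiagonal] at h ⊢
      obtain ⟨h1, h2, h3⟩ := h
      subst h2 h3
      rfl
    · rintro ⟨⟨n1, n2⟩, ⟨⟨i1, j1⟩, ⟨i2, j2⟩⟩⟩ h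
      simp only [Finset.mem_sigma, mem_wtSet hp hq, Finset.HasAntidiagonal.mem_antidiagonal] at h ⊢
      obtain ⟨h1, h2, h3⟩ := h
      subst h2 h3
      rfl
    · rintro ⟨⟨i, j⟩, ⟨⟨i1, i2⟩, ⟨j1, j2⟩⟩⟩ h
      simp only [Finset.mem_sigma, mem_wtSet hp hq, Finset.HasAntidiagonal.mem_antidiagonal] at h ⊢
      obtain ⟨h1, h2, h3⟩ := h
      subst h2 h3
      rfl

theorem coeff_newtonSubst (p q : ℕ) (hp : 0 < p) (hq : 0 < q) (F : PowerSeries (PowerSeries k))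
    (n : ℕ) : coeff n (newtonSubst p q hp hq F) =
      ∑ x ∈ wtSet p q n, Polynomial.monomial x.1 (coeff x.2 (coeff x.1 F)) := by
  simp [newtonSubst, newtonSubstFun]

theorem newtonSubst_C (p q : ℕ) (hp : 0 < p) (hq : 0 < q) (c : k) :
    newtonSubst p q hp hq (PowerSeries.C (PowerSeries.C c)) = PowerSeries.C (Polynomial.C c) := by
  ext n : 1
  rw [coeff_newtonSubst, coeff_C]
  split_ifs with h
  · subst h
    rw [Finset.sum_eq_single (0, 0)]
    · simp
    · intro b hb hne
      rw [mem_wtSet hp hq] at hb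
      exfalso; apply hne
      have h1 : p * b.1 = 0 := by omega
      have h2 : q * b.2 = 0 := by omega
      ext
      · simpa [hp.ne'] using h1
      · simpa [hq.ne'] using h2
    · intro hb; exact absurd ((mem_wtSet hp hq _).2 (by simp)) hb
  · apply Finset.sum_eq_zero
    intro x hx
    rw [mem_wtSet hp hq] at hx
    rw [coeff_C]
    split_ifs with h1
    · rw [coeff_C]
      split_ifs with h2
      · exfalso; apply h; rw [← hx, h1, h2]; simp
      · simp
    · simp

/-- coefficients of the weight-`n` part -/
theorem coeff_coeff_newtonSubst (p q : ℕ) (hp : 0 < p) (hq : 0 < q)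
    (F : PowerSeries (PowerSeries k)) (i j : ℕ) :
    (coeff (p * i + q * j) (newtonSubst p q hp hq F)).coeff i = coeff j (coeff i F) := by
  rw [coeff_newtonSubst, Polynomial.finsetSum_coeff]
  rw [Finset.sum_eq_single (i, j)]
  · simp
  · intro b hb hne
    rw [mem_wtSet hp hq] at hb
    rw [Polynomial.coeff_monomial, if_neg]
    intro h
    apply hne
    subst h
    have : q * b.2 = q * j := by omega
    ext
    · rfl
    · exact Nat.eq_of_mul_eq_mul_left hq this
  · intro hb; exact absurd ((mem_wtSet hp hq (i, j)).2 (by simp)) hb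

theorem coeff_coeff_newtonSubst_ne (p q : ℕ) (hp : 0 < p) (hq : 0 < q)
    (F : PowerSeries (PowerSeries k)) (n i : ℕ)
    (h : (coeff n (newtonSubst p q hp hq F)).coeff i ≠ 0) :
    ∃ j, p * i + q * j = n ∧ coeff j (coeff i F) ≠ 0 := by
  rw [coeff_newtonSubst, Polynomial.finsetSum_coeff] at h
  obtain ⟨b, hb, hb'⟩ := Finset.exists_ne_zero_of_sum_ne_zero h
  rw [mem_wtSet hp hq] at hb
  rw [Polynomial.coeff_monomial] at hb'
  split_ifs at hb' with h1
  · subst h1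
    exact ⟨b.2, hb, hb'⟩
  · exact absurd rfl hb'

/-- The two-dimensional core: toric blow-up separating the two arcs. -/
theorem newton_core {ι : Type*} (Q : PowerSeries (PowerSeries k)) (N : ι → PowerSeries (PowerSeries k))
    (i0 j0 : ℕ)
    (hj : coeff j0 (constantCoeff Q) ≠ 0)
    (hi : coeff i0 (PowerSeries.map constantCoeff Q) ≠ 0)
    (hi' : ∀ i < i0, coeff i (PowerSeries.map constantCoeff Q) = 0)
    (ha : ∀ x, ∀ j ≤ j0, coeff j (constantCoeff (N x)) = 0)
    (hb : ∃ x, ∃ i ≤ i0, coeff i (PowerSeries.map constantCoeff (N x)) ≠ 0) :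
    ∃ (χ : PowerSeries (PowerSeries k) →+* PowerSeries (Polynomial k)) (e d : ℕ)
      (Q' : PowerSeries (Polynomial k)) (N' : ι → PowerSeries (Polynomial k)),
      (∀ c, χ (C (C c)) = C (Polynomial.C c)) ∧
      χ Q = X ^ e * Q' ∧ (∀ x, χ (N x) = X ^ e * N' x) ∧
      ¬ (Polynomial.X ^ (d + 1) ∣ constantCoeff Q') ∧
      (∀ x, Polynomial.X ^ (d + 1) ∣ constantCoeff (N' x)) ∧
      ∃ x, constantCoeff (N' x) ≠ 0 := by
  classical
  let SQ : Set (ℕ × ℕ) := {x | coeff x.2 (coeff x.1 Q) ≠ 0}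
  let SN : Set (ℕ × ℕ) := {x | ∃ y, coeff x.2 (coeff x.1 (N y)) ≠ 0}
  obtain ⟨p, q, e, hp, hq, h1, h2, ⟨n, ⟨y, hy⟩, hne⟩, h4⟩ := newton_slope SQ SN i0 j0
    (by simpa [SQ] using hj) (by simpa [SQ] using hi)
    (by
      intro m hm hm2
      by_contra hlt
      apply hm
      rw [hm2]
      simpa using hi' m.1 (not_le.mp hlt))
    (by
      rintro n ⟨y, hy⟩ hn
      by_contra hlt
      apply hy
      rw [hn]
      simpa using ha y n.2 (not_lt.mp hlt))
    (by
      obtain ⟨x, i, hi, hx⟩ := hb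
      exact ⟨(i, 0), ⟨x, by simpa using hx⟩, rfl, hi⟩)
  have hdiv : ∀ F : PowerSeries (PowerSeries k),
      (∀ i j, coeff j (coeff i F) ≠ 0 → e ≤ p * i + q * j) →
      ∃ F', newtonSubst p q hp hq F = X ^ e * F' ∧
        constantCoeff F' = coeff e (newtonSubst p q hp hq F) := by
    intro F hF
    have : X ^ e ∣ newtonSubst p q hp hq F := by
      rw [X_pow_dvd_iff]
      intro m hm
      by_contra hcon
      obtain ⟨i, hi⟩ : ∃ i, (coeff m (newtonSubst p q hp hq F)).coeff i ≠ 0 := by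
        by_contra hall
        push Not at hall
        exact hcon (Polynomial.ext fun i => by simpa using hall i)
      obtain ⟨j, hj1, hj2⟩ := coeff_coeff_newtonSubst_ne p q hp hq F m i hi
      have := hF i j hj2
      omega
    obtain ⟨F', hF'⟩ := this
    refine ⟨F', hF', ?_⟩
    rw [hF']
    have := coeff_X_pow_mul F' e 0
    simpa using this.symm
  obtain ⟨Q', hQ', hQ'c⟩ := hdiv Q (fun i j h => h1 (i, j) h)
  choose N' hN' hN'c using fun x => hdiv (N x) (fun i j h => h2 (i, j) ⟨x, h⟩)
  obtain ⟨m, hm, hme, hml⟩ := h4 n ⟨y, hy⟩ hne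
  have hex : ∃ i, (constantCoeff Q').coeff i ≠ 0 := ⟨m.1, by
    rw [hQ'c, ← hme, coeff_coeff_newtonSubst]; exact hm⟩
  let d := Nat.find hex
  refine ⟨newtonSubst p q hp hq, e, d, Q', N', newtonSubst_C p q hp hq, hQ', hN', ?_, ?_, ?_⟩
  · intro hdvd
    rw [Polynomial.X_pow_dvd_iff] at hdvd
    exact Nat.find_spec hex (hdvd d (Nat.lt_succ_self d))
  · intro x
    rw [Polynomial.X_pow_dvd_iff]
    intro i hi
    by_contra hcon
    rw [hN'c] at hcon
    obtain ⟨j, hj1, hj2⟩ := coeff_coeff_newtonSubst_ne p q hp hq _ _ i hcon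
    obtain ⟨m', hm', hme', hml'⟩ := h4 (i, j) ⟨x, hj2⟩ hj1
    have : d ≤ m'.1 := Nat.find_min' hex (by
      rw [hQ'c, ← hme', coeff_coeff_newtonSubst]; exact hm')
    simp only at hml'
    omega
  · refine ⟨y, fun h0 => hy ?_⟩
    rw [hN'c] at h0
    rw [← coeff_coeff_newtonSubst p q hp hq (N y) n.1 n.2, hne, h0]
    simp
end PartTwo

section PartThree
open PowerSeries

variable {k : Type*} [Field k]

theorem st_pow_dvd_iff (n : ℕ) (F : PowerSeries (PowerSeries k)) :
    ((X : PowerSeries (PowerSeries k)) * C X) ^ n ∣ F ↔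
      ∀ i j, i < n ∨ j < n → coeff j (coeff i F) = 0 := by
  constructor
  · rintro ⟨G, rfl⟩ i j h
    rw [mul_pow, mul_assoc, coeff_X_pow_mul', ← map_pow]
    split_ifs with hi
    · rw [coeff_C_mul, coeff_X_pow_mul', if_neg (by omega)]
    · simp
  · intro h
    have h1 : X ^ n ∣ F := by
      rw [X_pow_dvd_iff]
      intro i hi
      ext j
      simpa using h i j (Or.inl hi)
    obtain ⟨G, rfl⟩ := h1
    have h2 : ∀ i, X ^ n ∣ coeff i G := by
      intro i
      rw [X_pow_dvd_iff]
      intro j hj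
      have := h (i + n) j (Or.inr hj)
      rwa [coeff_X_pow_mul] at this
    choose g hg using h2
    refine ⟨PowerSeries.mk g, ?_⟩
    rw [mul_pow, mul_assoc]
    congr 1
    ext i : 1
    rw [← map_pow, coeff_C_mul, coeff_mk, hg]

instance isAdicComplete_st :
    IsAdicComplete (Ideal.span {(X : PowerSeries (PowerSeries k)) * C X})
      (PowerSeries (PowerSeries k)) where
  haus' := by
    intro F hF
    ext i j
    have := hF (i + 1)
    rw [SModEq.sub_mem, sub_zero, smul_eq_mul, Ideal.mul_top, Ideal.span_singleton_pow,
      Ideal.mem_span_singleton, st_pow_dvd_iff] at this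
    simpa using this i j (Or.inl (Nat.lt_succ_self i))
  prec' := by
    intro f hf
    have hf' : ∀ m n, m ≤ n → ∀ i j, i < m ∨ j < m →
        coeff j (coeff i (f m)) = coeff j (coeff i (f n)) := by
      intro m n hmn i j hij
      have := hf hmn
      rw [SModEq.sub_mem, smul_eq_mul, Ideal.mul_top, Ideal.span_singleton_pow,
        Ideal.mem_span_singleton, st_pow_dvd_iff] at this
      simpa [sub_eq_zero] using this i j hij
    refine ⟨PowerSeries.mk fun i => PowerSeries.mk fun j => coeff j (coeff i (f (i + j + 1))), ?_⟩
    intro n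
    rw [SModEq.sub_mem, smul_eq_mul, Ideal.mul_top, Ideal.span_singleton_pow,
      Ideal.mem_span_singleton, st_pow_dvd_iff]
    intro i j hij
    simp only [map_sub, coeff_mk, sub_eq_zero]
    rcases le_total n (i + j + 1) with h | h
    · exact hf' _ _ h i j hij
    · exact (hf' _ _ h i j (by omega)).symm

theorem exists_two_arc_lift {R A : Type*} [CommRing R] [CommRing A] [Algebra R A] [Algebra R k]
    [Algebra.FormallySmooth R A] (α β : A →ₐ[R] PowerSeries k)
    (hαβ : ∀ a, constantCoeff (α a) = constantCoeff (β a)) :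
    ∃ Φ : A →ₐ[R] PowerSeries (PowerSeries k), (∀ a, constantCoeff (Φ a) = α a) ∧
      (∀ a, PowerSeries.map constantCoeff (Φ a) = β a) := by
  let I : Ideal (PowerSeries (PowerSeries k)) :=
    Ideal.span {(X : PowerSeries (PowerSeries k)) * C X}
  have hI : ∀ F G : PowerSeries (PowerSeries k), constantCoeff F = constantCoeff G →
      PowerSeries.map constantCoeff F = PowerSeries.map constantCoeff G →
      Ideal.Quotient.mk I F = Ideal.Quotient.mk I G := by
    intro F G h1 h2
    rw [Ideal.Quotient.eq, Ideal.mem_span_singleton, ← pow_one (X * C X), st_pow_dvd_iff]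
    rintro i j (h | h)
    · obtain rfl : i = 0 := by omega
      simp [h1]
    · obtain rfl : j = 0 := by omega
      have := congrArg (coeff i) h2
      simpa [sub_eq_zero] using this
  let g : A → PowerSeries (PowerSeries k) := fun a =>
    C (α a) + PowerSeries.map C (β a) - C (C (constantCoeff (α a)))
  have hg1 : ∀ a, constantCoeff (g a) = α a := by
    intro a
    simp only [g, map_sub, map_add, constantCoeff_C]
    rw [← coeff_zero_eq_constantCoeff_apply, PowerSeries.coeff_map, coeff_zero_eq_constantCoeff_apply,
      hαβ]
    ring
  have hg2 : ∀ a, PowerSeries.map constantCoeff (g a) = β a := by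
    intro a
    simp only [g, map_sub, map_add, PowerSeries.map_C, constantCoeff_C]
    rw [add_sub_cancel_left]
    ext i
    simp
  have hmapC : ∀ r : R, PowerSeries.map (constantCoeff (R := k))
      (algebraMap R (PowerSeries (PowerSeries k)) r) = algebraMap R (PowerSeries k) r := by
    intro r
    simp [PowerSeries.algebraMap_apply]
  have hcC : ∀ r : R, constantCoeff
      (algebraMap R (PowerSeries (PowerSeries k)) r) = algebraMap R (PowerSeries k) r := by
    intro r
    simp [PowerSeries.algebraMap_apply]
  let f : A →ₐ[R] PowerSeries (PowerSeries k) ⧸ I :=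
    { toFun := fun a => Ideal.Quotient.mk I (g a)
      map_one' := by
        rw [← map_one (Ideal.Quotient.mk I)]
        exact hI _ _ (by simp [hg1]) (by rw [hg2]; simp)
      map_mul' := fun a b => by
        rw [← map_mul (Ideal.Quotient.mk I)]
        exact hI _ _ (by simp [hg1]) (by rw [hg2, map_mul, map_mul, hg2, hg2])
      map_zero' := by
        rw [← map_zero (Ideal.Quotient.mk I)]
        exact hI _ _ (by simp [hg1]) (by rw [hg2]; simp)
      map_add' := fun a b => by
        rw [← map_add (Ideal.Quotient.mk I)]
        exact hI _ _ (by simp [hg1]) (by rw [hg2, map_add, map_add, hg2, hg2])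
      commutes' := fun r => by
        change Ideal.Quotient.mk I _ = Ideal.Quotient.mk I _
        exact hI _ _ (by rw [hg1, hcC]; simp) (by rw [hg2, hmapC]; simp) }
  obtain ⟨Φ, hΦ⟩ := Algebra.FormallySmooth.exists_mkₐ_comp_eq_of_isAdicComplete f
  have hk : ∀ a, ∃ G, Φ a - g a = X * C X * G := by
    intro a
    have : Ideal.Quotient.mk I (Φ a) = Ideal.Quotient.mk I (g a) := DFunLike.congr_fun hΦ a
    rw [Ideal.Quotient.eq, Ideal.mem_span_singleton] at this
    exact this
  refine ⟨Φ, fun a => ?_, fun a => ?_⟩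
  · obtain ⟨G, hG⟩ := hk a
    rw [← hg1, ← sub_eq_zero, ← map_sub, hG]
    simp
  · obtain ⟨G, hG⟩ := hk a
    rw [← hg2, ← sub_eq_zero, ← map_sub, hG]
    simp
end PartThree

section PartFour
open PowerSeries

/-- Expansion in a uniformizer. -/
theorem exists_expansion {k W : Type*} [Field k] [CommRing W] [Algebra k W] (π : W)
    (hπ : ∀ a b, π * a = π * b → a = b) (ρ : W →ₐ[k] k) (hρ : ∀ w, ρ w = 0 ↔ ∃ v, w = π * v) :
    ∃ α : W →ₐ[k] PowerSeries k, (∀ w, constantCoeff (α w) = ρ w) ∧ α π = X := by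
  have h1 : ∀ w, ∃ v, w = algebraMap k W (ρ w) + π * v := by
    intro w
    obtain ⟨v, hv⟩ := (hρ (w - algebraMap k W (ρ w))).1 (by simp)
    exact ⟨v, by rw [← hv]; ring⟩
  choose T hT using h1
  have hTu : ∀ w c v, w = algebraMap k W c + π * v → T w = v := by
    intro w c v h
    have hc : ρ w = c := by
      have h0 : ρ (π * v) = 0 := (hρ _).2 ⟨v, rfl⟩
      rw [h, map_add, h0]; simp
    apply hπ
    have := hT w
    rw [hc] at this
    exact add_left_cancel (this.symm.trans h)
  have hTadd : ∀ a b, T (a + b) = T a + T b := by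
    intro a b
    apply hTu _ (ρ a + ρ b)
    conv_lhs => rw [hT a, hT b]
    rw [map_add]; ring
  have hTmul : ∀ a b, T (a * b) = algebraMap k W (ρ a) * T b + T a * b := by
    intro a b
    apply hTu _ (ρ a * ρ b)
    have ha := hT a
    have hb := hT b
    rw [map_mul]
    calc a * b = (algebraMap k W (ρ a) + π * T a) * b := by rw [← ha]
      _ = algebraMap k W (ρ a) * b + π * (T a * b) := by ring
      _ = algebraMap k W (ρ a) * (algebraMap k W (ρ b) + π * T b) + π * (T a * b) := by rw [← hb]
      _ = _ := by ring
  have hTc : ∀ c, T (algebraMap k W c) = 0 := fun c => hTu _ c 0 (by simp)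
  have hT0 : T 0 = 0 := by simpa using hTc 0
  let f : W → PowerSeries k := fun w => PowerSeries.mk fun n => ρ (T^[n] w)
  have hf0 : ∀ w, coeff 0 (f w) = ρ w := fun w => by simp [f]
  have hfs : ∀ w n, coeff (n + 1) (f w) = coeff n (f (T w)) := fun w n => by simp [f]
  have hfe : ∀ w, f w = C (ρ w) + X * f (T w) := by
    intro w
    ext n
    cases n with
    | zero => rw [hf0]; simp
    | succ n => rw [hfs, map_add, coeff_succ_X_mul, coeff_C, if_neg (by omega), zero_add]
  have hfadd : ∀ a b, f (a + b) = f a + f b := by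
    have : ∀ n a b, coeff n (f (a + b)) = coeff n (f a) + coeff n (f b) := by
      intro n
      induction n with
      | zero => intro a b; simp only [hf0, map_add]
      | succ n ih => intro a b; simp only [hfs, hTadd, ih]
    intro a b; ext n; rw [this, map_add]
  have hfz : f 0 = 0 := by
    have := hfadd 0 0
    simpa using this
  have hfc : ∀ c, f (algebraMap k W c) = C c := by
    intro c
    rw [hfe, hTc, hfz]; simp
  have hfmul : ∀ a b, f (a * b) = f a * f b := by
    have : ∀ n a b, coeff n (f (a * b)) = coeff n (f a * f b) := by
      intro n
      induction n with
      | zero => intro a b; rw [hf0, coeff_zero_eq_constantCoeff_apply, map_mul, map_mul, ← coeff_zero_eq_constantCoeff_apply, ← coeff_zero_eq_constantCoeff_apply, hf0, hf0]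
      | succ n ih =>
        intro a b
        rw [hfs, hTmul, hfadd, map_add, ih, ih, hfc, coeff_C_mul, hfe a, add_mul, map_add,
          coeff_C_mul, hfs, mul_assoc, coeff_succ_X_mul]
    intro a b; ext n; rw [this]
  refine ⟨{ toFun := f, map_one' := ?_, map_mul' := hfmul, map_zero' := hfz, map_add' := hfadd,
            commutes' := ?_ }, ?_, ?_⟩
  · have := hfc 1
    simpa using this
  · intro c
    rw [hfc]; simp [PowerSeries.algebraMap_apply]
  · intro w
    rw [← coeff_zero_eq_constantCoeff_apply]
    exact hf0 w
  · change f π = X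
    have hTπ : T π = 1 := hTu π 0 1 (by simp)
    have : ρ π = 0 := (hρ π).2 ⟨1, by simp⟩
    rw [hfe, hTπ, this]
    have h1 := hfc 1
    simp only [map_one] at h1
    rw [h1]; simp

end PartFour

section PartFive
set_option linter.style.haveILetI false
open PowerSeries

theorem arc_finish {k J D L : Type*} [Field k] [CommRing J] [Algebra k J] [CommRing D] [IsDomain D]
    [IsDedekindDomain D] [Algebra k D] [Field L] [Algebra D L] [IsFractionRing D L]
    (φ : J →+* L) (hφ : Function.Injective φ)
    (hk : ∀ c, φ (algebraMap k J c) = algebraMap D L (algebraMap k D c))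
    (n : Ideal D) [hnp : n.IsPrime] (ρD : D →ₐ[k] k) (hρD : ∀ d, ρD d = 0 ↔ d ∈ n)
    (e : J →ₐ[k] k) (q : J) (hq0 : q ≠ 0) (hqe : e q = 0)
    (hJ : ∀ j, ∃ r d : D, r ∉ n ∧ algebraMap D L r * φ j = algebraMap D L d ∧
      ρD d = ρD r * e j) :
    ∃ α : J →ₐ[k] PowerSeries k, (∀ a, constantCoeff (α a) = e a) ∧ α q ≠ 0 := by
  have hinj := IsFractionRing.injective D L
  have hn0 : n ≠ ⊥ := by
    obtain ⟨r, d, hr, h1, h2⟩ := hJ q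
    rw [hqe, mul_zero, hρD] at h2
    rintro rfl
    rw [Ideal.mem_bot] at h2 hr
    rw [h2, map_zero, mul_eq_zero] at h1
    rcases h1 with h1 | h1
    · exact hr (hinj (by rw [h1, map_zero]))
    · exact hq0 (hφ (by rw [h1, map_zero]))
  have hS : n.primeCompl ≤ nonZeroDivisors D := n.primeCompl_le_nonZeroDivisors
  let W := Localization.subalgebra.ofField L n.primeCompl hS
  have hWm : ∀ x : L, x ∈ W ↔ ∃ (a s : D) (_ : s ∈ n.primeCompl), x = algebraMap D L a * (algebraMap D L s)⁻¹ :=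
    fun x => Iff.rfl
  have : IsLocalization.AtPrime W n := Localization.subalgebra.isLocalization_ofField L n.primeCompl hS
  have : IsDiscreteValuationRing W :=
    IsLocalization.AtPrime.isDiscreteValuationRing_of_dedekind_domain D hn0 W
  letI : Algebra k W := ((algebraMap D W).comp (algebraMap k D)).toAlgebra
  have : IsScalarTower k D W := IsScalarTower.of_algebraMap_eq fun c => rfl
  have hu : ∀ y : n.primeCompl, IsUnit (ρD y) := fun y => by
    rw [isUnit_iff_ne_zero, Ne, hρD]; exact y.2
  let ρ : W →ₐ[k] k := IsLocalization.liftAlgHom (M := n.primeCompl) (f := ρD) hu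
  have hρ : ∀ d, ρ (algebraMap D W d) = ρD d := fun d => IsLocalization.lift_eq (M := n.primeCompl) (g := ρD.toRingHom) hu d
  obtain ⟨π, hπ⟩ := IsDiscreteValuationRing.exists_irreducible W
  have hker : RingHom.ker ρ.toRingHom = IsLocalRing.maximalIdeal W := by
    apply IsLocalRing.eq_maximalIdeal
    exact RingHom.ker_isMaximal_of_surjective _ (fun c => ⟨algebraMap k W c, by simp⟩)
  obtain ⟨α, hα, hαπ⟩ := exists_expansion π (fun a b h => mul_left_cancel₀ hπ.ne_zero h) ρ (by
    intro w
    have : ρ w = 0 ↔ w ∈ RingHom.ker ρ.toRingHom := Iff.rfl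
    rw [this, hker, hπ.maximalIdeal_eq, Ideal.mem_span_singleton]; rfl)
  have hmem : ∀ j, φ j ∈ W := by
    intro j
    obtain ⟨r, d, hr, h1, h2⟩ := hJ j
    have hr0 : algebraMap D L r ≠ 0 := fun h => hr (by
      rw [show r = 0 from hinj (by rw [h, map_zero])]; exact n.zero_mem)
    exact (hWm _).2 ⟨d, r, hr, by rw [← h1]; field_simp⟩
  let ψ0 : J →+* W := φ.codRestrict W hmem
  let ψ : J →ₐ[k] W := { ψ0 with commutes' := fun c => Subtype.ext (hk c) }
  have hψ : ∀ j, ρ (ψ j) = e j := by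
    intro j
    obtain ⟨r, d, hr, h1, h2⟩ := hJ j
    have h3 : algebraMap D W r * ψ j = algebraMap D W d := Subtype.ext h1
    have h4 := congrArg ρ h3
    rw [map_mul, hρ, hρ, h2] at h4
    exact mul_left_cancel₀ (fun h => hr ((hρD _).1 h)) h4
  refine ⟨α.comp ψ, fun a => by rw [AlgHom.comp_apply, hα, hψ], ?_⟩
  have hq : ψ q ≠ 0 := fun h => hq0 (hφ (by rw [map_zero]; exact congrArg Subtype.val h))
  obtain ⟨N, u, hNu⟩ := IsDiscreteValuationRing.eq_unit_mul_pow_irreducible hq hπ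
  rw [AlgHom.comp_apply, hNu, map_mul, map_pow, hαπ]
  exact mul_ne_zero (u.isUnit.map α).ne_zero (pow_ne_zero _ X_ne_zero)

theorem arc_one_dim {k J : Type*} [Field k] [IsAlgClosed k] [CharZero k] [CommRing J] [IsDomain J]
    [Algebra k J] [Algebra.FiniteType k J] (e : J →ₐ[k] k) (q : J) (hq0 : q ≠ 0)
    (hqe : e q = 0) (hmin : RingHom.ker e.toRingHom ∈ (Ideal.span {q}).minimalPrimes) :
    ∃ α : J →ₐ[k] PowerSeries k, (∀ a, constantCoeff (α a) = e a) ∧ α q ≠ 0 := by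
  classical
  set m : Ideal J := RingHom.ker e.toRingHom with hm
  have hme : ∀ x, x ∈ m ↔ e x = 0 := fun x => Iff.rfl
  have hmmax : m.IsMaximal := RingHom.ker_isMaximal_of_surjective _
    (fun c => ⟨algebraMap k J c, by simp⟩)
  have hmp : m.IsPrime := hmmax.isPrime
  have hNoeth : IsNoetherianRing J := Algebra.FiniteType.isNoetherianRing k J
  letI alg : Algebra (Polynomial k) J := (Polynomial.aeval q).toRingHom.toAlgebra
  have algX : algebraMap (Polynomial k) J Polynomial.X = q := by
    change Polynomial.aeval q Polynomial.X = q
    simp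
  have algC : ∀ c, algebraMap (Polynomial k) J (Polynomial.C c) = algebraMap k J c := by
    intro c
    change Polynomial.aeval q (Polynomial.C c) = _
    simp
  haveI tow : IsScalarTower k (Polynomial k) J := IsScalarTower.of_algebraMap_eq fun c => by
    rw [Polynomial.algebraMap_eq, algC]
  haveI ft : Algebra.FiniteType (Polynomial k) J := Algebra.FiniteType.of_restrictScalars_finiteType k _ _
  have hinj : Function.Injective (algebraMap (Polynomial k) J) := by
    change Function.Injective (Polynomial.aeval q)
    rw [← transcendental_iff_injective]
    intro halg
    have : IsIntegral k q := halg.isIntegral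
    haveI : Algebra.IsIntegral k (Algebra.adjoin k {q}) := Algebra.IsIntegral.adjoin (by simpa using this)
    obtain ⟨c, hc⟩ := (IsAlgClosed.algebraMap_bijective_of_isIntegral (k := k)
      (K := Algebra.adjoin k {q})).2 ⟨q, Algebra.subset_adjoin rfl⟩
    have hc' : algebraMap k J c = q := congrArg Subtype.val hc
    have : c = 0 := by
      have := congrArg e hc'
      simpa [hqe] using this
    apply hq0
    rw [← hc', this, map_zero]
  -- quasi-finiteness at m
  haveI qf : Algebra.QuasiFiniteAt (Polynomial k) m := by
    have key : IsOpen (X := PrimeSpectrum.comap (algebraMap (Polynomial k) J) ⁻¹'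
        {PrimeSpectrum.comap (algebraMap (Polynomial k) J) ⟨m, hmp⟩}) {⟨⟨m, hmp⟩, rfl⟩} := by
      have hfin : (Ideal.span {q}).minimalPrimes.Finite := Ideal.finite_minimalPrimes_of_isNoetherianRing _ _
      obtain ⟨f, hf1, hf2⟩ : ∃ f, f ∉ m ∧ ∀ P ∈ (Ideal.span {q}).minimalPrimes, P ≠ m → f ∈ P := by
        have hnot : ¬ (hfin.toFinset.erase m).inf id ≤ m := by
          intro hle
          rw [Ideal.IsPrime.inf_le' hmp] at hle
          obtain ⟨P, hP, hPm⟩ := hle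
          rw [Finset.mem_erase, Set.Finite.mem_toFinset] at hP
          exact hP.1 (le_antisymm hPm (hmin.2 hP.2.1 hPm))
        obtain ⟨f, hf1, hf2⟩ := Set.not_subset.1 hnot
        refine ⟨f, hf2, fun P hP hne => ?_⟩
        have : (hfin.toFinset.erase m).inf id ≤ P :=
          Finset.inf_le (f := id) (by rw [Finset.mem_erase, Set.Finite.mem_toFinset]; exact ⟨hne, hP⟩)
        exact this hf1
      rw [isOpen_induced_iff]
      refine ⟨PrimeSpectrum.basicOpen f, (PrimeSpectrum.basicOpen f).isOpen, ?_⟩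
      ext ⟨P, hP⟩
      simp only [Set.mem_preimage, SetLike.mem_coe, PrimeSpectrum.mem_basicOpen,
        Set.mem_singleton_iff, Subtype.mk.injEq]
      constructor
      · intro hfP
        have hqP : q ∈ P.asIdeal := by
          have h1 : Polynomial.X ∈ (PrimeSpectrum.comap (algebraMap (Polynomial k) J) ⟨m, hmp⟩).asIdeal := by
            rw [PrimeSpectrum.comap_asIdeal, Ideal.mem_comap, algX]
            exact hqe
          have h2 : PrimeSpectrum.comap (algebraMap (Polynomial k) J) P =
            PrimeSpectrum.comap (algebraMap (Polynomial k) J) ⟨m, hmp⟩ := hP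
          rw [← h2, PrimeSpectrum.comap_asIdeal, Ideal.mem_comap, algX] at h1
          exact h1
        obtain ⟨P', hP', hle⟩ := Ideal.exists_minimalPrimes_le (J := P.asIdeal)
          (I := Ideal.span {q}) (by simpa [Ideal.span_le] using hqP)
        have : P' = m := by
          by_contra hne
          exact hfP (hle (hf2 P' hP' hne))
        subst this
        exact Subtype.ext (PrimeSpectrum.ext (hmmax.eq_of_le P.isPrime.ne_top hle).symm)
      · intro h
        rw [show P = ⟨m, hmp⟩ from congrArg Subtype.val h]
        exact hf1
    exact Algebra.QuasiFiniteAt.of_isOpen_singleton_fiber (R := Polynomial k) ⟨m, hmp⟩ key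
  let L := FractionRing J
  haveI finL : Algebra.QuasiFinite (Polynomial k) L := by
    haveI : (⊥ : Ideal J).IsPrime := Ideal.isPrime_bot
    haveI : Algebra.QuasiFiniteAt (Polynomial k) (⊥ : Ideal J) :=
      Algebra.QuasiFiniteAt.of_le (bot_le : (⊥ : Ideal J) ≤ m)
    haveI : IsLocalization.AtPrime (Localization.AtPrime (⊥ : Ideal J)) (⊥ : Ideal J) := inferInstance
    have hh : (⊥ : Ideal J).primeCompl = nonZeroDivisors J := by
      ext x; simp [Ideal.primeCompl]
    haveI : IsLocalization (⊥ : Ideal J).primeCompl L := by rw [hh]; infer_instance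
    let E : Localization.AtPrime (⊥ : Ideal J) ≃ₐ[J] L :=
      IsLocalization.algEquiv (⊥ : Ideal J).primeCompl _ _
    exact (Algebra.QuasiFinite.iff_of_algEquiv (E.restrictScalars (Polynomial k))).1 ‹_›
  haveI : FaithfulSMul (Polynomial k) J := (faithfulSMul_iff_algebraMap_injective _ _).2 hinj
  have hinjL : Function.Injective (algebraMap (Polynomial k) L) := by
    rw [IsScalarTower.algebraMap_eq (Polynomial k) J L]
    exact (IsFractionRing.injective J L).comp hinj
  haveI : FaithfulSMul (Polynomial k) L := (faithfulSMul_iff_algebraMap_injective _ _).2 hinjL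
  let K := FractionRing (Polynomial k)
  letI : Algebra K L := FractionRing.liftAlgebra _ _
  haveI : Algebra.QuasiFinite K L := Algebra.QuasiFinite.of_restrictScalars (Polynomial k) K L
  haveI : FiniteDimensional K L := Module.Finite.of_quasiFinite
  haveI : CharZero K := charZero_of_injective_algebraMap (IsFractionRing.injective (Polynomial k) K)
  let D := integralClosure (Polynomial k) L
  haveI : IsDedekindDomain D := integralClosure.isDedekindDomain (Polynomial k) K L
  let D0 := integralClosure (Polynomial k) J
  -- the map D0 → D
  let ιD : D0 →+* D :=
    { toFun := fun d => ⟨algebraMap J L d.1, d.2.map (IsScalarTower.toAlgHom (Polynomial k) J L)⟩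
      map_one' := by ext; simp
      map_mul' := fun a b => by ext; simp
      map_zero' := by ext; simp
      map_add' := fun a b => by ext; simp }
  letI : Algebra D0 D := ιD.toAlgebra
  haveI : IsScalarTower (Polynomial k) D0 D := IsScalarTower.of_algebraMap_eq fun c => by
    apply Subtype.ext
    change algebraMap (Polynomial k) L c = algebraMap J L (algebraMap (Polynomial k) J c)
    rw [← IsScalarTower.algebraMap_apply]
  haveI : Algebra.IsIntegral (Polynomial k) D := integralClosure.AlgebraIsIntegral
  haveI : Algebra.IsIntegral D0 D := Algebra.IsIntegral.tower_top (R := Polynomial k)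
  have hιinj : Function.Injective ιD := by
    intro a b h
    apply Subtype.ext
    exact IsFractionRing.injective J L (congrArg Subtype.val h)
  let P0 : Ideal D0 := m.comap (algebraMap D0 J)
  haveI : P0.IsPrime := Ideal.IsPrime.comap _
  obtain ⟨n, hnp, hn⟩ := Ideal.exists_ideal_over_prime_of_isIntegral_of_isDomain (S := D) P0 (by
    exact ((RingHom.injective_iff_ker_eq_bot _).1 hιinj).le.trans bot_le)
  have hnmem : ∀ d : D0, ιD d ∈ n ↔ e d.1 = 0 := by
    intro d
    have : ιD d ∈ n ↔ d ∈ n.comap (algebraMap D0 D) := Iff.rfl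
    rw [this, hn]; rfl
  obtain ⟨r, hrm, hri, hrx⟩ := Algebra.zariskisMainProperty_iff.1
    (Algebra.ZariskisMainProperty.of_finiteType (R := Polynomial k) m)
  letI : Algebra k D := ((algebraMap (Polynomial k) D).comp Polynomial.C).toAlgebra
  have hqi : IsIntegral (Polynomial k) q := by
    rw [← algX]; exact isIntegral_algebraMap
  have hXn : algebraMap (Polynomial k) D Polynomial.X ∈ n := by
    have h := (hnmem ⟨q, hqi⟩).2 hqe
    convert h using 1
    apply Subtype.ext
    change algebraMap (Polynomial k) L Polynomial.X = algebraMap J L q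
    rw [IsScalarTower.algebraMap_apply (Polynomial k) J L, algX]
  have hhint : Algebra.IsIntegral k (D ⧸ n) := by
    constructor
    intro x
    obtain ⟨d, rfl⟩ := Ideal.Quotient.mk_surjective x
    obtain ⟨p, hp, hpd⟩ := Algebra.IsIntegral.isIntegral (R := Polynomial k) d
    refine ⟨p.map (Polynomial.evalRingHom 0), hp.map _, ?_⟩
    have h1 : (algebraMap k (D ⧸ n)).comp (Polynomial.evalRingHom 0) =
        (Ideal.Quotient.mk n).comp (algebraMap (Polynomial k) D) := by
      apply Polynomial.ringHom_ext
      · intro c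
        simp only [RingHom.comp_apply, Polynomial.coe_evalRingHom, Polynomial.eval_C]
        rfl
      · simp only [RingHom.comp_apply, Polynomial.coe_evalRingHom, Polynomial.eval_X, map_zero]
        exact (Ideal.Quotient.eq_zero_iff_mem.2 hXn).symm
    rw [Polynomial.eval₂_map, h1, ← Polynomial.hom_eval₂, hpd, map_zero]
  let E : k ≃ₐ[k] (D ⧸ n) := AlgEquiv.ofBijective (Algebra.ofId k (D ⧸ n))
    (IsAlgClosed.algebraMap_bijective_of_isIntegral (k := k) (K := D ⧸ n))
  let ρD : D →ₐ[k] k := E.symm.toAlgHom.comp (Ideal.Quotient.mkₐ k n)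
  have hρD : ∀ d, ρD d = 0 ↔ d ∈ n := by
    intro d
    change E.symm (Ideal.Quotient.mk n d) = 0 ↔ _
    rw [EmbeddingLike.map_eq_zero_iff, Ideal.Quotient.eq_zero_iff_mem]
  have hρe : ∀ d : D0, ρD (ιD d) = e d.1 := by
    intro d
    have hc : ∀ c : k, IsIntegral (Polynomial k) (algebraMap k J c) := fun c => by
      rw [← algC]; exact isIntegral_algebraMap
    have h1 : ιD (d - ⟨algebraMap k J (e d.1), hc _⟩) ∈ n := by
      rw [hnmem]; simp
    rw [← hρD, map_sub, map_sub, sub_eq_zero] at h1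
    rw [h1]
    have : ιD ⟨algebraMap k J (e d.1), hc _⟩ = algebraMap k D (e d.1) := by
      apply Subtype.ext
      change algebraMap J L _ = algebraMap (Polynomial k) L (Polynomial.C _)
      rw [IsScalarTower.algebraMap_apply (Polynomial k) J L, algC]
    rw [this, AlgHom.commutes]; rfl
  haveI : IsFractionRing D L := integralClosure.isFractionRing_of_finite_extension K L
  refine arc_finish (algebraMap J L) (IsFractionRing.injective J L) ?_ n ρD hρD e q hq0 hqe ?_
  · intro c
    change _ = algebraMap (Polynomial k) L (Polynomial.C _)
    rw [IsScalarTower.algebraMap_apply (Polynomial k) J L, algC]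
  · intro j
    obtain ⟨N, hN⟩ := hrx j
    refine ⟨ιD (⟨r, hri⟩ ^ N), ιD ⟨r ^ N * j, hN⟩, ?_, ?_, ?_⟩
    · rw [hnmem]
      simp only [SubmonoidClass.coe_pow, map_pow]
      exact pow_ne_zero _ hrm
    · change algebraMap J L _ * _ = algebraMap J L _
      simp
    · rw [hρe, hρe]; simp
end PartFive

section PartSix
open PowerSeries

theorem minimal_over_of_maximal {J : Type*} [CommRing J] [IsDomain J] [IsNoetherianRing J]
    (m : Ideal J) [hmp : m.IsPrime] (q : J) (hq0 : q ≠ 0) (hqm : q ∈ m)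
    (h : ∀ P : Ideal J, P.IsPrime → P ≤ m → P ≠ ⊥ → q ∈ P) :
    m ∈ (Ideal.span {q}).minimalPrimes := by
  classical
  by_contra hm
  have hfin : (Ideal.span {q}).minimalPrimes.Finite := Ideal.finite_minimalPrimes_of_isNoetherianRing _ _
  have hnot : ¬ (m : Set J) ⊆ ⋃ P ∈ ((hfin.toFinset : Finset (Ideal J)) : Set (Ideal J)), (P : Set J) := by
    intro hsub
    have := (Ideal.subset_union_prime (s := hfin.toFinset) (f := id) ⊥ ⊥ (by
      intro P hP _ _
      rw [Set.Finite.mem_toFinset] at hP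
      exact hP.1.1)).1 hsub
    obtain ⟨P, hP, hle⟩ := this
    rw [Set.Finite.mem_toFinset] at hP
    have hPm : m = P := le_antisymm hle (hP.2 ⟨hmp, by simpa [Ideal.span_le] using hqm⟩ hle)
    exact hm (hPm ▸ hP)
  obtain ⟨x, hxm, hx⟩ := Set.not_subset.1 hnot
  simp only [Set.Finite.coe_toFinset, Set.mem_iUnion, not_exists, SetLike.mem_coe] at hx
  obtain ⟨p2, hp2, hp2m⟩ := Ideal.exists_minimalPrimes_le (J := m) (I := Ideal.span {x})
    (by simpa [Ideal.span_le] using hxm)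
  have hp2p : p2.IsPrime := hp2.1.1
  have hx2 : x ∈ p2 := hp2.1.2 (Ideal.mem_span_singleton_self x)
  have hx0 : x ≠ 0 := by
    rintro rfl
    obtain ⟨P, hP, -⟩ := Ideal.exists_minimalPrimes_le (J := m) (I := Ideal.span {q})
      (by simpa [Ideal.span_le] using hqm)
    exact hx P hP P.zero_mem
  have hq2 : q ∈ p2 := h p2 hp2p hp2m (fun hb => hx0 (by rw [hb] at hx2; exact hx2))
  obtain ⟨p3, hp3, hp32⟩ := Ideal.exists_minimalPrimes_le (J := p2) (I := Ideal.span {q})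
    (by simpa [Ideal.span_le] using hq2)
  have hp3p : p3.IsPrime := hp3.1.1
  have hlt : p3 < p2 := lt_of_le_of_ne hp32 (fun he => hx p3 hp3 (he ▸ hx2))
  have h1 := Ideal.height_le_one_of_isPrincipal_of_mem_minimalPrimes (Ideal.span {x}) p2 hp2
  have h2 : p3.height < 1 := Ideal.height_le_iff.1 h1 p3 hp3p hlt
  have h3 : p3.height = 0 := by simpa using h2
  have h4 : p3 = ⊥ := by
    rw [Ideal.height_eq_zero_iff] at h3
    rw [IsDomain.minimalPrimes_eq_singleton_bot] at h3
    exact h3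
  have : q ∈ p3 := hp3.1.2 (Ideal.mem_span_singleton_self q)
  rw [h4] at this
  exact hq0 this

theorem exists_arc {k C : Type*} [Field k] [IsAlgClosed k] [CharZero k] [CommRing C]
    [Algebra k C] [Algebra.FiniteType k C] (e : C →ₐ[k] k) (q : C)
    (hq : ∀ r, ∀ n : ℕ, r * q ^ n = 0 → e r = 0) :
    ∃ α : C →ₐ[k] PowerSeries k, (∀ a, constantCoeff (α a) = e a) ∧ α q ≠ 0 := by
  by_cases hqe : e q = 0
  swap
  · refine ⟨(Algebra.ofId k (PowerSeries k)).comp e, fun a => ?_, fun h => hqe ?_⟩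
    · change constantCoeff (algebraMap k (PowerSeries k) (e a)) = e a
      simp
    · have := congrArg constantCoeff h
      change constantCoeff (algebraMap k (PowerSeries k) (e q)) = constantCoeff 0 at this
      simpa using this
  have hNoeth : IsNoetherianRing C := Algebra.FiniteType.isNoetherianRing k C
  let m : Ideal C := RingHom.ker e.toRingHom
  have hmp : m.IsPrime := RingHom.ker_isPrime _
  have hme : ∀ x, x ∈ m ↔ e x = 0 := fun x => Iff.rfl
  let S : Set (Ideal C) := {P | P.IsPrime ∧ P ≤ m ∧ q ∉ P}
  have hS : S.Nonempty := by
    obtain ⟨p, hp, -, hd⟩ := Ideal.exists_le_prime_disjoint (⊥ : Ideal C) (m.primeCompl ⊔ Submonoid.powers q) (by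
      rw [Set.disjoint_left]
      intro x hx hx'
      rw [SetLike.mem_coe, Ideal.mem_bot] at hx
      subst hx
      obtain ⟨r, hr, y, ⟨n, rfl⟩, hry⟩ := Submonoid.mem_sup.1 hx'
      exact hr (hq r n hry))
    rw [Set.disjoint_left] at hd
    refine ⟨p, hp, fun x hx => ?_, fun hqp => ?_⟩
    · by_contra hxm
      exact hd hx (Submonoid.mem_sup_left (S := m.primeCompl) (T := Submonoid.powers q) hxm)
    · exact hd hqp (Submonoid.mem_sup_right (S := m.primeCompl) (T := Submonoid.powers q) (Submonoid.mem_powers q))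
  obtain ⟨P, ⟨hPp, hPm, hqP⟩, hPmax⟩ := set_has_maximal_iff_noetherian.2 hNoeth S hS
  let J := C ⧸ P
  have : Algebra.FiniteType k J := inferInstance
  let eJ : J →ₐ[k] k := Ideal.Quotient.liftₐ P e (fun a ha => hPm ha)
  have heJ : ∀ c, eJ (Ideal.Quotient.mk P c) = e c := fun c => rfl
  have hkp : (RingHom.ker eJ.toRingHom).IsPrime := RingHom.ker_isPrime _
  have hNJ : IsNoetherianRing J := inferInstance
  obtain ⟨α, hα, hαq⟩ := arc_one_dim eJ (Ideal.Quotient.mk P q)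
    (fun h => hqP (Ideal.Quotient.eq_zero_iff_mem.1 h)) hqe
    (minimal_over_of_maximal _ _ (fun h => hqP (Ideal.Quotient.eq_zero_iff_mem.1 h)) hqe (by
      intro Q hQ hQm hQ0
      by_contra hqQ
      have hle : P ≤ Q.comap (Ideal.Quotient.mk P) := by
        intro x hx
        rw [Ideal.mem_comap, Ideal.Quotient.eq_zero_iff_mem.2 hx]
        exact Q.zero_mem
      refine hPmax (Q.comap (Ideal.Quotient.mk P)) ⟨hQ.comap _, fun x hx => hQm hx, hqQ⟩ (lt_of_le_of_ne hle ?_)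
      intro he
      apply hQ0
      rw [eq_bot_iff]
      intro x hx
      obtain ⟨c, rfl⟩ := Ideal.Quotient.mk_surjective x
      rw [Ideal.mem_bot, Ideal.Quotient.eq_zero_iff_mem, he]
      exact hx))
  refine ⟨α.comp (Ideal.Quotient.mkₐ k P), fun a => ?_, hαq⟩
  rw [AlgHom.comp_apply, hα]; rfl

/-- Arcs for a finitely generated domain over a smaller field. -/
theorem exists_arc_of_domain {F k A : Type*} [Field F] [Field k] [IsAlgClosed k] [CharZero k] [Algebra F k]
    [CommRing A] [IsDomain A] [Algebra F A] [Algebra.FiniteType F A] (e : A →ₐ[F] k) (q : A) (hq : q ≠ 0) :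
    ∃ α : A →ₐ[F] PowerSeries k, (∀ a, constantCoeff (α a) = e a) ∧ α q ≠ 0 := by
  let C := TensorProduct F k A
  let eC : C →ₐ[k] k := Algebra.TensorProduct.lift (AlgHom.id k k) e (fun _ _ => Commute.all _ _)
  obtain ⟨α, hα, hαq⟩ := exists_arc eC ((1 : k) ⊗ₜ[F] q : C) (by
    intro r n h
    have hreg : IsSMulRegular A (q ^ n) := fun a b hab => mul_left_cancel₀ (pow_ne_zero n hq) hab
    have h2 : Function.Injective (LinearMap.lTensor k (LinearMap.mulLeft F (q ^ n))) := by
      apply Module.Flat.lTensor_preserves_injective_linearMap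
      exact fun a b hab => hreg hab
    have h3 : ∀ r : C, LinearMap.lTensor k (LinearMap.mulLeft F (q ^ n)) r = r * ((1 : k) ⊗ₜ[F] q : C) ^ n := by
      intro r
      induction r using TensorProduct.induction_on with
      | zero => simp
      | tmul x y =>
        rw [Algebra.TensorProduct.tmul_pow, one_pow]
        refine Eq.trans ?_ (Algebra.TensorProduct.tmul_mul_tmul _ _ _ _).symm
        rw [LinearMap.lTensor_tmul, mul_one, mul_comm, LinearMap.mulLeft_apply]
      | add x y hx hy => rw [map_add, hx, hy, add_mul]
    have : r = 0 := h2 (by rw [h3, h, map_zero])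
    rw [this, map_zero])
  refine ⟨(α.restrictScalars F).comp Algebra.TensorProduct.includeRight, fun a => ?_, hαq⟩
  change constantCoeff (α _) = _
  rw [hα]
  refine (Algebra.TensorProduct.lift_tmul _ _ _ _ _).trans ?_
  rw [map_one, one_mul]
end PartSix

section PartSeven
set_option linter.style.haveILetI false
open TensorProduct

theorem etale_normal {R S K : Type*} [CommRing R] [IsDomain R] [IsIntegrallyClosed R] [CommRing S]
    [IsDomain S] [Algebra R S] [Algebra.Etale R S] [Field K] [Algebra S K] [IsFractionRing S K]
    (x : K) (hx : IsIntegral S x) : ∃ s, algebraMap S K s = x := by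
  have hflat : Module.Flat R S := inferInstance
  have hinj : Function.Injective (algebraMap R S) := by
    rw [injective_iff_map_eq_zero]
    intro r hr
    by_contra hr0
    have h1 : Function.Injective (LinearMap.lTensor S (LinearMap.mulLeft R r)) :=
      Module.Flat.lTensor_preserves_injective_linearMap _ (fun a b h => mul_left_cancel₀ hr0 h)
    have h2 : (1 : S) ⊗ₜ[R] (1 : R) = 0 := h1 (by
      rw [map_zero, LinearMap.lTensor_tmul, LinearMap.mulLeft_apply]
      rw [← smul_eq_mul, TensorProduct.tmul_smul, TensorProduct.smul_tmul', Algebra.smul_def, hr, zero_mul, TensorProduct.zero_tmul])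
    have h3 := congrArg (Algebra.TensorProduct.rid R R S) h2
    simp at h3
  let K0 := FractionRing R
  letI : Algebra R K := ((algebraMap S K).comp (algebraMap R S)).toAlgebra
  have : IsScalarTower R S K := IsScalarTower.of_algebraMap_eq fun _ => rfl
  have hRK : Function.Injective (algebraMap R K) := (IsFractionRing.injective S K).comp hinj
  let j : K0 →ₐ[R] K := IsFractionRing.liftAlgHom (g := Algebra.ofId R K) hRK
  let ψ : S ⊗[R] K0 →ₐ[S] K := Algebra.TensorProduct.lift (Algebra.ofId S K) j (fun _ _ => Commute.all _ _)
  have hψt : ∀ s c, ψ (s ⊗ₜ c) = algebraMap S K s * j c := fun s c => by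
    simp [ψ, Algebra.ofId_apply]
  have hform : ∀ y : S ⊗[R] K0, ∃ (s : S) (r : R), r ≠ 0 ∧ (algebraMap R S r) • y = s ⊗ₜ 1 := by
    intro y
    induction y using TensorProduct.induction_on with
    | zero => exact ⟨0, 1, one_ne_zero, by simp⟩
    | tmul s c =>
      obtain ⟨a, b, hb, rfl⟩ := IsFractionRing.div_surjective (A := R) c
      have hb0 := nonZeroDivisors.ne_zero hb
      refine ⟨algebraMap R S a * s, b, hb0, ?_⟩
      rw [algebraMap_smul, ← TensorProduct.tmul_smul, Algebra.smul_def]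
      have : algebraMap R K0 b ≠ 0 := by simpa using hb0
      rw [mul_div_cancel₀ _ this, ← Algebra.smul_def, Algebra.algebraMap_eq_smul_one, TensorProduct.smul_tmul]
    | add y z hy hz =>
      obtain ⟨s, r, hr, h⟩ := hy
      obtain ⟨s', r', hr', h'⟩ := hz
      refine ⟨algebraMap R S r' * s + algebraMap R S r * s', r * r', mul_ne_zero hr hr', ?_⟩
      rw [TensorProduct.add_tmul, smul_add, map_mul, mul_smul, mul_smul, h', smul_comm, h,
        TensorProduct.smul_tmul', TensorProduct.smul_tmul', smul_eq_mul, smul_eq_mul]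
  have hψinj : Function.Injective ψ := by
    rw [injective_iff_map_eq_zero]
    intro y hy
    obtain ⟨s, r, hr, h⟩ := hform y
    have hrS : algebraMap R S r ≠ 0 := by simpa using hinj.ne hr
    have hs : s = 0 := by
      have := congrArg ψ h
      rw [map_smul, hy, smul_zero, hψt, map_one, mul_one] at this
      exact IsFractionRing.injective S K (by rw [map_zero, ← this])
    rw [hs, TensorProduct.zero_tmul] at h
    -- multiply by the inverse
    have h2 : ((1 : S) ⊗ₜ[R] (algebraMap R K0 r)⁻¹ : S ⊗[R] K0) * ((algebraMap R S r) • y) = y := by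
      have hr0 : algebraMap R K0 r ≠ 0 := by simpa using hr
      rw [← one_mul y, ← smul_mul_assoc, Algebra.TensorProduct.one_def, TensorProduct.smul_tmul',
        ← mul_assoc, Algebra.TensorProduct.tmul_mul_tmul, mul_one, one_mul, smul_eq_mul, mul_one,
        Algebra.algebraMap_eq_smul_one, TensorProduct.smul_tmul, Algebra.smul_def, mul_inv_cancel₀ hr0]
    rw [← h2, h, mul_zero]
  have hdom : IsDomain (K0 ⊗[R] S) :=
    Function.Injective.isDomain (ψ.toRingHom.comp (Algebra.TensorProduct.comm R K0 S).toRingHom)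
     (hψinj.comp (Algebra.TensorProduct.comm R K0 S).injective)
  have hfin : Module.Finite K0 (K0 ⊗[R] S) := Algebra.FormallyUnramified.finite_of_free _ _
  have hfield : IsField (K0 ⊗[R] S) := isField_of_isIntegral_of_isField' (Field.toIsField K0)
  have hfield2 : IsField (S ⊗[R] K0) := (Algebra.TensorProduct.comm R S K0).toMulEquiv.isField hfield
  have hsurj : ∃ y, ψ y = x := by
    obtain ⟨a, b, hb, rfl⟩ := IsFractionRing.div_surjective (A := S) x
    have hb0 := nonZeroDivisors.ne_zero hb
    have hbK : algebraMap S K b ≠ 0 := fun h => hb0 (IsFractionRing.injective S K (by rw [h, map_zero]))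
    obtain ⟨c, hc⟩ := hfield2.mul_inv_cancel (a := algebraMap S (S ⊗[R] K0) b) (fun h => hbK (by
      rw [← ψ.commutes, h, map_zero]))
    refine ⟨algebraMap S _ a * c, ?_⟩
    have := congrArg ψ hc
    rw [map_mul, map_one, ψ.commutes] at this
    rw [map_mul, ψ.commutes, eq_div_iff hbK, mul_assoc, mul_comm (ψ c), this, mul_one]
  obtain ⟨y, rfl⟩ := hsurj
  have hy : IsIntegral S y := (isIntegral_algHom_iff ψ hψinj).1 hx
  obtain ⟨z, hz⟩ := (TensorProduct.toIntegralClosure_bijective_of_smooth (R := R) (S := S) (B := K0)).2 ⟨y, hy⟩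
  have hz' : (Algebra.TensorProduct.map (AlgHom.id S S) (integralClosure R K0).val) z = y := congrArg Subtype.val hz
  rw [← hz']
  clear hz hz'
  induction z using TensorProduct.induction_on with
  | zero => exact ⟨0, by simp⟩
  | tmul s c =>
    obtain ⟨r, hr⟩ := (IsIntegrallyClosed.isIntegral_iff (R := R) (K := K0)).1 c.2
    refine ⟨s * algebraMap R S r, ?_⟩
    rw [Algebra.TensorProduct.map_tmul, hψt, map_mul]
    congr 1
    have : (integralClosure R K0).val c = algebraMap R K0 r := hr.symm
    rw [this, j.commutes]; rfl
  | add a b ha hb =>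
    obtain ⟨s, hs⟩ := ha
    obtain ⟨t, ht⟩ := hb
    exact ⟨s + t, by rw [map_add, hs, ht, map_add, map_add]⟩


theorem smooth_normal {F A K : Type*} [Field F] [CommRing A]
    [IsDomain A] [Algebra F A] [Algebra.Smooth F A] [Field K] [Algebra A K] [IsFractionRing A K]
    (x : K) (hx : IsIntegral A x) : ∃ s, algebraMap A K s = x := by
  let J : Ideal A :=
    { carrier := {a | ∃ s, algebraMap A K s = algebraMap A K a * x}
      add_mem' := by
        rintro a b ⟨s, hs⟩ ⟨t, ht⟩
        exact ⟨s + t, by rw [map_add, hs, ht, map_add, add_mul]⟩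
      zero_mem' := ⟨0, by simp⟩
      smul_mem' := by
        rintro c a ⟨s, hs⟩
        exact ⟨c * s, by rw [smul_eq_mul, map_mul, hs, map_mul, mul_assoc]⟩ }
  have hJ : J = ⊤ := by
    by_contra hne
    obtain ⟨m, hm, hJm⟩ := Ideal.exists_le_maximal J hne
    have hmp := hm.isPrime
    obtain ⟨f, hfm, n, alg, tow, et⟩ :=
      Algebra.IsSmoothAt.exists_isStandardEtale_mvPolynomial (R := F) (p := m)
    have hf0 : f ≠ 0 := fun h => hfm (h ▸ m.zero_mem)
    have hpow : Submonoid.powers f ≤ nonZeroDivisors A := powers_le_nonZeroDivisors_of_noZeroDivisors hf0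
    have hu : ∀ y : Submonoid.powers f, IsUnit (algebraMap A K y) := fun y => by
      rw [isUnit_iff_ne_zero]
      exact IsFractionRing.to_map_ne_zero_of_mem_nonZeroDivisors (hpow y.2)
    letI : Algebra (Localization.Away f) K := (IsLocalization.lift (M := Submonoid.powers f) hu).toAlgebra
    haveI : IsScalarTower A (Localization.Away f) K := IsScalarTower.of_algebraMap_eq fun a =>
      (IsLocalization.lift_eq (M := Submonoid.powers f) hu a).symm
    haveI : IsFractionRing (Localization.Away f) K :=
      IsFractionRing.isFractionRing_of_isDomain_of_isLocalization (Submonoid.powers f) _ _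
    haveI : IsDomain (Localization.Away f) := IsLocalization.isDomain_localization hpow
    haveI : Algebra.Etale (MvPolynomial (Fin n) F) (Localization.Away f) := inferInstance
    obtain ⟨s, hs⟩ := etale_normal (R := MvPolynomial (Fin n) F) (S := Localization.Away f) x hx.tower_top
    obtain ⟨a, y, rfl⟩ := IsLocalization.exists_mk'_eq (Submonoid.powers f) s
    have : (y : A) ∈ J := by
      refine ⟨a, ?_⟩
      rw [← hs, IsScalarTower.algebraMap_apply A (Localization.Away f) K,
        IsScalarTower.algebraMap_apply A (Localization.Away f) K, ← map_mul, IsLocalization.mk'_spec']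
    obtain ⟨N, hN⟩ := y.2
    simp only at hN
    rw [← hN] at this
    exact hfm (hmp.mem_of_pow_mem N (hJm this))
  have h1 : (1 : A) ∈ J := by rw [hJ]; trivial
  obtain ⟨s, hs⟩ := h1
  exact ⟨s, by rw [hs, map_one, one_mul]⟩

/-- If h is not regular at p, there is a point over p where `h⁻¹` vanishes. -/
theorem exists_pole_point {A K : Type*} [CommRing A] [IsDomain A] [Field K] [Algebra A K] [IsFractionRing A K]
    (hnorm : ∀ x : K, IsIntegral A x → ∃ s, algebraMap A K s = x)
    (p : Ideal A) [hp : p.IsPrime] (h : K) (hh : ∀ s a : A, s ∉ p → algebraMap A K s * h ≠ algebraMap A K a) :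
    ∃ V : ValuationSubring K, (∀ a : A, algebraMap A K a ∈ V) ∧
      (∀ a : A, V.valuation (algebraMap A K a) < 1 ↔ a ∈ p) ∧ V.valuation h⁻¹ < 1 ∧ h ≠ 0 := by
  let A0 : Subring K := (algebraMap A K).range
  let E : A ≃+* A0 := RingEquiv.ofBijective (algebraMap A K).rangeRestrict
    ⟨fun a b hab => IsFractionRing.injective A K (congrArg Subtype.val hab), (algebraMap A K).rangeRestrict_surjective⟩
  let P : Ideal A0 := p.comap E.symm.toRingHom
  have hPp : P.IsPrime := Ideal.IsPrime.comap _
  have hmemP : ∀ a : A, E a ∈ P ↔ a ∈ p := fun a => by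
    change E.symm (E a) ∈ p ↔ _
    rw [E.symm_apply_apply]
  have hEv : ∀ a : A, ((E a : A0) : K) = algebraMap A K a := fun a => rfl
  let R := LocalSubring.ofPrime A0 P
  have hRmem : ∀ x : K, (∃ s a : A, s ∉ p ∧ algebraMap A K s * x = algebraMap A K a) ↔ x ∈ R.toSubring := by
    intro x
    constructor
    · rintro ⟨s, a, hs, hsa⟩
      have hu := IsLocalization.map_units R.toSubring (⟨E s, fun hx => hs ((hmemP s).1 hx)⟩ : P.primeCompl)
      obtain ⟨v, hv⟩ := isUnit_iff_exists_inv.1 hu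
      have hv' : algebraMap A K s * (v : K) = 1 := congrArg Subtype.val hv
      have : x = algebraMap A0 R.toSubring (E a) * v := by
        change x = algebraMap A K a * v
        rw [← hsa, mul_right_comm, hv', one_mul]
      rw [this]
      exact (algebraMap A0 R.toSubring (E a) * v).2
    · intro hx
      obtain ⟨a, s, hs⟩ := IsLocalization.exists_mk'_eq P.primeCompl (⟨x, hx⟩ : R.toSubring)
      refine ⟨E.symm s, E.symm a, s.2, ?_⟩
      have h1 := IsLocalization.mk'_spec' R.toSubring a s
      rw [hs] at h1
      have h2 : ((s : A0) : K) * x = (a : K) := congrArg Subtype.val h1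
      rw [← hEv, ← hEv, E.apply_symm_apply, E.apply_symm_apply, h2]
  have hic : IsIntegrallyClosedIn R.toSubring K := by
    rw [isIntegrallyClosedIn_iff]
    refine ⟨Subtype.val_injective, fun {x} hx => ?_⟩
    obtain ⟨t, ht⟩ := IsIntegral.exists_multiple_integral_of_isLocalization P.primeCompl x hx
    have ht' : IsIntegral A (((t : A0) : K) * x) := by
      obtain ⟨g, hg, hgx⟩ := ht
      refine ⟨g.map E.symm.toRingHom, hg.map _, ?_⟩
      rw [Polynomial.eval₂_map]
      have : (algebraMap A K).comp E.symm.toRingHom = algebraMap A0 K := by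
        ext a
        change algebraMap A K (E.symm a) = _
        rw [← hEv, E.apply_symm_apply]; rfl
      rw [this]; exact hgx
    obtain ⟨s, hs⟩ := hnorm _ ht'
    have := (hRmem x).1 ⟨E.symm t, s, t.2, by rw [hs, ← hEv, E.apply_symm_apply]⟩
    exact ⟨⟨x, this⟩, rfl⟩
  obtain ⟨V, hV, hhV⟩ := LocalSubring.exists_le_valuationSubring_of_isIntegrallyClosedIn (R := R) (x := h)
    (fun hR => by
      obtain ⟨s, a, hs, hsa⟩ := (hRmem h).2 hR
      exact hh s a hs hsa)
  have hAV : ∀ a : A, algebraMap A K a ∈ V := fun a => hV.1 (LocalSubring.le_ofPrime A0 P ⟨a, rfl⟩)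
  have hh0 : h ≠ 0 := fun h0 => hhV (h0 ▸ V.zero_mem)
  refine ⟨V, hAV, fun a => ?_, ?_, hh0⟩
  · obtain ⟨hle, hloc⟩ := hV
    have key : ∀ a : A, IsUnit (algebraMap A0 R.toSubring (E a)) ↔ a ∉ p := fun a => by
      rw [IsLocalization.AtPrime.isUnit_to_map_iff R.toSubring P (E a)]
      change E a ∉ P ↔ _
      rw [hmemP]
    have k2 : IsUnit (Subring.inclusion hle (algebraMap A0 R.toSubring (E a))) ↔ IsUnit (algebraMap A0 R.toSubring (E a)) :=
      ⟨fun hx => hloc.map_nonunit _ hx, fun hx => hx.map _⟩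
    have k3 := V.valuation_lt_one_iff ⟨algebraMap A K a, hAV a⟩
    have k4 : ¬ IsUnit (⟨algebraMap A K a, hAV a⟩ : V) ↔ a ∈ p := by
      rw [← not_iff_not, not_not, ← key, ← k2]; rfl
    rw [← k4]
    rw [← k3]
    exact IsLocalRing.mem_maximalIdeal _
  · rw [map_inv₀]
    have : 1 < V.valuation h := by
      rw [← not_le, V.valuation_le_one_iff]; exact hhV
    exact inv_lt_one_of_one_lt₀ this

end PartSeven

section PartEight
set_option linter.style.haveILetI false
open PowerSeries

theorem exists_amalgam_field (κ k1 k2 : Type) [Field κ] [Field k1] [Field k2] [Algebra κ k1] [Algebra κ k2] :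
    ∃ (k : Type) (_ : Field k) (_ : IsAlgClosed k) (j1 : k1 →+* k) (j2 : k2 →+* k),
      ∀ a, j1 (algebraMap κ k1 a) = j2 (algebraMap κ k2 a) := by
  obtain ⟨m, hm⟩ := Ideal.exists_maximal (TensorProduct κ k1 k2)
  letI : Field (TensorProduct κ k1 k2 ⧸ m) := Ideal.Quotient.field m
  let q : TensorProduct κ k1 k2 →+* AlgebraicClosure (TensorProduct κ k1 k2 ⧸ m) :=
    (algebraMap _ _).comp (Ideal.Quotient.mk m)
  refine ⟨AlgebraicClosure (TensorProduct κ k1 k2 ⧸ m), inferInstance, inferInstance,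
    q.comp (Algebra.TensorProduct.includeLeftRingHom),
    q.comp (Algebra.TensorProduct.includeRight (R := κ) (A := k1) (B := k2)).toRingHom, fun a => ?_⟩
  change q (algebraMap κ k1 _ ⊗ₜ 1) = q (1 ⊗ₜ algebraMap κ k2 _)
  rw [Algebra.algebraMap_eq_smul_one, Algebra.algebraMap_eq_smul_one, TensorProduct.smul_tmul]

theorem exists_amalgam {A k1 k2 : Type} [CommRing A] [Field k1] [Field k2] (e1 : A →+* k1) (e2 : A →+* k2)
    (h : ∀ a, e1 a = 0 ↔ e2 a = 0) :
    ∃ (k : Type) (_ : Field k) (_ : IsAlgClosed k) (j1 : k1 →+* k) (j2 : k2 →+* k), ∀ a, j1 (e1 a) = j2 (e2 a) := by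
  let p := RingHom.ker e1
  have hp : p.IsPrime := RingHom.ker_isPrime e1
  let f1 : A ⧸ p →+* k1 := Ideal.Quotient.lift p e1 (fun a ha => ha)
  let f2 : A ⧸ p →+* k2 := Ideal.Quotient.lift p e2 (fun a ha => (h a).1 ha)
  have hf1 : Function.Injective f1 := by
    rw [injective_iff_map_eq_zero]
    intro x hx
    obtain ⟨a, rfl⟩ := Ideal.Quotient.mk_surjective x
    exact Ideal.Quotient.eq_zero_iff_mem.2 hx
  have hf2 : Function.Injective f2 := by
    rw [injective_iff_map_eq_zero]
    intro x hx
    obtain ⟨a, rfl⟩ := Ideal.Quotient.mk_surjective x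
    exact Ideal.Quotient.eq_zero_iff_mem.2 ((h a).2 hx)
  let κ := FractionRing (A ⧸ p)
  let g1 : κ →+* k1 := IsFractionRing.lift hf1
  let g2 : κ →+* k2 := IsFractionRing.lift hf2
  letI : Algebra κ k1 := g1.toAlgebra
  letI : Algebra κ k2 := g2.toAlgebra
  obtain ⟨k, i1, i2, j1, j2, hj⟩ := exists_amalgam_field κ k1 k2
  refine ⟨k, i1, i2, j1, j2, fun a => ?_⟩
  have h1 : e1 a = algebraMap κ k1 (algebraMap (A ⧸ p) κ (Ideal.Quotient.mk p a)) := by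
    change f1 (Ideal.Quotient.mk p a) = g1 _
    exact (IsFractionRing.lift_algebraMap (K := κ) hf1 _).symm
  have h2 : e2 a = algebraMap κ k2 (algebraMap (A ⧸ p) κ (Ideal.Quotient.mk p a)) := by
    change f2 (Ideal.Quotient.mk p a) = g2 _
    exact (IsFractionRing.lift_algebraMap (K := κ) hf2 _).symm
  rw [h1, h2, hj]

theorem newton_extend {F A K k ι : Type} [Field F] [CommRing A] [IsDomain A] [Algebra F A] [Field K] [Algebra A K]
    [IsFractionRing A K] [Algebra F K] [IsScalarTower F A K] [Field k] [Algebra F k]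
    (h : ι → K) (Q : A) (P : ι → A) (hQ0 : Q ≠ 0) (hP : ∀ i, h i * algebraMap A K Q = algebraMap A K (P i))
    (Ω : A →+* PowerSeries (Polynomial k)) (hΩ : ∀ c, Ω (algebraMap F A c) = C (Polynomial.C (algebraMap F k c)))
    (e : ℕ) (Q' : PowerSeries (Polynomial k)) (N' : ι → PowerSeries (Polynomial k)) (θ : ι → k)
    (h1 : Ω Q = X ^ e * Q') (h2 : ∀ i, Ω (P i) = C (Polynomial.C (θ i)) * Ω Q + X ^ e * N' i)
    (h3 : constantCoeff Q' ≠ 0) :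
    ∃ ψ : Algebra.adjoin F (Set.range h) →ₐ[F] RatFunc k,
      ∀ i, ψ ⟨h i, Algebra.subset_adjoin ⟨i, rfl⟩⟩ =
        RatFunc.C (θ i) + algebraMap _ (RatFunc k) (constantCoeff (N' i)) / algebraMap _ (RatFunc k) (constantCoeff Q') := by
  let PS := PowerSeries (RatFunc k)
  let LS := FractionRing PS
  let μ : PowerSeries (Polynomial k) →+* PS := PowerSeries.map (algebraMap (Polynomial k) (RatFunc k))
  let ν : PS →+* LS := algebraMap PS LS
  have hν : Function.Injective ν := IsFractionRing.injective PS LS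
  have hinj : Function.Injective (algebraMap (Polynomial k) (RatFunc k)) := IsFractionRing.injective _ _
  have hμ0 : ∀ x, constantCoeff (μ x) = algebraMap (Polynomial k) (RatFunc k) (constantCoeff x) := by
    intro x
    rw [← PowerSeries.coeff_zero_eq_constantCoeff_apply, ← PowerSeries.coeff_zero_eq_constantCoeff_apply]
    exact PowerSeries.coeff_map _ _ _
  have hμC : ∀ c : k, μ (C (Polynomial.C c)) = C (RatFunc.C c) := by
    intro c
    ext n
    change coeff n (PowerSeries.map _ _) = _
    rw [PowerSeries.coeff_map, PowerSeries.coeff_C, PowerSeries.coeff_C]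
    split_ifs
    · exact RatFunc.algebraMap_C _
    · simp
  have hQ'0 : constantCoeff (μ Q') ≠ 0 := by
    rw [hμ0]
    intro h0
    exact h3 (hinj (by rw [h0, map_zero]))
  have hμX : μ X = X := PowerSeries.map_X _
  have hQu : μ Q' * (μ Q')⁻¹ = 1 := PowerSeries.mul_inv_cancel _ hQ'0
  have hμQ0 : μ (Ω Q) ≠ 0 := by
    rw [h1, map_mul, map_pow, hμX]
    refine mul_ne_zero (pow_ne_zero _ X_ne_zero) (fun h0 => hQ'0 (by rw [h0, map_zero]))
  have hpow : Submonoid.powers Q ≤ nonZeroDivisors A := powers_le_nonZeroDivisors_of_noZeroDivisors hQ0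
  let S := Localization.subalgebra.ofField K (Submonoid.powers Q) hpow
  have : IsLocalization (Submonoid.powers Q) S := Localization.subalgebra.isLocalization_ofField K _ hpow
  let g : A →+* LS := ν.comp (μ.comp Ω)
  have hgu : ∀ y : Submonoid.powers Q, IsUnit (g y) := by
    rintro ⟨y, n, rfl⟩
    rw [isUnit_iff_ne_zero]
    change g (Q ^ n) ≠ 0
    rw [map_pow]
    refine pow_ne_zero _ fun h0 => hμQ0 (hν ?_)
    rw [map_zero]; exact h0
  let lam : S →+* LS := IsLocalization.lift (M := Submonoid.powers Q) hgu
  have hlam : ∀ a, lam (algebraMap A S a) = g a := fun a => IsLocalization.lift_eq hgu a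
  have hQK : algebraMap A K Q ≠ 0 := fun h0 => hQ0 (IsFractionRing.injective A K (by rw [h0, map_zero]))
  have hS : ∀ i, h i ∈ S := fun i => by
    refine ⟨P i, Q, ⟨1, by simp⟩, ?_⟩
    rw [← hP]; field_simp
  have hSF : ∀ c : F, algebraMap F K c ∈ S := fun c => by
    rw [IsScalarTower.algebraMap_apply F A K]
    exact S.algebraMap_mem _
  let S' : Subalgebra F K := { S.toSubsemiring with algebraMap_mem' := hSF }
  have hle : Algebra.adjoin F (Set.range h) ≤ S' := Algebra.adjoin_le (by rintro _ ⟨i, rfl⟩; exact hS i)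
  let H := Algebra.adjoin F (Set.range h)
  let inc : H →+* S := { toFun := fun x => ⟨x.1, hle x.2⟩, map_one' := rfl, map_mul' := fun _ _ => rfl, map_zero' := rfl, map_add' := fun _ _ => rfl }
  let lamH : H →+* LS := lam.comp inc
  have hlamc : ∀ c : F, lamH (algebraMap F H c) = ν (C (RatFunc.C (algebraMap F k c))) := by
    intro c
    have : inc (algebraMap F H c) = algebraMap A S (algebraMap F A c) := by
      apply Subtype.ext
      exact IsScalarTower.algebraMap_apply F A K c
    change lam (inc _) = _
    rw [this, hlam]
    change ν (μ (Ω _)) = _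
    rw [hΩ]
    rw [hμC]
  have hlami : ∀ i, lamH ⟨h i, Algebra.subset_adjoin ⟨i, rfl⟩⟩ =
      ν (C (RatFunc.C (θ i)) + μ (N' i) * (μ Q')⁻¹) := by
    intro i
    have e1 : (⟨h i, hS i⟩ : S) * algebraMap A S Q = algebraMap A S (P i) := Subtype.ext (hP i)
    have e2 := congrArg lam e1
    rw [map_mul, hlam, hlam] at e2
    change lam ⟨h i, hS i⟩ = _
    have e3 : g Q ≠ 0 := (hgu ⟨Q, 1, by simp⟩).ne_zero
    apply mul_right_cancel₀ e3
    rw [e2]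
    change ν (μ (Ω (P i))) = _ * ν (μ (Ω Q))
    rw [← map_mul]
    congr 1
    rw [h2, add_mul, map_add, map_mul, h1]
    congr 1
    · rw [← h1, hμC]
    · rw [map_mul, map_mul, map_pow, hμX]
      linear_combination (-(X : PS) ^ e * μ (N' i)) * hQu
  have hrange : ∀ x : H, lamH x ∈ ν.range := by
    rintro ⟨x, hx⟩
    induction hx using Algebra.adjoin_induction with
    | mem x hx =>
      obtain ⟨i, rfl⟩ := hx
      exact ⟨_, (hlami i).symm⟩
    | algebraMap c => exact ⟨_, (hlamc c).symm⟩
    | add x y hx hy ihx ihy =>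
      have : (⟨x + y, add_mem hx hy⟩ : H) = ⟨x, hx⟩ + ⟨y, hy⟩ := rfl
      rw [this, map_add]; exact add_mem ihx ihy
    | mul x y hx hy ihx ihy =>
      have : (⟨x * y, mul_mem hx hy⟩ : H) = ⟨x, hx⟩ * ⟨y, hy⟩ := rfl
      rw [this, map_mul]; exact mul_mem ihx ihy
  let E : PS ≃+* ν.range := RingEquiv.ofBijective ν.rangeRestrict
    ⟨fun a b hab => hν (congrArg Subtype.val hab), ν.rangeRestrict_surjective⟩
  let ψ0 : H →+* RatFunc k := (constantCoeff (R := RatFunc k)).comp (E.symm.toRingHom.comp (lamH.codRestrict ν.range hrange))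
  have hψ0 : ∀ x y, lamH x = ν y → ψ0 x = constantCoeff y := by
    intro x y hxy
    change constantCoeff (E.symm (lamH.codRestrict ν.range hrange x)) = _
    congr 1
    rw [RingEquiv.symm_apply_eq]
    exact Subtype.ext hxy
  refine ⟨{ ψ0 with commutes' := fun c => ?_ }, fun i => ?_⟩
  · refine (hψ0 _ _ (hlamc c)).trans ?_
    simp only [PowerSeries.constantCoeff_C]
    rw [IsScalarTower.algebraMap_apply F k (RatFunc k), RatFunc.algebraMap_eq_C]
  · refine (hψ0 _ _ (hlami i)).trans ?_
    rw [map_add, map_mul, PowerSeries.constantCoeff_C, PowerSeries.constantCoeff_inv, div_eq_mul_inv, hμ0, hμ0]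
end PartEight

section PartNine
set_option linter.style.haveILetI false
open PowerSeries

theorem newton_inj {F K k ι : Type} [Field F] [Field K] [Algebra F K] [Field k] [Algebra F k]
    (h : ι → K) (ψ : Algebra.adjoin F (Set.range h) →ₐ[F] RatFunc k)
    (e : Algebra.adjoin F (Set.range h) →ₐ[F] k) (he : Function.Injective e)
    (n : ι → Polynomial k) (q : Polynomial k) (d : ℕ) (hq : ¬ Polynomial.X ^ (d + 1) ∣ q)
    (hn : ∀ i, Polynomial.X ^ (d + 1) ∣ n i)
    (hψ : ∀ i, ψ ⟨h i, Algebra.subset_adjoin ⟨i, rfl⟩⟩ =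
      RatFunc.C (e ⟨h i, Algebra.subset_adjoin ⟨i, rfl⟩⟩) +
        algebraMap _ (RatFunc k) (n i) / algebraMap _ (RatFunc k) q) :
    Function.Injective ψ := by
  have hq0 : q ≠ 0 := fun h0 => hq (h0 ▸ dvd_zero _)
  have hinj : Function.Injective (algebraMap (Polynomial k) (RatFunc k)) := IsFractionRing.injective _ _
  obtain ⟨q', hqq, hq'⟩ := Polynomial.exists_eq_pow_rootMultiplicity_mul_and_not_dvd q hq0 0
  generalize hm : Polynomial.rootMultiplicity 0 q = m at hqq
  rw [Polynomial.C_0, sub_zero] at hqq hq'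
  have hmd : m ≤ d := by
    by_contra hlt
    exact hq (hqq ▸ Dvd.dvd.mul_right (pow_dvd_pow _ (by omega)) _)
  have hq'0 : q'.eval 0 ≠ 0 := by
    rw [← Polynomial.coeff_zero_eq_eval_zero]
    exact fun h0 => hq' (Polynomial.X_dvd_iff.2 h0)
  have key : ∀ x, ∃ a b : Polynomial k, b.eval 0 ≠ 0 ∧ ψ x * algebraMap _ _ b = algebraMap _ _ a ∧
      a.eval 0 = e x * b.eval 0 := by
    rintro ⟨x, hx⟩
    induction hx using Algebra.adjoin_induction with
    | mem x hx =>
      obtain ⟨i, rfl⟩ := hx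
      obtain ⟨n', hn'⟩ := hn i
      refine ⟨Polynomial.C (e ⟨h i, Algebra.subset_adjoin ⟨i, rfl⟩⟩) * q' + Polynomial.X ^ (d + 1 - m) * n', q', hq'0, ?_, ?_⟩
      · rw [hψ, hn', hqq]
        have hXm : algebraMap (Polynomial k) (RatFunc k) (Polynomial.X) ≠ 0 := by
          rw [Ne, map_eq_zero_iff _ hinj]; exact Polynomial.X_ne_zero
        have hqm : algebraMap (Polynomial k) (RatFunc k) q' ≠ 0 := by
          rw [Ne, map_eq_zero_iff _ hinj]; rintro rfl; simp at hq'0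
        have : d + 1 = m + (d + 1 - m) := by omega
        generalize d + 1 - m = r at this ⊢
        rw [this]
        simp only [map_mul, map_add, map_pow, RatFunc.algebraMap_C, pow_add]
        field_simp
      · simp; left; omega
    | algebraMap c =>
      refine ⟨Polynomial.C (algebraMap F k c), 1, by simp, ?_, ?_⟩
      · have : ψ (algebraMap F _ c) = _ := ψ.commutes c
        rw [map_one, mul_one, RatFunc.algebraMap_C]
        refine this.trans ?_
        rw [IsScalarTower.algebraMap_apply F k (RatFunc k), RatFunc.algebraMap_eq_C]
      · have : e (algebraMap F _ c) = _ := e.commutes c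
        rw [Polynomial.eval_C, Polynomial.eval_one, mul_one]
        exact this.symm
    | add x y hx hy ihx ihy =>
      have : (⟨x + y, add_mem hx hy⟩ : Algebra.adjoin F (Set.range h)) = ⟨x, hx⟩ + ⟨y, hy⟩ := rfl
      obtain ⟨a, b, h1, h2, h3⟩ := ihx
      obtain ⟨a', b', h1', h2', h3'⟩ := ihy
      refine ⟨a * b' + a' * b, b * b', by simp [h1, h1'], ?_, ?_⟩
      · rw [this, map_add, map_mul, map_add, map_mul, map_mul, ← h2, ← h2']; ring
      · rw [this, map_add]; simp [h3, h3']; ring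
    | mul x y hx hy ihx ihy =>
      have : (⟨x * y, mul_mem hx hy⟩ : Algebra.adjoin F (Set.range h)) = ⟨x, hx⟩ * ⟨y, hy⟩ := rfl
      obtain ⟨a, b, h1, h2, h3⟩ := ihx
      obtain ⟨a', b', h1', h2', h3'⟩ := ihy
      refine ⟨a * a', b * b', by simp [h1, h1'], ?_, ?_⟩
      · rw [this, map_mul, map_mul, map_mul, ← h2, ← h2']; ring
      · rw [this, map_mul]; simp [h3, h3']; ring
  rw [injective_iff_map_eq_zero]
  intro x hx
  obtain ⟨a, b, h1, h2, h3⟩ := key x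
  rw [hx, zero_mul] at h2
  have : a = 0 := hinj (by rw [← h2, map_zero])
  rw [this, Polynomial.eval_zero, eq_comm, mul_eq_zero, or_iff_left h1] at h3
  exact he (by rw [h3, map_zero])

theorem thmK {F A K k1 ι : Type} [Field F] [CharZero F] [CommRing A] [IsDomain A] [Algebra F A] [Algebra.Smooth F A]
    [Field K] [Algebra A K] [IsFractionRing A K] [Algebra F K] [IsScalarTower F A K] [Field k1] [Algebra F k1]
    [Finite ι]
    (h : ι → K) (A' : Subalgebra F K) [Algebra.FiniteType F A'] (hA : ∀ a, algebraMap A K a ∈ A')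
    (hh : ∀ i, h i ∈ A') (e : A' →ₐ[F] k1)
    (he : ∀ x (hx : x ∈ Algebra.adjoin F (Set.range h)) (hx' : x ∈ A'), e ⟨x, hx'⟩ = 0 → x = 0) :
    (∀ i, ∃ s a : A, e ⟨_, hA s⟩ ≠ 0 ∧ algebraMap A K s * h i = algebraMap A K a) ∨
    ∃ (k : Type) (_ : Field k) (_ : Algebra F k) (ψ : Algebra.adjoin F (Set.range h) →ₐ[F] RatFunc k),
      Function.Injective ψ ∧ ∃ i, ∀ c, ψ ⟨h i, Algebra.subset_adjoin ⟨i, rfl⟩⟩ ≠ RatFunc.C c := by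
  classical
  cases nonempty_fintype ι
  rw [or_iff_not_imp_left]
  intro hnot
  push Not at hnot
  obtain ⟨i₁, hi₁⟩ := hnot
  let iA : A →ₐ[F] A' := (IsScalarTower.toAlgHom F A K).codRestrict A' hA
  let p : Ideal A := RingHom.ker ((e.comp iA : A →ₐ[F] k1) : A →+* k1)
  have hp : p.IsPrime := RingHom.ker_isPrime _
  obtain ⟨V, hV1, hV2, hV3, hV4⟩ := exists_pole_point (A := A) (K := K) (smooth_normal (F := F)) p (h i₁)
    (fun s a hs => hi₁ s a hs)
  -- the second algebra
  let A'' : Subalgebra F K := (IsScalarTower.toAlgHom F A K).range ⊔ Algebra.adjoin F {(h i₁)⁻¹}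
  have hfgA : (IsScalarTower.toAlgHom F A K).range.FG := by
    rw [← Algebra.map_top]
    exact Subalgebra.FG.map _ Algebra.FiniteType.out
  have hA''ft : Algebra.FiniteType F A'' :=
    Subalgebra.fg_iff_finiteType A'' |>.1 (hfgA.sup ⟨{(h i₁)⁻¹}, by simp⟩)
  have hVF : ∀ c : F, algebraMap F K c ∈ V := fun c => by
    rw [IsScalarTower.algebraMap_apply F A K]; exact hV1 _
  let V' : Subalgebra F K := { V.toSubring.toSubsemiring with algebraMap_mem' := hVF }
  have hle : A'' ≤ V' := by
    refine sup_le ?_ (Algebra.adjoin_le ?_)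
    · rintro _ ⟨a, rfl⟩; exact hV1 a
    · rintro _ rfl
      exact (V.valuation_le_one_iff _).1 hV3.le
  let k2 := IsLocalRing.ResidueField V
  let incl : A'' →+* V := { toFun := fun x => ⟨x.1, hle x.2⟩, map_one' := rfl, map_mul' := fun _ _ => rfl, map_zero' := rfl, map_add' := fun _ _ => rfl }
  let e2 : A'' →+* k2 := (IsLocalRing.residue V).comp incl
  have hA2 : ∀ a, algebraMap A K a ∈ A'' := fun a => (le_sup_left : _ ≤ A'') ⟨a, rfl⟩
  let iA2 : A →ₐ[F] A'' := (IsScalarTower.toAlgHom F A K).codRestrict A'' hA2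
  have he2 : ∀ x : A'', e2 x = 0 ↔ V.valuation x.1 < 1 := by
    intro x
    change IsLocalRing.residue V (incl x) = 0 ↔ _
    rw [IsLocalRing.residue_eq_zero_iff]
    exact V.valuation_lt_one_iff (incl x)
  obtain ⟨k, _, _, j1, j2, hj⟩ := exists_amalgam ((e.comp iA : A →ₐ[F] k1) : A →+* k1) (e2.comp iA2.toRingHom) (by
    intro a
    change a ∈ p ↔ e2 (iA2 a) = 0
    rw [he2]
    exact (hV2 a).symm)
  letI : Algebra F k := (j1.comp (algebraMap F k1)).toAlgebra
  haveI : CharZero k := charZero_of_injective_algebraMap (algebraMap F k).injective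
  let ε1 : A' →ₐ[F] k := { j1.comp e.toRingHom with
    commutes' := fun c => by
      change j1 (e (algebraMap F A' c)) = j1 (algebraMap F k1 c)
      rw [e.commutes] }
  let ε2 : A'' →ₐ[F] k := { j2.comp e2 with
    commutes' := fun c => by
      have : algebraMap F A'' c = iA2 (algebraMap F A c) := (iA2.commutes c).symm
      change j2 (e2 (algebraMap F A'' c)) = j1 (algebraMap F k1 c)
      rw [this]
      refine (hj _).symm.trans ?_
      change j1 (e (iA (algebraMap F A c))) = _
      rw [iA.commutes, e.commutes] }
  obtain ⟨Q, hQ⟩ := IsLocalization.exist_integer_multiples_of_finset (nonZeroDivisors A) (Finset.univ.image h)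
  have hP : ∀ i, ∃ P : A, h i * algebraMap A K Q = algebraMap A K P := by
    intro i
    obtain ⟨P, hP⟩ := hQ (h i) (by simp)
    refine ⟨P, ?_⟩
    rw [hP, Algebra.smul_def, mul_comm]
  choose P hP using hP
  have hQ0 : (Q : A) ≠ 0 := nonZeroDivisors.coe_ne_zero Q
  generalize (Q : A) = Q at hP hQ0
  have hQK : algebraMap A K Q ≠ 0 := fun h0 => hQ0 (IsFractionRing.injective A K (by rw [h0, map_zero]))
  obtain ⟨α, hα, hαq⟩ := exists_arc_of_domain ε1 (iA Q) (fun h0 => hQK (congrArg Subtype.val h0))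
  obtain ⟨β, hβ, hβq⟩ := exists_arc_of_domain ε2 (iA2 Q) (fun h0 => hQK (congrArg Subtype.val h0))
  obtain ⟨Φ, hΦ1, hΦ2⟩ := exists_two_arc_lift (k := k) (α.comp iA) (β.comp iA2) (by
    intro a
    change constantCoeff (α (iA a)) = constantCoeff (β (iA2 a))
    rw [hα, hβ]
    exact hj a)
  let θ : ι → k := fun i => ε1 ⟨h i, hh i⟩
  let N : ι → PowerSeries (PowerSeries k) := fun i => Φ (P i) - C (C (θ i)) * Φ Q
  let j0 := (α (iA Q)).order.toNat
  let i0 := (β (iA2 Q)).order.toNat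
  have hj0 : ((j0 : ℕ) : ℕ∞) = (α (iA Q)).order := PowerSeries.coe_toNat_order hαq
  have hi0 : ((i0 : ℕ) : ℕ∞) = (β (iA2 Q)).order := PowerSeries.coe_toNat_order hβq
  have hhi : (h i₁)⁻¹ ∈ A'' := (le_sup_right : _ ≤ A'') (Algebra.subset_adjoin rfl)
  obtain ⟨χ, m, d, Q', N', hχ1, hχ2, hχ3, hχ4, hχ5, hχ6⟩ := newton_core (Φ Q) N i0 j0
    (by rw [hΦ1]; exact PowerSeries.coeff_order hαq)
    (by rw [hΦ2]; exact PowerSeries.coeff_order hβq)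
    (by
      intro i hi
      rw [hΦ2]
      exact PowerSeries.coeff_of_lt_order _ (by change _ < (β (iA2 Q)).order; rw [← hi0]; exact_mod_cast hi))
    (by
      intro i j hj
      have e1 : α (iA (P i)) = α ⟨h i, hh i⟩ * α (iA Q) := by
        rw [← map_mul]; congr 1; exact Subtype.ext (hP i).symm
      have e2 : constantCoeff (N i) = (α ⟨h i, hh i⟩ - C (θ i)) * α (iA Q) := by
        simp only [N, map_sub, map_mul, hΦ1, constantCoeff_C]
        change α (iA (P i)) - C (θ i) * α (iA Q) = _
        rw [e1]; ring
      rw [e2]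
      apply PowerSeries.coeff_of_lt_order
      have e3 : 1 ≤ (α ⟨h i, hh i⟩ - C (θ i)).order := by
        rw [PowerSeries.one_le_order_iff_constCoeff_eq_zero, map_sub, hα, constantCoeff_C]
        exact sub_self _
      calc (j : ℕ∞) < 1 + (j0 : ℕ∞) := by exact_mod_cast (by omega)
        _ ≤ _ := by rw [PowerSeries.order_mul, ← hj0]; gcongr)
    (by
      refine ⟨i₁, ?_⟩
      have e1 : β (iA2 Q) = β ⟨(h i₁)⁻¹, hhi⟩ * β (iA2 (P i₁)) := by
        rw [← map_mul]; congr 1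
        apply Subtype.ext
        change algebraMap A K Q = (h i₁)⁻¹ * algebraMap A K (P i₁)
        rw [← hP]; field_simp
      have e0 : constantCoeff (β ⟨(h i₁)⁻¹, hhi⟩) = 0 := by
        rw [hβ]
        change j2 (e2 _) = 0
        rw [(he2 _).2 hV3, map_zero]
      have e2 : PowerSeries.map constantCoeff (N i₁) = (1 - C (θ i₁) * β ⟨(h i₁)⁻¹, hhi⟩) * β (iA2 (P i₁)) := by
        simp only [N, map_sub, map_mul, hΦ2, PowerSeries.map_C, constantCoeff_C]
        change β (iA2 (P i₁)) - C (θ i₁) * β (iA2 Q) = _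
        rw [e1]; ring
      have e3 : β (iA2 (P i₁)) ≠ 0 := fun h0 => hβq (by rw [e1, h0, mul_zero])
      have e4 : (1 - C (θ i₁) * β ⟨(h i₁)⁻¹, hhi⟩).order = 0 := by
        rw [PowerSeries.order_zero_of_unit]
        rw [PowerSeries.isUnit_iff_constantCoeff]
        simp [e0]
      have e5 : (PowerSeries.map constantCoeff (N i₁)).order = (β (iA2 (P i₁))).order := by
        rw [e2, PowerSeries.order_mul, e4, zero_add]
      have e6 : PowerSeries.map constantCoeff (N i₁) ≠ 0 := by
        rw [Ne, ← PowerSeries.order_eq_top, e5, PowerSeries.order_eq_top]; exact e3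
      refine ⟨(PowerSeries.map constantCoeff (N i₁)).order.toNat, ?_, PowerSeries.coeff_order e6⟩
      have e7 : ((PowerSeries.map constantCoeff (N i₁)).order.toNat : ℕ∞) ≤ i0 := by
        rw [PowerSeries.coe_toNat_order e6, e5, hi0, e1, PowerSeries.order_mul]
        exact le_add_self
      exact_mod_cast e7)
  let Ω : A →+* PowerSeries (Polynomial k) := χ.comp Φ.toRingHom
  have hq0 : constantCoeff Q' ≠ 0 := fun h0 => hχ4 (h0 ▸ dvd_zero _)
  obtain ⟨ψ, hψ⟩ := newton_extend (F := F) h Q P hQ0 hP Ω (fun c => by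
      change χ (Φ (algebraMap F A c)) = _
      rw [Φ.commutes]
      rw [PowerSeries.algebraMap_apply, PowerSeries.algebraMap_apply]
      exact hχ1 _) m Q' N' θ hχ2 (fun i => by
      change χ (Φ (P i)) = _ * χ (Φ Q) + _
      rw [← hχ3, ← hχ1, ← map_mul, ← map_add]
      congr 1
      simp [N]) hq0
  have hHA : Algebra.adjoin F (Set.range h) ≤ A' := Algebra.adjoin_le (by rintro _ ⟨i, rfl⟩; exact hh i)
  refine ⟨k, inferInstance, inferInstance, ψ, newton_inj h ψ (ε1.comp (Subalgebra.inclusion hHA)) ?_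
    (fun i => constantCoeff (N' i)) (constantCoeff Q') d hχ4 hχ5 hψ, ?_⟩
  · rw [injective_iff_map_eq_zero]
    rintro ⟨x, hx⟩ h0
    apply Subtype.ext
    refine he x hx (hHA hx) (j1.injective ?_)
    rw [map_zero]; exact h0
  · obtain ⟨i, hi⟩ := hχ6
    refine ⟨i, fun c hc => ?_⟩
    rw [hψ] at hc
    have hinj : Function.Injective (algebraMap (Polynomial k) (RatFunc k)) := IsFractionRing.injective _ _
    have hq0' : algebraMap (Polynomial k) (RatFunc k) (constantCoeff Q') ≠ 0 := by
      rw [Ne, map_eq_zero_iff _ hinj]; exact hq0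
    have h1 : constantCoeff (N' i) = Polynomial.C (c - θ i) * constantCoeff Q' := by
      apply hinj
      rw [map_mul, RatFunc.algebraMap_C, map_sub]
      rw [← hc]
      field_simp
      ring
    by_cases hc0 : c - θ i = 0
    · rw [hc0] at h1; simp at h1; exact hi h1
    · have h2 := hχ5 i
      rw [h1, (Polynomial.isUnit_C.2 (isUnit_iff_ne_zero.2 hc0)).dvd_mul_left] at h2
      exact hχ4 h2
end PartNine

section PartTen
set_option linter.style.haveILetI false
open TensorProduct

theorem thmK' {F A K k1 H : Type} [Field F] [CharZero F] [CommRing A] [IsDomain A] [Algebra F A] [Algebra.Smooth F A]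
    [Field K] [Algebra A K] [IsFractionRing A K] [Algebra F K] [IsScalarTower F A K] [Field k1] [Algebra F k1]
    [CommRing H] [Algebra F H] [Algebra.FiniteType F H] (g : H →ₐ[F] K) (eA : A →ₐ[F] k1) (eH : H →ₐ[F] k1)
    (hcomp : ∀ t : A ⊗[F] H, Algebra.TensorProduct.lift (IsScalarTower.toAlgHom F A K) g (fun _ _ => Commute.all _ _) t = 0 →
      Algebra.TensorProduct.lift eA eH (fun _ _ => Commute.all _ _) t = 0)
    (hker : ∀ x, eH x = 0 → g x = 0) :
    (∀ x : H, ∃ s a : A, eA s ≠ 0 ∧ algebraMap A K s * g x = algebraMap A K a) ∨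
    ∃ (k : Type) (_ : Field k) (_ : Algebra F k) (ψ : H →ₐ[F] RatFunc k),
      (∀ x, ψ x = 0 ↔ g x = 0) ∧ ∃ x, ∀ c, ψ x ≠ RatFunc.C c := by
  classical
  obtain ⟨S, hS⟩ := (Algebra.FiniteType.out : (⊤ : Subalgebra F H).FG)
  let h : S → K := fun i => g i
  let G := Algebra.TensorProduct.lift (IsScalarTower.toAlgHom F A K) g (fun _ _ => Commute.all _ _)
  let E := Algebra.TensorProduct.lift eA eH (fun _ _ => Commute.all _ _)
  let A' := G.range
  have hG1 : ∀ a, G (a ⊗ₜ 1) = algebraMap A K a := fun a => by simp [G]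
  have hG2 : ∀ a, G (1 ⊗ₜ a) = g a := fun a => by simp [G]
  have hE1 : ∀ a, E (a ⊗ₜ 1) = eA a := fun a => by simp [E]
  have hE2 : ∀ a, E (1 ⊗ₜ a) = eH a := fun a => by simp [E]
  haveI : Algebra.FiniteType F (A ⊗[F] H) := Algebra.FiniteType.trans (S := A) inferInstance inferInstance
  haveI : Algebra.FiniteType F A' := Algebra.FiniteType.of_surjective G.rangeRestrict G.rangeRestrict_surjective
  let e : A' →ₐ[F] k1 := AlgHom.liftOfSurjective G.rangeRestrict G.rangeRestrict_surjective E (by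
    intro t ht
    exact hcomp t (congrArg Subtype.val ht))
  have hadj : Algebra.adjoin F (Set.range h) = g.range := by
    rw [← Algebra.map_top, ← hS, AlgHom.map_adjoin]
    congr 1
    ext x; simp [h]
  have he : ∀ t, e (G.rangeRestrict t) = E t := fun t => AlgHom.liftOfSurjective_apply _ _ _ _ _
  have hA : ∀ a, algebraMap A K a ∈ A' := fun a => ⟨a ⊗ₜ 1, hG1 a⟩
  have heA : ∀ a, e ⟨_, hA a⟩ = eA a := by
    intro a
    rw [← hE1, ← he]; congr 1; exact Subtype.ext (hG1 a).symm
  have hreg_ind : (∀ i : S, ∃ s a : A, e ⟨_, hA s⟩ ≠ 0 ∧ algebraMap A K s * h i = algebraMap A K a) →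
      (∀ x : H, ∃ s a : A, eA s ≠ 0 ∧ algebraMap A K s * g x = algebraMap A K a) := by
    intro hi x
    have hx : x ∈ Algebra.adjoin F (S : Set H) := hS ▸ Algebra.mem_top
    induction hx using Algebra.adjoin_induction with
    | mem x hx =>
      obtain ⟨s, a, h1, h2⟩ := hi ⟨x, hx⟩
      exact ⟨s, a, heA s ▸ h1, h2⟩
    | algebraMap c =>
      refine ⟨1, algebraMap F A c, by simp, ?_⟩
      rw [map_one, one_mul, g.commutes, ← IsScalarTower.algebraMap_apply]
    | add x y hx hy ihx ihy =>
      obtain ⟨s, a, h1, h2⟩ := ihx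
      obtain ⟨s', a', h1', h2'⟩ := ihy
      refine ⟨s * s', a * s' + a' * s, by simp [h1, h1'], ?_⟩
      simp only [map_mul, map_add, ← h2, ← h2']; ring
    | mul x y hx hy ihx ihy =>
      obtain ⟨s, a, h1, h2⟩ := ihx
      obtain ⟨s', a', h1', h2'⟩ := ihy
      refine ⟨s * s', a * a', by simp [h1, h1'], ?_⟩
      simp only [map_mul, ← h2, ← h2']; ring
  rcases thmK h A' hA (fun i => ⟨1 ⊗ₜ i, hG2 i⟩) e (by
    intro x hx hx' h0
    rw [hadj] at hx
    obtain ⟨y, rfl⟩ := hx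
    have : e (G.rangeRestrict (1 ⊗ₜ y)) = 0 := by
      rw [← h0]; congr 1; exact Subtype.ext (hG2 y)
    rw [he, hE2] at this
    exact hker y this) with h1 | ⟨k, _, _, ψ, h1, i, h2⟩
  · exact Or.inl (hreg_ind h1)
  · refine Or.inr ⟨k, inferInstance, inferInstance,
      ψ.comp (g.codRestrict _ (fun x => hadj ▸ ⟨x, rfl⟩)), fun x => ?_, i, fun c => h2 c⟩
    change ψ _ = 0 ↔ _
    rw [map_eq_zero_iff ψ h1]
    exact ⟨fun h => congrArg Subtype.val h, fun h => Subtype.ext h⟩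
end PartTen

section PartEleven
set_option linter.style.haveILetI false

theorem exists_open_of_constructible {X : Type*} [TopologicalSpace X] (x : X) (hx : ∀ U : Set X, IsOpen U → U.Nonempty → x ∈ U)
    {s : Set X} (hs : Topology.IsConstructible s) : ∃ U : Set X, IsOpen U ∧ x ∈ U ∧ (U ⊆ s ∨ U ⊆ sᶜ) := by
  induction hs using Topology.IsConstructible.empty_union_induction with
  | open_retrocompact U hU _ =>
    by_cases h : U.Nonempty
    · exact ⟨U, hU, hx U hU h, Or.inl subset_rfl⟩
    · rw [Set.not_nonempty_iff_eq_empty] at h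
      exact ⟨Set.univ, isOpen_univ, trivial, Or.inr (by simp [h])⟩
  | union s _ t _ h1 h2 =>
    obtain ⟨U, hU, hxU, h⟩ := h1
    obtain ⟨V, hV, hxV, h'⟩ := h2
    refine ⟨U ∩ V, hU.inter hV, ⟨hxU, hxV⟩, ?_⟩
    rcases h with h | h
    · exact Or.inl fun y hy => Or.inl (h hy.1)
    · rcases h' with h' | h'
      · exact Or.inl fun y hy => Or.inr (h' hy.2)
      · refine Or.inr fun y hy hyu => hyu.elim (h hy.1) (h' hy.2)
  | compl s _ h =>
    obtain ⟨U, hU, hxU, h⟩ := h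
    refine ⟨U, hU, hxU, ?_⟩
    rw [compl_compl]; exact h.symm

theorem generic_range {R S : Type*} [CommRing R] [IsDomain R] [IsNoetherianRing R] [CommRing S] [IsDomain S]
    (f : R →+* S) (hf : Function.Injective f) (hft : f.FiniteType) :
    ∃ g : R, g ≠ 0 ∧ ∀ p : Ideal R, p.IsPrime → g ∉ p → ∃ q : Ideal S, q.IsPrime ∧ q.comap f = p := by
  have hfp : f.FinitePresentation := RingHom.FinitePresentation.of_finiteType.1 hft
  have hc := PrimeSpectrum.isConstructible_range_comap hfp
  obtain ⟨U, hU, hxU, h⟩ := exists_open_of_constructible (⊥ : PrimeSpectrum R) (by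
    intro U hU ⟨y, hy⟩
    have : (⊥ : PrimeSpectrum R) ⤳ y := by
      rw [← PrimeSpectrum.le_iff_specializes]; exact bot_le
    exact this.mem_open hU hy) hc
  have hr : (⊥ : PrimeSpectrum R) ∈ Set.range (PrimeSpectrum.comap f) := by
    refine ⟨⊥, PrimeSpectrum.ext ?_⟩
    change (⊥ : Ideal S).comap f = ⊥
    rw [← RingHom.ker_eq_comap_bot]; exact (RingHom.injective_iff_ker_eq_bot f).1 hf
  have hsub : U ⊆ Set.range (PrimeSpectrum.comap f) := h.resolve_right (fun h' => h' hxU hr)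
  obtain ⟨_, ⟨g, rfl⟩, hg, hgU⟩ := PrimeSpectrum.isTopologicalBasis_basic_opens.exists_subset_of_mem_open hxU hU
  refine ⟨g, fun h0 => hg (by rw [h0]; exact zero_mem _), fun p hp hgp => ?_⟩
  obtain ⟨q, hq⟩ := hsub (hgU (show (⟨p, hp⟩ : PrimeSpectrum R) ∈ (PrimeSpectrum.basicOpen g : Set _) from hgp))
  exact ⟨q.asIdeal, q.2, congrArg PrimeSpectrum.asIdeal hq⟩

theorem exists_sigma {R : Type} [CommRing R] [IsDomain R] [Algebra ℂ R] [Algebra.FiniteType ℂ R] (φ : ℂ →+* R) :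
    ∃ σ : ℂ →+* ℂ, ∀ c, φ c = algebraMap ℂ R (σ c) := by
  have key : ∀ c, ∃ d, algebraMap ℂ R d = φ c := by
    intro c
    by_cases ha : IsAlgebraic ℂ (φ c)
    · have := ha.isIntegral
      have h2 := IsAlgClosed.splits (minpoly ℂ (φ c))
      have h3 := Polynomial.eq_X_add_C_of_degree_eq_one (IsAlgClosed.degree_eq_one_of_irreducible ℂ (minpoly.irreducible this))
      rw [(minpoly.monic this).leadingCoeff] at h3
      have h4 := minpoly.aeval ℂ (φ c)
      generalize (minpoly ℂ (φ c)).coeff 0 = z at h3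
      rw [h3] at h4
      simp at h4
      exact ⟨-z, by rw [map_neg]; exact (eq_neg_of_add_eq_zero_left h4).symm⟩
    · exfalso
      have hinj : Function.Injective (Polynomial.aeval (R := ℂ) (φ c)) := transcendental_iff_injective.1 ha
      have hft : (Polynomial.aeval (R := ℂ) (φ c)).toRingHom.FiniteType := by
        have : ((Polynomial.aeval (R := ℂ) (φ c)).toRingHom.comp (algebraMap ℂ (Polynomial ℂ))).FiniteType := by
          rw [show (Polynomial.aeval (R := ℂ) (φ c)).toRingHom.comp (algebraMap ℂ (Polynomial ℂ)) = algebraMap ℂ R from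
            (Polynomial.aeval (R := ℂ) (φ c)).comp_algebraMap]
          exact RingHom.finiteType_algebraMap.2 inferInstance
        exact RingHom.FiniteType.of_comp_finiteType this
      obtain ⟨g, hg, hg2⟩ := generic_range _ hinj hft
      obtain ⟨r, hr⟩ : ∃ r : ℕ, g.eval (r : ℂ) ≠ 0 := by
        by_contra hcon
        push Not at hcon
        refine hg (Polynomial.eq_zero_of_infinite_isRoot g ?_)
        refine Set.Infinite.mono (s := Set.range (Nat.cast : ℕ → ℂ)) ?_ (Set.infinite_range_of_injective Nat.cast_injective)
        rintro _ ⟨n, rfl⟩; exact hcon n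
      obtain ⟨q, hq, hq2⟩ := hg2 (Ideal.span {Polynomial.X - Polynomial.C (r : ℂ)})
        ((Ideal.span_singleton_prime (Polynomial.X_sub_C_ne_zero _)).2 (Polynomial.prime_X_sub_C _))
        (by rw [Ideal.mem_span_singleton, Polynomial.dvd_iff_isRoot]; exact hr)
      have h1 : (Polynomial.X - Polynomial.C (r : ℂ)) ∈ q.comap (Polynomial.aeval (R := ℂ) (φ c)).toRingHom := by
        rw [hq2]; exact Ideal.mem_span_singleton_self _
      have h2 : φ (c - r) ∈ q := by
        have h1' : Polynomial.aeval (φ c) (Polynomial.X - Polynomial.C (r : ℂ)) ∈ q := h1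
        simpa using h1'
      by_cases hc : c - r = 0
      · rw [sub_eq_zero] at hc
        apply ha
        rw [hc, map_natCast]
        exact isAlgebraic_natCast r
      · exact hq.ne_top (Ideal.eq_top_of_isUnit_mem _ h2 ((isUnit_iff_ne_zero.2 hc).map φ))
  have hinj : Function.Injective (algebraMap ℂ R) := FaithfulSMul.algebraMap_injective ℂ R
  choose s hs using key
  have h1 : s 1 = 1 := hinj (by rw [hs]; simp)
  have h0 : s 0 = 0 := hinj (by rw [hs]; simp)
  have hm : ∀ a b, s (a * b) = s a * s b := fun a b => hinj (by simp only [map_mul, hs])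
  have ha : ∀ a b, s (a + b) = s a + s b := fun a b => hinj (by simp only [map_add, hs])
  exact ⟨RingHom.mk ⟨⟨s, h1⟩, hm⟩ h0 ha, fun c => (hs c).symm⟩

theorem krullDim_le_of_lift {α β : Type*} [PartialOrder α] [PartialOrder β] (f : β → α) (hsurj : Function.Surjective f)
    (hl : ∀ b, ∀ a > f b, ∃ b' > b, f b' = a) : Order.krullDim α ≤ Order.krullDim β := by
  have key : ∀ (n : ℕ) (p : LTSeries α), p.length = n → ∀ b, f b = p.head → ∃ q : LTSeries β, q.length = n ∧ q.head = b := by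
    intro n
    induction n with
    | zero => intro p hp b _; exact ⟨RelSeries.singleton _ b, rfl, rfl⟩
    | succ n ih =>
      intro p hp b hb
      have h0 : p.length ≠ 0 := by omega
      obtain ⟨b', hb', hb''⟩ := hl b (p.tail h0).head (by
        rw [hb, RelSeries.head_tail]
        exact p.strictMono (by rw [Fin.lt_def]; simp [Nat.mod_eq_of_lt (show 1 < p.length + 1 by omega)]))
      obtain ⟨q, hq, hq'⟩ := ih (p.tail h0) (by simp [hp]) b' hb''
      exact ⟨q.cons b (by rw [hq']; exact hb'), by simp [hq], by simp⟩
  apply iSup_le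
  intro p
  obtain ⟨b, hb⟩ := hsurj p.head
  obtain ⟨q, hq, _⟩ := key p.length p rfl b hb
  rw [← hq]
  exact le_iSup (fun q : LTSeries β => ((q.length : ℕ∞) : WithBot ℕ∞)) q

theorem ringKrullDim_le_of_integral_inj {R S : Type*} [CommRing R] [CommRing S] (f : R →+* S) (hf : Function.Injective f)
    (hi : f.IsIntegral) : ringKrullDim R ≤ ringKrullDim S := by
  algebraize [f]
  haveI : Algebra.IsIntegral R S := ⟨hi⟩
  refine krullDim_le_of_lift (PrimeSpectrum.comap f) ?_ ?_
  · intro p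
    obtain ⟨Q, -, hQ, hQp⟩ := Ideal.exists_ideal_over_prime_of_isIntegral p.asIdeal (⊥ : Ideal S)
      (by rw [← RingHom.ker_eq_comap_bot]; exact ((RingHom.injective_iff_ker_eq_bot _).1 hf).le.trans bot_le)
    exact ⟨⟨Q, hQ⟩, PrimeSpectrum.ext hQp⟩
  · intro b a hab
    obtain ⟨Q, hbQ, hQ, hQp⟩ := Ideal.exists_ideal_over_prime_of_isIntegral a.asIdeal b.asIdeal (le_of_lt hab)
    refine ⟨⟨Q, hQ⟩, lt_of_le_of_ne hbQ ?_, PrimeSpectrum.ext hQp⟩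
    rintro rfl
    exact hab.ne (PrimeSpectrum.ext hQp)

theorem ringKrullDim_le_of_integral {R S : Type*} [CommRing R] [CommRing S] (f : R →+* S)
    (hi : f.IsIntegral) : ringKrullDim S ≤ ringKrullDim R := by
  algebraize [f]
  haveI : Algebra.IsIntegral R S := ⟨hi⟩
  refine Order.krullDim_le_of_strictMono (PrimeSpectrum.comap f) ?_
  intro p q hpq
  exact Ideal.comap_lt_comap_of_integral_mem_sdiff (R := R) (hpq.le : p.asIdeal ≤ q.asIdeal)
    (Set.exists_of_ssubset (show (p.asIdeal : Set S) ⊂ q.asIdeal from hpq)).choose_spec (Algebra.IsIntegral.isIntegral _)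
end PartEleven

section PartTwelve
set_option linter.style.haveILetI false

theorem exists_fibre_prime {A H : Type} [CommRing A] [IsDomain A] [Algebra ℂ A] [Algebra.FiniteType ℂ A]
    [CommRing H] [Algebra ℂ H] [Algebra.FiniteType ℂ H] (h : H →ₐ[ℂ] A) (t : A) (ht : Transcendental h.range t) :
    ∃ P : Ideal A, P.IsPrime ∧ ¬ P.IsMaximal ∧ (P.comap h.toRingHom).IsMaximal := by
  let R := h.range
  have hRft : Algebra.FiniteType ℂ R := Algebra.FiniteType.of_surjective h.rangeRestrict h.rangeRestrict_surjective
  haveI : IsNoetherianRing R := Algebra.FiniteType.isNoetherianRing ℂ R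
  haveI : IsJacobsonRing R := isJacobsonRing_of_finiteType (A := ℂ)
  have hinj : Function.Injective (Polynomial.aeval (R := R) t) := transcendental_iff_injective.1 ht
  have hft : (Polynomial.aeval (R := R) t).toRingHom.FiniteType := by
    have : ((Polynomial.aeval (R := R) t).toRingHom.comp (algebraMap ℂ (Polynomial R))).FiniteType := by
      have h1 : (Polynomial.aeval (R := R) t).toRingHom.comp (algebraMap ℂ (Polynomial R)) = algebraMap ℂ A := by
        ext c
        rw [IsScalarTower.algebraMap_eq ℂ R (Polynomial R)]
        change Polynomial.aeval t (algebraMap R (Polynomial R) (algebraMap ℂ R c)) = _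
        rw [AlgHom.commutes]; rfl
      rw [h1]
      exact RingHom.finiteType_algebraMap.2 inferInstance
    exact RingHom.FiniteType.of_comp_finiteType this
  obtain ⟨g, hg, hg2⟩ := generic_range _ hinj hft
  obtain ⟨n, hn⟩ : ∃ n, g.coeff n ≠ 0 := by
    by_contra hcon
    push Not at hcon
    exact hg (Polynomial.ext (by simpa using hcon))
  obtain ⟨m, hm, hnm⟩ : ∃ m : Ideal R, m.IsMaximal ∧ g.coeff n ∉ m := by
    by_contra hcon
    push Not at hcon
    have h1 : (⊥ : Ideal R).jacobson = ⊥ := IsJacobsonRing.out ‹IsJacobsonRing R› (Ideal.isRadical_bot)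
    have : g.coeff n ∈ (⊥ : Ideal R).jacobson := by
      rw [Ideal.jacobson, Ideal.mem_sInf]
      intro J hJ
      exact hcon J hJ.2
    rw [h1] at this
    exact hn this
  haveI := hm.isPrime
  obtain ⟨P, hP, hP2⟩ := hg2 (Ideal.map Polynomial.C m) Ideal.isPrime_map_C_of_isPrime
    (fun h0 => hnm (Ideal.mem_map_C_iff.1 h0 n))
  have hmem : ∀ f : Polynomial R, Polynomial.aeval t f ∈ P ↔ ∀ n, f.coeff n ∈ m := by
    intro f
    rw [← Ideal.mem_map_C_iff, ← hP2]; rfl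
  refine ⟨P, hP, fun hmax => ?_, ?_⟩
  · letI : Field (A ⧸ P) := Ideal.Quotient.field P
    haveI : Algebra.FiniteType ℂ (A ⧸ P) := Algebra.FiniteType.of_surjective (Ideal.Quotient.mkₐ ℂ P) (Ideal.Quotient.mkₐ_surjective _ _)
    haveI : Module.Finite ℂ (A ⧸ P) := finite_of_finite_type_of_isJacobsonRing ℂ (A ⧸ P)
    have hhint : IsIntegral ℂ (Ideal.Quotient.mk P t) := Algebra.IsIntegral.isIntegral _
    obtain ⟨p, hp, hp0⟩ := hhint
    have h1 : Polynomial.aeval t (p.map (algebraMap ℂ R)) ∈ P := by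
      rw [Polynomial.aeval_map_algebraMap, ← Ideal.Quotient.eq_zero_iff_mem]
      rw [← hp0]
      change Ideal.Quotient.mkₐ ℂ P (Polynomial.aeval t p) = _
      rw [← Polynomial.aeval_algHom_apply]
      rfl
    have h2 := (hmem _).1 h1 p.natDegree
    rw [Polynomial.coeff_map, Polynomial.coeff_natDegree, hp.leadingCoeff, map_one] at h2
    exact hm.ne_top ((Ideal.eq_top_iff_one _).2 h2)
  · have : P.comap h.toRingHom = m.comap h.rangeRestrict.toRingHom := by
      ext x
      have := hmem (Polynomial.C (h.rangeRestrict x))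
      rw [Polynomial.aeval_C] at this
      refine this.trans ⟨fun h => by simpa using h 0, fun h n => ?_⟩
      rw [Polynomial.coeff_C]
      split_ifs
      · exact h
      · exact zero_mem _
    rw [this]
    exact Ideal.comap_isMaximal_of_surjective _ h.rangeRestrict_surjective

theorem dim_le_of_algebraic {A AB K : Type} [CommRing A] [IsDomain A] [Algebra ℂ A] [Algebra.FiniteType ℂ A]
    [CommRing AB] [Nontrivial AB] [Algebra ℂ AB] [Algebra.FiniteType ℂ AB] [Field K] [Algebra ℂ K]
    (iA : A →ₐ[ℂ] K) (hiA : Function.Injective iA)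
    (b : AB →+* K) (σ : ℂ →+* ℂ) (hb : ∀ c, b (algebraMap ℂ AB c) = algebraMap ℂ K (σ c))
    (halg : ∀ y : K, IsAlgebraic (Algebra.adjoin ℂ (Set.range b)) y) : ringKrullDim A ≤ ringKrullDim AB := by
  obtain ⟨r, g, hg, hgi⟩ := exists_integral_inj_algHom_of_fg ℂ AB
  obtain ⟨s, f, hf, hfi⟩ := exists_integral_inj_algHom_of_fg ℂ A
  have h1 : ringKrullDim A ≤ s := by
    refine (ringKrullDim_le_of_integral f.toRingHom hfi).trans ?_
    rw [MvPolynomial.ringKrullDim_of_isNoetherianRing]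
    simp
  have h2 : (r : WithBot ℕ∞) ≤ ringKrullDim AB := by
    refine le_trans ?_ (ringKrullDim_le_of_integral_inj g.toRingHom hg hgi)
    rw [MvPolynomial.ringKrullDim_of_isNoetherianRing]
    simp
  suffices hsr : s ≤ r from h1.trans (le_trans (by exact_mod_cast hsr) h2)
  let x : Fin r → K := fun i => b (g (MvPolynomial.X i))
  let E := Algebra.adjoin ℂ (Set.range x)
  have hmemE : ∀ p, b (g p) ∈ E := by
    intro p
    induction p using MvPolynomial.induction_on with
    | C c =>
      have : g (MvPolynomial.C c) = algebraMap ℂ AB c := g.commutes c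
      rw [this, hb]; exact E.algebraMap_mem _
    | add p q hp hq => rw [map_add, map_add]; exact add_mem hp hq
    | mul_X p i hp => rw [map_mul, map_mul]; exact mul_mem hp (Algebra.subset_adjoin ⟨i, rfl⟩)
  let g' : MvPolynomial (Fin r) ℂ →+* E := (b.comp g.toRingHom).codRestrict E hmemE
  let I := integralClosure E K
  have hbI : Algebra.adjoin ℂ (Set.range b) ≤ I.restrictScalars ℂ := by
    refine Algebra.adjoin_le ?_
    rintro _ ⟨a, rfl⟩
    obtain ⟨p, hp, hp0⟩ := hgi a
    refine ⟨p.map g', hp.map _, ?_⟩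
    rw [Polynomial.eval₂_map]
    have h3 := congrArg b hp0
    rw [map_zero, Polynomial.hom_eval₂] at h3
    exact h3
  have hIalg : Algebra.IsAlgebraic I K := ⟨fun y =>
    (IsAlgebraic.tower_top_of_subalgebra_le hbI (halg y) : IsAlgebraic (I.restrictScalars ℂ) y)⟩
  have hEI : Algebra.IsAlgebraic E I := Algebra.IsIntegral.isAlgebraic
  have hE : Algebra.IsAlgebraic E K := Algebra.IsAlgebraic.trans E I K
  have h3 : Algebra.trdeg ℂ K ≤ Cardinal.mk (Set.range x) := Algebra.IsAlgebraic.trdeg_le_cardinalMk ℂ (Set.range x)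
  have h4 : Cardinal.mk (Set.range x) ≤ r := by
    have := Cardinal.mk_range_le (f := x)
    simpa using this
  have h5 : AlgebraicIndependent ℂ (fun i : Fin s => iA (f (MvPolynomial.X i))) := by
    rw [algebraicIndependent_iff_injective_aeval]
    have : (MvPolynomial.aeval fun i : Fin s => iA (f (MvPolynomial.X i))) = iA.comp f := by
      ext i; simp
    rw [this]
    exact hiA.comp hf
  have h6 := h5.cardinalMk_le_trdeg
  rw [Cardinal.mk_fin] at h6
  exact_mod_cast h6.trans (h3.trans h4)
end PartTwelve

section PartThirteen
set_option linter.style.haveILetI false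
open AlgebraicGeometry CategoryTheory CategoryTheory.Limits

theorem mem_domain_of_stalk {X Y S : Scheme.{0}} [IsIntegral X] (sX : X ⟶ S) (sY : Y ⟶ S) [LocallyOfFiniteType sY]
    (f : X ⤏ Y) (x : X) (φ : Spec (X.presheaf.stalk x) ⟶ Y) (h : φ ≫ sY = X.fromSpecStalk x ≫ sX)
    (hf : f.fromFunctionField = Spec.map (X.presheaf.stalkSpecializes ((genericPoint_spec X).specializes trivial)) ≫ φ) :
    x ∈ f.domain := by
  let p := Scheme.PartialMap.ofFromSpecStalk sX sY φ h
  have hx : x ∈ p.domain := Scheme.PartialMap.mem_domain_ofFromSpecStalk sX sY φ h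
  have hp : p.fromSpecStalkOfMem hx = φ := Scheme.PartialMap.fromSpecStalkOfMem_ofFromSpecStalk sX sY φ h
  refine Scheme.RationalMap.mem_domain.2 ⟨p, hx, ?_⟩
  refine Scheme.RationalMap.eq_of_fromFunctionField_eq _ _ ?_
  rw [Scheme.RationalMap.fromFunctionField_toRationalMap, hf, ← hp]
  simp only [Scheme.PartialMap.fromFunctionField, Scheme.PartialMap.fromSpecStalkOfMem, ← Category.assoc]
  congr 1
  rw [← cancel_mono p.domain.ι]
  simp

theorem lift_of_proper {Y S : Scheme.{0}} (sY : Y ⟶ S) [UniversallyClosed sY] (R K : CommRingCat.{0}) [IsDomain R]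
    [ValuationRing R] (hK : IsField K) (j : R ⟶ K)
    (hj : @IsFractionRing R _ K _ j.hom.toAlgebra) (i₁ : Spec K ⟶ Y) (i₂ : Spec R ⟶ S)
    (h : i₁ ≫ sY = Spec.map j ≫ i₂) : ∃ l : Spec R ⟶ Y, Spec.map j ≫ l = i₁ ∧ l ≫ sY = i₂ := by
  have hex : ValuativeCriterion.Existence sY := by
    have : UniversallyClosed sY := inferInstance
    rw [UniversallyClosed.eq_valuativeCriterion] at this
    exact this.1
  letI := hK.toField
  letI := j.hom.toAlgebra
  obtain ⟨⟨l, h1, h2⟩⟩ := hex { R := R, K := K, i₁ := i₁, i₂ := i₂, commSq := ⟨h⟩ }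
  exact ⟨l, h1, h2⟩

theorem extend_of_valuationRing {X Y S W : Scheme.{0}} [IsIntegral X] (sX : X ⟶ S) (sY : Y ⟶ S) [IsProper sY]
    [Y.IsSeparated]
    (hval : ∀ x : X, ValuationRing (X.presheaf.stalk x)) (i : W ⟶ X) [IsOpenImmersion i] [Nonempty W]
    (m : W ⟶ Y) (hm : m ≫ sY = i ≫ sX) : ∃ F : X ⟶ Y, i ≫ F = m := by
  let p : X.PartialMap Y :=
    { domain := i.opensRange
      dense_domain := i.opensRange.2.dense ⟨_, ⟨Classical.arbitrary W, rfl⟩⟩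
      hom := i.isoOpensRange.inv ≫ m }
  let f := p.toRationalMap
  have hdom : ∀ x, x ∈ f.domain := by
    intro x
    haveI := hval x
    have hsq : CommSq f.fromFunctionField (Spec.map (X.presheaf.stalkSpecializes ((genericPoint_spec X).specializes trivial))) sY (X.fromSpecStalk x ≫ sX) := by
      constructor
      simp only [f, p, Scheme.RationalMap.fromFunctionField_toRationalMap, Scheme.PartialMap.fromFunctionField, Scheme.PartialMap.fromSpecStalkOfMem, Category.assoc, hm]
      simp [← Category.assoc]
    obtain ⟨l, h1, h2⟩ := lift_of_proper sY _ _ (Field.toIsField X.functionField) _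
      (inferInstanceAs (IsFractionRing (X.presheaf.stalk x) X.functionField)) _ _ hsq.w
    exact mem_domain_of_stalk sX sY f x l h2 h1.symm
  have htop : f.domain = ⊤ := by ext x; simp [hdom x]
  have hle : i.opensRange ≤ f.toPartialMap.domain := p.le_domain_toRationalMap
  have hres : X.homOfLE hle ≫ f.toPartialMap.hom = i.isoOpensRange.inv ≫ m :=
    Scheme.PartialMap.toPartialMap_toRationalMap_restrict p
  have hW : f.toPartialMap.domain = ⊤ := htop
  generalize f.toPartialMap = q at hle hres hW
  refine ⟨X.topIso.inv ≫ (X.isoOfEq hW).inv ≫ q.hom, ?_⟩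
  have h4 : i ≫ X.topIso.inv ≫ (X.isoOfEq hW).inv = i.isoOpensRange.hom ≫ X.homOfLE hle := by
    rw [← cancel_mono (q.domain.ι)]
    simp
  have h5 := congrArg (fun z => z ≫ q.hom) h4
  simp only [Category.assoc, hres, Iso.hom_inv_id_assoc] at h5
  exact h5
end PartThirteen

section PartFourteen
set_option linter.style.haveILetI false
open AlgebraicGeometry CategoryTheory CategoryTheory.Limits MvPolynomial HomogeneousLocalization
attribute [local instance] MvPolynomial.gradedAlgebra

theorem homog_scale {K : Type} [Field K] [Algebra ℂ K] (x : MvPolynomial (Fin 2) ℂ) (n : ℕ) (hx : x.IsHomogeneous n)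
    (r : K) (f : Fin 2 → K) : aeval (fun v => r * f v) x = r ^ n * aeval f x := by
  rw [aeval_def, aeval_def, eval₂_eq, eval₂_eq, Finset.mul_sum]
  refine Finset.sum_congr rfl fun d hd => ?_
  have h1 := hx (mem_support_iff.1 hd)
  rw [Finsupp.weight_apply, Finsupp.sum_fintype _ _ (by simp)] at h1
  simp only [Fin.sum_univ_two, Pi.one_apply, smul_eq_mul, mul_one] at h1
  have h2 : ∑ i ∈ d.support, d i = n := by
    rw [← h1, ← Fin.sum_univ_two (f := fun i => d i)]
    exact Finset.sum_subset (Finset.subset_univ _) (by simp)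
  simp only [mul_pow, Finset.prod_mul_distrib, Finset.prod_pow_eq_pow_sum, h2]
  ring

noncomputable def chartPoly (i : Fin 2) : MvPolynomial (Fin 2) ℂ →ₐ[ℂ] Polynomial ℂ :=
  aeval (fun v => if v = i then 1 else Polynomial.X)

theorem chartPoly_inj (i : Fin 2) (x : MvPolynomial (Fin 2) ℂ) (n : ℕ) (hx : x.IsHomogeneous n) (h : chartPoly i x = 0) :
    x = 0 := by
  let K := FractionRing (MvPolynomial (Fin 2) ℂ)
  let a : Fin 2 → K := fun v => algebraMap (MvPolynomial (Fin 2) ℂ) K (X v)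
  have ha : a i ≠ 0 := by
    intro h0
    have := (IsFractionRing.injective (MvPolynomial (Fin 2) ℂ) K) (h0.trans (map_zero _).symm)
    exact X_ne_zero i this
  have h1 : algebraMap _ K x = aeval a x := by
    have : (aeval a : MvPolynomial (Fin 2) ℂ →ₐ[ℂ] K) = IsScalarTower.toAlgHom ℂ _ K := by
      ext v; simp [a]
    rw [this]; rfl
  obtain ⟨j, hj⟩ : ∃ j : Fin 2, ∀ v, v ≠ i → v = j := by
    fin_cases i
    · exact ⟨1, by decide⟩
    · exact ⟨0, by decide⟩
  have h2 : a = fun v => a i * (if v = i then 1 else a j / a i) := by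
    ext v
    by_cases hv : v = i
    · simp [hv]
    · rw [if_neg hv, mul_div_cancel₀ _ ha, ← hj v hv]
  have h3 : (aeval (fun v => if v = i then (1 : K) else a j / a i) : MvPolynomial (Fin 2) ℂ →ₐ[ℂ] K) =
      (Polynomial.aeval (a j / a i)).comp (chartPoly i) := by
    ext v
    by_cases hv : v = i <;> simp [chartPoly, hv]
  rw [h2, homog_scale x n hx, h3, AlgHom.comp_apply, h, map_zero, mul_zero] at h1
  exact (IsFractionRing.injective (MvPolynomial (Fin 2) ℂ) K) (h1.trans (map_zero _).symm)

noncomputable def chartHom (i : Fin 2) : Away (homogeneousSubmodule (Fin 2) ℂ) (X i : MvPolynomial (Fin 2) ℂ) →+* Polynomial ℂ :=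
  (Localization.awayLift (chartPoly i).toRingHom (X i : MvPolynomial (Fin 2) ℂ) (by simp [chartPoly])).comp
    (algebraMap _ (Localization.Away (X i : MvPolynomial (Fin 2) ℂ)))

theorem X_mem (i : Fin 2) : (X i : MvPolynomial (Fin 2) ℂ) ∈ homogeneousSubmodule (Fin 2) ℂ 1 := isHomogeneous_X _ _

theorem chartHom_mk (i : Fin 2) (n : ℕ) (x) (hx) : chartHom i (Away.mk _ (X_mem i) n x hx) = chartPoly i x := by
  simp only [chartHom, RingHom.comp_apply, HomogeneousLocalization.algebraMap_apply, Away.val_mk]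
  rw [Localization.awayLift_mk (v := 1)]
  · simp
  · simp [chartPoly]

theorem chartHom_bij (i : Fin 2) : Function.Bijective (chartHom i) := by
  constructor
  · rw [injective_iff_map_eq_zero]
    intro a ha
    obtain ⟨n, x, hx, rfl⟩ := Away.mk_surjective _ (X_mem i) a
    rw [chartHom_mk] at ha
    have := chartPoly_inj i x _ hx ha
    subst this
    exact mk_eq_zero_of_num _ rfl
  · intro p
    obtain ⟨j, hj⟩ : ∃ j : Fin 2, j ≠ i := exists_ne i
    induction p using Polynomial.induction_on' with
    | add p q hp hq =>
      obtain ⟨a, rfl⟩ := hp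
      obtain ⟨b, rfl⟩ := hq
      exact ⟨a + b, map_add _ _ _⟩
    | monomial n c =>
      refine ⟨Away.mk _ (X_mem i) n (C c * X j ^ n) ?_, ?_⟩
      · have := (isHomogeneous_C (Fin 2) c).mul ((isHomogeneous_X ℂ j).pow n)
        simpa using this
      · rw [chartHom_mk]
        simp [chartPoly, hj, Polynomial.C_mul_X_pow_eq_monomial]

noncomputable def chartEquiv (i : Fin 2) : Away (homogeneousSubmodule (Fin 2) ℂ) (X i : MvPolynomial (Fin 2) ℂ) ≃+* Polynomial ℂ :=
  RingEquiv.ofBijective (chartHom i) (chartHom_bij i)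

noncomputable abbrev PL : Scheme.{0} := Proj (homogeneousSubmodule (Fin 2) ℂ)

noncomputable def projStruct : PL ⟶ Spec (CommRingCat.of ℂ) :=
  Proj.toSpecZero (homogeneousSubmodule (Fin 2) ℂ) ≫
    Spec.map (CommRingCat.ofHom (algebraMap ℂ (homogeneousSubmodule (Fin 2) ℂ 0)))

noncomputable def chart (i : Fin 2) : Spec (CommRingCat.of (Polynomial ℂ)) ⟶ PL :=
  Spec.map (CommRingCat.ofHom (chartEquiv i).toRingHom) ≫ Proj.awayι _ _ (X_mem i) one_pos

instance (i : Fin 2) : IsIso (CommRingCat.ofHom (chartEquiv i).toRingHom) :=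
  (chartEquiv i).toCommRingCatIso.isIso_hom

instance chart_open (i : Fin 2) : IsOpenImmersion (chart i) := by
  unfold chart; exact IsOpenImmersion.comp _ _

theorem C_mem (c : ℂ) : (C c : MvPolynomial (Fin 2) ℂ) ∈ homogeneousSubmodule (Fin 2) ℂ (0 • 1) := by
  have := isHomogeneous_C (Fin 2) c
  simpa using this

theorem chart_struct (i : Fin 2) : chart i ≫ projStruct = Spec.map (CommRingCat.ofHom Polynomial.C) := by
  unfold chart projStruct
  rw [Category.assoc, Proj.awayι_toSpecZero_assoc, ← Spec.map_comp, ← Spec.map_comp]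
  congr 1
  refine CommRingCat.hom_ext (RingHom.ext fun (c : ℂ) => ?_)
  change chartHom i (fromZeroRingHom _ _ (algebraMap ℂ (homogeneousSubmodule (Fin 2) ℂ 0) c)) = Polynomial.C c
  have h1 : fromZeroRingHom (homogeneousSubmodule (Fin 2) ℂ) (Submonoid.powers (X i))
      (algebraMap ℂ (homogeneousSubmodule (Fin 2) ℂ 0) c) = Away.mk _ (X_mem i) 0 (C c) (C_mem c) := by
    apply val_injective
    rw [Away.val_mk]
    change Localization.mk _ _ = _
    congr 1
  rw [h1, chartHom_mk]
  simp [chartPoly]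

theorem range_chart (i : Fin 2) : (chart i).opensRange = Proj.basicOpen (homogeneousSubmodule (Fin 2) ℂ) (X i) := by
  unfold chart
  rw [Scheme.Hom.opensRange_comp_of_isIso, Proj.opensRange_awayι]

theorem chart_cover (x : PL) : ∃ i, ∃ y, chart i y = x := by
  have h := Proj.iSup_basicOpen_eq_top' (homogeneousSubmodule (Fin 2) ℂ) (fun i : Fin 2 => X i) (fun i => ⟨1, X_mem i⟩) (by
    rw [eq_top_iff]
    rintro p -
    induction p using MvPolynomial.induction_on with
    | C c => exact Subalgebra.algebraMap_mem _ (⟨C c, isHomogeneous_C _ _⟩ : homogeneousSubmodule (Fin 2) ℂ 0)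
    | add p q hp hq => exact add_mem hp hq
    | mul_X p i hp => exact mul_mem hp (Algebra.subset_adjoin ⟨i, rfl⟩))
  have hx : x ∈ (⊤ : PL.Opens) := trivial
  rw [← h, TopologicalSpace.Opens.mem_iSup] at hx
  obtain ⟨i, hi⟩ := hx
  rw [← range_chart] at hi
  exact ⟨i, hi⟩

noncomputable def PLgen : PL where
  asHomogeneousIdeal := ⊥
  isPrime := Ideal.isPrime_bot
  not_irrelevant_le := fun h => by
    have : (X 0 : MvPolynomial (Fin 2) ℂ) ∈ (⊥ : HomogeneousIdeal (homogeneousSubmodule (Fin 2) ℂ)) :=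
      h (by
        rw [HomogeneousIdeal.mem_irrelevant_iff]
        rw [GradedRing.proj_apply, DirectSum.decompose_of_mem_ne _ (X_mem 0) (by decide)])
    exact X_ne_zero (R := ℂ) (0 : Fin 2) this

instance : IrreducibleSpace PL := by
  have h : closure ({PLgen} : Set PL) = Set.univ := by
    ext x
    simp only [Set.mem_univ, iff_true]
    refine (ProjectiveSpectrum.le_iff_mem_closure (homogeneousSubmodule (Fin 2) ℂ) PLgen x).1 ?_
    exact (bot_le : (⊥ : HomogeneousIdeal (homogeneousSubmodule (Fin 2) ℂ)) ≤ x.asHomogeneousIdeal)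
  have := IsIrreducible.closure (s := ({PLgen} : Set PL)) isIrreducible_singleton
  rw [h] at this
  exact irreducibleSpace_def _ |>.2 this

noncomputable def stalkEquiv (i : Fin 2) (y) : PL.presheaf.stalk (chart i y) ≅ (Spec (CommRingCat.of (Polynomial ℂ))).presheaf.stalk y :=
  asIso ((chart i).stalkMap y)

instance : IsReduced PL := by
  haveI : ∀ x : PL, _root_.IsReduced (PL.presheaf.stalk x) := by
    intro x
    obtain ⟨i, y, rfl⟩ := chart_cover x
    exact isReduced_of_injective (stalkEquiv i y).commRingCatIsoToRingEquiv.toRingHom (stalkEquiv i y).commRingCatIsoToRingEquiv.injective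
  exact isReduced_of_isReduced_stalk PL

instance : IsIntegral PL := isIntegral_of_irreducibleSpace_of_isReduced PL

theorem pid_localization {R L : Type} [CommRing R] [IsDomain R] [IsPrincipalIdealRing R] [CommRing L] [Algebra R L]
    (M : Submonoid R) [IsLocalization M L] : IsPrincipalIdealRing L := by
  constructor
  intro I
  obtain ⟨g, hg⟩ := (IsPrincipalIdealRing.principal (I.under R)).principal
  refine ⟨algebraMap R L g, ?_⟩
  rw [← IsLocalization.map_under M L I, hg]
  change Ideal.map _ (Ideal.span {g}) = Ideal.span _
  rw [Ideal.map_span, Set.image_singleton]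

theorem PL_val (x : PL) : ValuationRing (PL.presheaf.stalk x) := by
  obtain ⟨i, y, rfl⟩ := chart_cover x
  let S := (Spec (CommRingCat.of (Polynomial ℂ))).presheaf.stalk y
  letI : Algebra (Polynomial ℂ) S := StructureSheaf.stalkAlgebra (Polynomial ℂ) y
  haveI : (PrimeSpectrum.asIdeal (R := Polynomial ℂ) y).IsPrime := PrimeSpectrum.isPrime (R := Polynomial ℂ) y
  haveI : IsLocalization (PrimeSpectrum.asIdeal (R := Polynomial ℂ) y).primeCompl S :=
    StructureSheaf.IsLocalization.to_stalk (Polynomial ℂ) y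
  haveI : IsPrincipalIdealRing S := pid_localization (PrimeSpectrum.asIdeal (R := Polynomial ℂ) y).primeCompl
  haveI : ValuationRing S := inferInstance
  haveI : PreValuationRing (PL.presheaf.stalk (chart i y)) :=
    (stalkEquiv i y).commRingCatIsoToRingEquiv.symm.surjective.preValuationRing
      (stalkEquiv i y).commRingCatIsoToRingEquiv.symm.toRingHom.toMonoidHom.toMulHom
  exact { }
end PartFourteen

section PartFifteen
set_option linter.style.haveILetI false
open Polynomial

theorem exists_hom_to_C {S : Type} [CommRing S] [Algebra ℂ S] [Algebra.FiniteType ℂ S] (q : Ideal S) (hq : q.IsPrime) :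
    ∃ θ : S →+* ℂ, RingHom.ker θ = q := by
  let K := FractionRing (S ⧸ q)
  let L := AlgebraicClosure K
  haveI : CharZero L := charZero_of_injective_algebraMap (algebraMap ℂ L).injective
  have h1 : Cardinal.mk S ≤ Cardinal.continuum := by
    obtain ⟨n, f, hf⟩ := Algebra.FiniteType.iff_quotient_mvPolynomial''.1 (inferInstance : Algebra.FiniteType ℂ S)
    refine (Cardinal.mk_le_of_surjective hf).trans (MvPolynomial.cardinalMk_le_max.trans ?_)
    simp [Cardinal.mk_complex, Cardinal.aleph0_le_continuum, (Cardinal.nat_lt_continuum n).le]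
  have h2 : Cardinal.mk K ≤ Cardinal.continuum :=
    (IsLocalization.cardinalMk_le (nonZeroDivisors (S ⧸ q))).trans
      ((Cardinal.mk_le_of_surjective (Ideal.Quotient.mk_surjective (I := q))).trans h1)
  have h3 : Cardinal.mk L ≤ Cardinal.continuum :=
    (Algebra.IsAlgebraic.cardinalMk_le_max K L).trans (max_le h2 Cardinal.aleph0_le_continuum)
  have h4 : Cardinal.continuum ≤ Cardinal.mk L := by
    rw [← Cardinal.mk_complex]
    exact Cardinal.mk_le_of_injective (algebraMap ℂ L).injective
  have h5 : Cardinal.mk L = Cardinal.mk ℂ := by rw [Cardinal.mk_complex]; exact le_antisymm h3 h4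
  obtain ⟨e⟩ := IsAlgClosed.ringEquiv_of_equiv_of_charZero (K := L) (L := ℂ)
    (lt_of_lt_of_le Cardinal.aleph0_lt_continuum h4) (Cardinal.eq.1 h5)
  refine ⟨e.toRingHom.comp ((algebraMap K L).comp ((algebraMap (S ⧸ q) K).comp (Ideal.Quotient.mk q))), ?_⟩
  ext x
  rw [RingHom.mem_ker]
  simp only [RingHom.comp_apply, RingEquiv.toRingHom_eq_coe, RingHom.coe_coe, map_eq_zero,
    map_eq_zero_iff _ (IsFractionRing.injective (S ⧸ q) K), Ideal.Quotient.eq_zero_iff_mem]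

theorem exists_minor {k : Type} [Field k] (P Q : k[X]) (hQ : Q ≠ 0) (h : ∀ c, P ≠ C c * Q) :
    ∃ i j, P.coeff i * Q.coeff j - P.coeff j * Q.coeff i ≠ 0 := by
  by_contra! hc
  have hl : Q.leadingCoeff ≠ 0 := leadingCoeff_ne_zero.2 hQ
  refine h (P.coeff Q.natDegree / Q.leadingCoeff) ?_
  ext i
  have := hc i Q.natDegree
  rw [coeff_natDegree, sub_eq_zero] at this
  rw [coeff_C_mul]
  field_simp
  linear_combination this

theorem two_primes {S : Type} [CommRing S] [IsDomain S] [Algebra ℂ S] [Algebra.FiniteType ℂ S] (r : S)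
    (hr : ∀ a, r ≠ algebraMap ℂ S a) : ∃ (v : ℕ) (q : Ideal S), q.IsPrime ∧ r - v ∈ q ∧ r - v ≠ 0 := by
  have htr : Function.Injective (aeval (R := ℂ) r) := by
    rw [← transcendental_iff_injective]
    intro hal
    have hi : IsIntegral ℂ r := hal.isIntegral
    have h1 := IsAlgClosed.degree_eq_one_of_irreducible ℂ (minpoly.irreducible hi)
    obtain ⟨a, ha⟩ := minpoly.mem_range_of_degree_eq_one ℂ r h1
    exact hr a ha.symm
  obtain ⟨g, hg0, hg⟩ := generic_range (aeval (R := ℂ) r).toRingHom htr (by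
    refine RingHom.FiniteType.of_comp_finiteType (f := algebraMap ℂ ℂ[X]) ?_
    have : (aeval (R := ℂ) r).toRingHom.comp (algebraMap ℂ ℂ[X]) = algebraMap ℂ S := by ext; simp
    rw [this]
    exact RingHom.finiteType_algebraMap.2 inferInstance)
  have hinf : (Set.range (fun n : ℕ => (n : ℂ))).Infinite := Set.infinite_range_of_injective Nat.cast_injective
  obtain ⟨_, ⟨v, rfl⟩, hv⟩ := hinf.exists_notMem_finset g.roots.toFinset
  obtain ⟨q, hq, hqc⟩ := hg (Ideal.span {X - C (v : ℂ)}) (by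
    rw [Ideal.span_singleton_prime (X_sub_C_ne_zero _)]; exact prime_X_sub_C _) (by
    rw [Ideal.mem_span_singleton, dvd_iff_isRoot]
    simpa [hg0] using hv)
  refine ⟨v, q, hq, ?_, fun h => hr v ?_⟩
  · have : X - C (v : ℂ) ∈ q.comap (aeval (R := ℂ) r).toRingHom := by
      rw [hqc]; exact Ideal.mem_span_singleton_self _
    simpa using this
  · simpa [sub_eq_zero] using h
end PartFifteen

section PartSixteen
set_option linter.style.haveILetI false
open Polynomial

theorem lemS_data {R k : Type} [CommRing R] [Algebra ℂ R] [Algebra.FiniteType ℂ R] [Field k] [Algebra ℂ k]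
    (ψ : R →+* RatFunc k) (b0 : R) (hb0 : ∀ c, ψ b0 ≠ RatFunc.C c) :
    ∃ (T : Finset R) (L : Subalgebra ℂ k) (D : L[X]) (n : R → L[X]), Algebra.adjoin ℂ (T : Set R) = ⊤ ∧ b0 ∈ T ∧
      Algebra.FiniteType ℂ L ∧ D ≠ 0 ∧
      (∀ t ∈ T, ψ t * algebraMap k[X] (RatFunc k) (D.map (algebraMap L k)) = algebraMap k[X] (RatFunc k) ((n t).map (algebraMap L k))) ∧
      ∃ i j, IsUnit ((n b0).coeff i * D.coeff j - (n b0).coeff j * D.coeff i) := by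
  classical
  obtain ⟨T0, hT0⟩ := (inferInstance : Algebra.FiniteType ℂ R).out
  let T := insert b0 T0
  have hT : Algebra.adjoin ℂ (T : Set R) = ⊤ := by
    rw [eq_top_iff, ← hT0]; exact Algebra.adjoin_mono (by simp [T])
  have hb : b0 ∈ T := by simp [T]
  let Dk : k[X] := ∏ t ∈ T, (ψ t).denom
  have hDk : Dk ≠ 0 := Finset.prod_ne_zero_iff.2 fun t _ => (ψ t).denom_ne_zero
  let nk : R → k[X] := fun t => (ψ t).num * ∏ s ∈ T.erase t, (ψ s).denom
  have hnk : ∀ t ∈ T, ψ t * algebraMap k[X] (RatFunc k) Dk = algebraMap k[X] (RatFunc k) (nk t) := by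
    intro t ht
    simp only [Dk, nk, ← Finset.mul_prod_erase T _ ht, map_mul]
    rw [← mul_assoc]
    congr 1
    have h0 : algebraMap k[X] (RatFunc k) (ψ t).denom ≠ 0 := by simpa using (ψ t).denom_ne_zero
    have h1 := RatFunc.num_div_denom (ψ t)
    rw [div_eq_iff h0] at h1
    exact h1.symm
  obtain ⟨i, j, hij⟩ := exists_minor (nk b0) Dk hDk (by
    intro c hc
    refine hb0 c ?_
    have h1 := hnk b0 hb
    rw [hc, map_mul] at h1
    have h2 := mul_right_cancel₀ (by simpa using hDk) h1
    rw [h2]; rfl)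
  let M : k := (nk b0).coeff i * Dk.coeff j - (nk b0).coeff j * Dk.coeff i
  let G : Finset k := insert M⁻¹ (Dk.coeffs ∪ T.biUnion fun t => (nk t).coeffs)
  let L := Algebra.adjoin ℂ (G : Set k)
  have hL : Algebra.FiniteType ℂ L := Subalgebra.fg_iff_finiteType _ |>.1 ⟨G, rfl⟩
  have hlift : ∀ P : k[X], (∀ c ∈ P.coeffs, c ∈ G) → ∃ Q : L[X], Q.map (algebraMap L k) = P := by
    intro P hP
    rw [← Polynomial.mem_lifts, Polynomial.lifts_iff_coeff_lifts]
    intro m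
    by_cases h0 : P.coeff m = 0
    · exact ⟨0, by simp [h0]⟩
    · exact ⟨⟨P.coeff m, Algebra.subset_adjoin (hP _ (Polynomial.coeff_mem_coeffs h0))⟩, rfl⟩
  obtain ⟨D, hD⟩ := hlift Dk (fun c hc => by simp only [G, Finset.mem_insert, Finset.mem_union]; tauto)
  have hn : ∀ t, ∃ Q : L[X], t ∈ T → Q.map (algebraMap L k) = nk t := by
    intro t
    by_cases ht : t ∈ T
    · obtain ⟨Q, hQ⟩ := hlift (nk t) (fun c hc => by
        simp only [G, Finset.mem_insert, Finset.mem_union, Finset.mem_biUnion]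
        exact Or.inr (Or.inr ⟨t, ht, hc⟩))
      exact ⟨Q, fun _ => hQ⟩
    · exact ⟨0, fun h => absurd h ht⟩
  choose n hn using hn
  refine ⟨T, L, D, n, hT, hb, hL, ?_, ?_, i, j, ?_⟩
  · rintro rfl; simp at hD; exact hDk hD.symm
  · intro t ht
    rw [hD, hn t ht]; exact hnk t ht
  · refine IsUnit.of_mul_eq_one (b := ⟨M⁻¹, Algebra.subset_adjoin (by simp [G])⟩) ?_
    apply Subtype.ext
    have hM : ((((n b0).coeff i * D.coeff j - (n b0).coeff j * D.coeff i : L)) : k) = M := by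
      simp only [M, ← hD, ← hn b0 hb, Polynomial.coeff_map]; rfl
    change ((((n b0).coeff i * D.coeff j - (n b0).coeff j * D.coeff i : L)) : k) * M⁻¹ = 1
    rw [hM, mul_inv_cancel₀ hij]

theorem lemS_alg {R k : Type} [CommRing R] [IsDomain R] [Algebra ℂ R] [Algebra.FiniteType ℂ R] [Field k]
    (ρ : ℂ →+* k) (ψ : R →+* RatFunc k) (hψ : Function.Injective ψ)
    (hc : ∀ c, ψ (algebraMap ℂ R c) = RatFunc.C (ρ c)) (b0 : R) (hb0 : ∀ c, ψ b0 ≠ RatFunc.C c) :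
    ∃ g : R, g ≠ 0 ∧ ∀ p : Ideal R, p.IsPrime → g ∉ p →
      ∃ (τ : ℂ →+* ℂ) (d : ℂ[X]) (m : R →+* Localization.Away d), d ≠ 0 ∧
        (∀ c, m (algebraMap ℂ R c) = algebraMap ℂ[X] (Localization.Away d) (C (τ c))) ∧
        (∃ q : Ideal (Localization.Away d), q.IsPrime ∧ q.comap m = p) ∧
        ∃ q q' : Ideal (Localization.Away d), q.IsPrime ∧ q'.IsPrime ∧ q.comap m ≠ q'.comap m := by
  letI : Algebra ℂ k := ρ.toAlgebra
  obtain ⟨T, L, D, n, hT, hb, hL, hD, hn, i, j, hu⟩ := lemS_data ψ b0 hb0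
  haveI := hL
  let S := Localization.Away D
  haveI : IsDomain S := IsLocalization.isDomain_localization (powers_le_nonZeroDivisors_of_noZeroDivisors hD)
  have hSft : Algebra.FiniteType ℂ S := by
    haveI : Algebra.FiniteType L[X] S := IsLocalization.finiteType_of_monoid_fg (Submonoid.powers D) S
    exact Algebra.FiniteType.trans (S := L[X]) inferInstance inferInstance
  let j0 : L[X] →+* RatFunc k := (algebraMap k[X] (RatFunc k)).comp (mapRingHom (algebraMap L k))
  have hj0 : Function.Injective j0 := (RatFunc.algebraMap_injective k).comp
    (Polynomial.map_injective _ Subtype.val_injective)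
  have hj0D : IsUnit (j0 D) := by
    rw [isUnit_iff_ne_zero]; exact (map_ne_zero_iff _ hj0).2 hD
  let J : S →+* RatFunc k := IsLocalization.Away.lift D hj0D
  have hJ : ∀ a, J (algebraMap L[X] S a) = j0 a := fun a => IsLocalization.Away.lift_eq D hj0D a
  have hJi : Function.Injective J := by
    rw [injective_iff_map_eq_zero]
    intro s hs
    obtain ⟨⟨a, b⟩, hab⟩ := IsLocalization.surj (Submonoid.powers D) s
    have h1 := congrArg J hab
    rw [map_mul, hs, zero_mul, hJ] at h1
    have h2 : a = 0 := (map_eq_zero_iff _ hj0).1 h1.symm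
    simp only [h2, map_zero] at hab
    exact (mul_eq_zero.1 hab).resolve_right (IsLocalization.map_units S b).ne_zero
  have hrange : ∀ x, ψ x ∈ J.range := by
    intro x
    have hx : x ∈ Algebra.adjoin ℂ (T : Set R) := by rw [hT]; trivial
    induction hx using Algebra.adjoin_induction with
    | mem t ht =>
      refine ⟨algebraMap L[X] S (n t) * IsLocalization.Away.invSelf D, ?_⟩
      refine mul_right_cancel₀ hj0D.ne_zero ?_
      rw [← hJ, ← map_mul, mul_assoc, mul_comm (IsLocalization.Away.invSelf D), IsLocalization.Away.mul_invSelf, mul_one, hJ, hJ]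
      exact (hn t ht).symm
    | algebraMap c =>
      rw [hc]
      refine ⟨algebraMap L[X] S (C (algebraMap ℂ L c)), ?_⟩
      rw [hJ]
      simp only [j0, RingHom.comp_apply, coe_mapRingHom, map_C]
      rfl
    | add x y _ _ hx hy => rw [map_add]; exact add_mem hx hy
    | mul x y _ _ hx hy => rw [map_mul]; exact mul_mem hx hy
  let eJ : S ≃+* J.range := RingEquiv.ofBijective J.rangeRestrict
    ⟨fun a b h => hJi (congrArg Subtype.val h), J.rangeRestrict_surjective⟩
  let μ : R →+* S := eJ.symm.toRingHom.comp (ψ.codRestrict J.range hrange)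
  have hμ : ∀ x, J (μ x) = ψ x := by
    intro x
    have := eJ.apply_symm_apply (ψ.codRestrict J.range hrange x)
    exact congrArg Subtype.val this
  have hμi : Function.Injective μ := fun a b h => hψ (by rw [← hμ, ← hμ, h])
  have hμc : ∀ c, μ (algebraMap ℂ R c) = algebraMap L[X] S (C (algebraMap ℂ L c)) := by
    intro c
    apply hJi
    rw [hμ, hc, hJ]
    simp only [j0, RingHom.comp_apply, coe_mapRingHom, map_C]
    rfl
  have hμb : μ b0 * algebraMap L[X] S D = algebraMap L[X] S (n b0) := by
    apply hJi
    rw [map_mul, hμ, hJ, hJ]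
    exact hn b0 hb
  haveI : IsNoetherianRing R := Algebra.FiniteType.isNoetherianRing ℂ R
  obtain ⟨g, hg0, hg⟩ := generic_range μ hμi (by
    refine RingHom.FiniteType.of_comp_finiteType (f := algebraMap ℂ R) ?_
    have : μ.comp (algebraMap ℂ R) = algebraMap ℂ S := by
      ext c
      rw [RingHom.comp_apply, hμc]
      rw [IsScalarTower.algebraMap_apply ℂ L[X] S]
      rfl
    rw [this]
    exact RingHom.finiteType_algebraMap.2 inferInstance)
  refine ⟨g, hg0, fun p hp hgp => ?_⟩
  obtain ⟨q, hq, hqp⟩ := hg p hp hgp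
  obtain ⟨θ, hθ⟩ := exists_hom_to_C q hq
  let θL : L →+* ℂ := θ.comp ((algebraMap L[X] S).comp C)
  let x0 : ℂ := θ (algebraMap L[X] S X)
  let d : ℂ[X] := D.map θL
  have hev : ∀ a : L[X], (a.map θL).eval x0 = θ (algebraMap L[X] S a) := by
    intro a
    have : (evalRingHom x0).comp (mapRingHom θL) = θ.comp (algebraMap L[X] S) := by
      refine Polynomial.ringHom_ext (fun c => ?_) ?_
      · simp [θL]
      · simp [x0]
    exact congrArg (fun f => f a) this
  have hd0 : d.eval x0 ≠ 0 := by
    rw [hev]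
    exact ((IsLocalization.Away.algebraMap_isUnit D).map θ).ne_zero
  have hd : d ≠ 0 := by rintro h; rw [h] at hd0; simp at hd0
  let A := Localization.Away d
  haveI : IsDomain A := IsLocalization.isDomain_localization (powers_le_nonZeroDivisors_of_noZeroDivisors hd)
  haveI : Algebra.FiniteType ℂ A := by
    haveI : Algebra.FiniteType ℂ[X] A := IsLocalization.finiteType_of_monoid_fg (Submonoid.powers d) A
    exact Algebra.FiniteType.trans (S := ℂ[X]) inferInstance inferInstance
  have hAinj : Function.Injective (algebraMap ℂ[X] A) :=
    IsLocalization.injective A (powers_le_nonZeroDivisors_of_noZeroDivisors hd)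
  let ν : S →+* A := IsLocalization.Away.lift D (g := (algebraMap ℂ[X] A).comp (mapRingHom θL))
    (IsLocalization.Away.algebraMap_isUnit d)
  have hν : ∀ a, ν (algebraMap L[X] S a) = algebraMap ℂ[X] A (a.map θL) := fun a => IsLocalization.Away.lift_eq D _ a
  let ε : A →+* ℂ := IsLocalization.Away.lift d (g := evalRingHom x0) (isUnit_iff_ne_zero.2 hd0)
  have hε : ∀ a, ε (algebraMap ℂ[X] A a) = a.eval x0 := fun a => IsLocalization.Away.lift_eq d _ a
  have hεν : ε.comp ν = θ := by
    refine IsLocalization.ringHom_ext (Submonoid.powers D) ?_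
    ext a
    · simp [hν, hε, θL]
    · simp [hν, hε, x0]
  let m := ν.comp μ
  let τ : ℂ →+* ℂ := θL.comp (algebraMap ℂ L)
  have hmc : ∀ c, m (algebraMap ℂ R c) = algebraMap ℂ[X] A (C (τ c)) := by
    intro c
    simp only [m, RingHom.comp_apply, hμc, hν, map_C, τ]
  refine ⟨τ, d, m, hd, hmc, ⟨RingHom.ker ε, RingHom.ker_isPrime ε, ?_⟩, ?_⟩
  · rw [← hqp, ← hθ, ← hεν, RingHom.comap_ker, RingHom.comap_ker]; rfl
  · obtain ⟨v, Q, hQ, h1, h2⟩ := two_primes (m b0) (by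
      intro a ha
      have h1 := congrArg ν hμb
      rw [map_mul, hν, hν] at h1
      change m b0 * _ = _ at h1
      rw [ha, IsScalarTower.algebraMap_apply ℂ ℂ[X] A, ← map_mul] at h1
      have h2 := hAinj h1
      have h3 : ∀ l, θL ((n b0).coeff l) = a * θL (D.coeff l) := by
        intro l
        have := congrArg (fun f => Polynomial.coeff f l) h2
        simp only [Polynomial.algebraMap_apply, Algebra.algebraMap_self, RingHom.id_apply, coeff_C_mul, coeff_map] at this
        exact this.symm
      have h4 := (hu.map θL).ne_zero
      apply h4
      rw [map_sub, map_mul, map_mul, h3, h3]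
      ring)
    have h3 : m (b0 - v) = m b0 - v := by simp
    refine ⟨Q, ⊥, hQ, Ideal.isPrime_bot, fun h => h2 ?_⟩
    have h4 : b0 - (v : R) ∈ Q.comap m := by rw [Ideal.mem_comap, h3]; exact h1
    rw [h, Ideal.mem_comap, h3] at h4
    exact h4
end PartSixteen

section PartSeventeen
set_option linter.style.haveILetI false
open AlgebraicGeometry CategoryTheory CategoryTheory.Limits
attribute [local instance] MvPolynomial.gradedAlgebra

theorem uniruled_of_ratfunc (B : Scheme.{0}) [IsIntegral B] [B.IsSeparated] (sB : B ⟶ Spec (CommRingCat.of ℂ))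
    [IsProper sB] {R k : Type} [CommRing R] [IsDomain R] [Algebra ℂ R] [Algebra.FiniteType ℂ R] [Field k]
    (iR : Spec (CommRingCat.of R) ⟶ B) [IsOpenImmersion iR]
    (hstr : iR ≫ sB = Spec.map (CommRingCat.ofHom (algebraMap ℂ R)))
    (ρ : ℂ →+* k) (ψ : R →+* RatFunc k) (hψ : Function.Injective ψ)
    (hc : ∀ c, ψ (algebraMap ℂ R c) = RatFunc.C (ρ c)) (b0 : R) (hb0 : ∀ c, ψ b0 ≠ RatFunc.C c) :
    Uniruled B := by
  obtain ⟨g, hg0, hg⟩ := lemS_alg ρ ψ hψ hc b0 hb0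
  let V : Set (PrimeSpectrum R) := PrimeSpectrum.basicOpen g
  have hVo : IsOpen V := (PrimeSpectrum.basicOpen g).2
  have hVn : V.Nonempty := ⟨⊥, by simpa [V, PrimeSpectrum.mem_basicOpen] using hg0⟩
  have hUo : IsOpen (iR '' V) := iR.isOpenEmbedding.isOpenMap _ hVo
  refine ⟨iR '' V, hUo, hUo.dense (hVn.image _), ?_⟩
  rintro _ ⟨y, hy, rfl⟩
  obtain ⟨τ, d, m, hd, hmc, ⟨q, hq, hqp⟩, q1, q2, hq1, hq2, hq12⟩ := hg (PrimeSpectrum.asIdeal (R := R) y) (PrimeSpectrum.isPrime (R := R) y) hy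
  let A := Localization.Away d
  haveI : IsDomain A := IsLocalization.isDomain_localization (powers_le_nonZeroDivisors_of_noZeroDivisors hd)
  let W := Spec (CommRingCat.of A)
  let iA : W ⟶ Spec (CommRingCat.of (Polynomial ℂ)) := Spec.map (CommRingCat.ofHom (algebraMap (Polynomial ℂ) A))
  haveI : IsOpenImmersion iA := inferInstanceAs (IsOpenImmersion (Spec.map (CommRingCat.ofHom (algebraMap (Polynomial ℂ) (Localization.Away d)))))
  let i : W ⟶ PL := iA ≫ chart 0
  haveI : Nonempty W := ⟨(⟨q, hq⟩ : PrimeSpectrum A)⟩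
  let mS : W ⟶ Spec (CommRingCat.of R) := Spec.map (CommRingCat.ofHom m)
  have hm : (mS ≫ iR) ≫ sB = i ≫ (projStruct ≫ Spec.map (CommRingCat.ofHom τ)) := by
    simp only [i, Category.assoc, hstr]
    rw [← Category.assoc (chart 0), chart_struct]
    simp only [mS, iA, ← Spec.map_comp, ← CommRingCat.ofHom_comp]
    congr 2
    ext c
    exact hmc c
  obtain ⟨F, hF⟩ := extend_of_valuationRing (projStruct ≫ Spec.map (CommRingCat.ofHom τ)) sB PL_val i (mS ≫ iR) hm
  have hpt : ∀ (q : PrimeSpectrum A), F (i q) = iR (mS q) := by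
    intro q
    have := congrArg (fun z => (z : W ⟶ B) q) hF
    exact this
  have hmS : ∀ q : PrimeSpectrum A, mS q = PrimeSpectrum.comap m q := fun q => rfl
  refine ⟨F, ?_, ?_⟩
  · refine ⟨F (i ⟨q1, hq1⟩), ⟨_, rfl⟩, F (i ⟨q2, hq2⟩), ⟨_, rfl⟩, ?_⟩
    rw [hpt, hpt]
    intro h
    have h1 := iR.isOpenEmbedding.injective h
    rw [hmS, hmS] at h1
    exact hq12 (congrArg PrimeSpectrum.asIdeal h1)
  · refine ⟨i ⟨q, hq⟩, ?_⟩
    change F (i ⟨q, hq⟩) = _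
    rw [hpt, hmS]
    congr 1
    exact PrimeSpectrum.ext hqp
end PartSeventeen

section PartEighteen
set_option linter.style.haveILetI false
open AlgebraicGeometry CategoryTheory CategoryTheory.Limits

theorem dim_le_of_charts (X : Scheme.{0}) (n : WithBot ℕ∞)
    (h : ∀ (A : CommRingCat.{0}) (j : Spec A ⟶ X), IsOpenImmersion j → Nonempty (Spec A) → ringKrullDim A ≤ n) :
    topologicalKrullDim X ≤ n := by
  have h1 : topologicalKrullDim X = Order.krullDim X :=
    Order.krullDim_eq_of_orderIso (irreducibleSetEquivPoints (α := X))
  rw [h1, Order.krullDim_eq_iSup_coheight]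
  refine iSup_le fun x => ?_
  obtain ⟨A, j, hj, hx, -⟩ := Scheme.exists_affine_mem_range_and_range_subset (X := X) (U := ⊤) (x := x) trivial
  obtain ⟨y, rfl⟩ := hx
  haveI := hj
  refine le_trans ?_ (h A j hj ⟨y⟩)
  have h2 : Order.coheight (j.base y) = Order.coheight y := coheight_eq_of_isOpenImmersion j
  have h3 := idealHeight_eq_coheight A y
  change ((Order.coheight (j.base y) : ℕ∞) : WithBot ℕ∞) ≤ _
  rw [h2, ← h3]
  exact Ideal.height_le_ringKrullDim_of_ne_top y.isPrime.ne_top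

theorem dim_ge_of_chart (B : Scheme.{0}) (R : CommRingCat.{0}) (j : Spec R ⟶ B) [IsOpenImmersion j] :
    ringKrullDim R ≤ topologicalKrullDim B := by
  rw [← PrimeSpectrum.topologicalKrullDim_eq_ringKrullDim]
  exact j.isOpenEmbedding.isInducing.topologicalKrullDim_le

theorem one_le_dim_closure {X : Type} [TopologicalSpace X] [T0Space X] (z z' : X) (h : z ⤳ z') (hne : z ≠ z') :
    1 ≤ topologicalKrullDim (closure ({z} : Set X)) := by
  have hz : z ∈ closure ({z} : Set X) := subset_closure rfl
  have hz' : z' ∈ closure ({z} : Set X) := specializes_iff_mem_closure.1 h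
  unfold topologicalKrullDim
  rw [Order.one_le_krullDim_iff]
  let a : closure ({z} : Set X) := ⟨z, hz⟩
  let b : closure ({z} : Set X) := ⟨z', hz'⟩
  have hab : a ⤳ b := (Topology.IsInducing.subtypeVal).specializes_iff.1 h
  refine ⟨⟨closure {b}, isIrreducible_singleton.closure, isClosed_closure⟩,
    ⟨closure {a}, isIrreducible_singleton.closure, isClosed_closure⟩, lt_of_le_of_ne ?_ ?_⟩
  · exact specializes_iff_closure_subset.1 hab
  · intro he
    have h1 : closure ({b} : Set (closure ({z} : Set X))) = closure {a} := congrArg TopologicalSpace.IrreducibleCloseds.carrier he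
    have h2 : b ⤳ a := specializes_iff_closure_subset.2 h1.ge
    have h3 : z' ⤳ z := (Topology.IsInducing.subtypeVal).specializes_iff.2 h2
    exact hne (h.antisymm h3).eq

theorem chart_ft {X : Scheme.{0}} {k : Type} [CommRing k] (sX : X ⟶ Spec (CommRingCat.of k)) [LocallyOfFiniteType sX] (A : CommRingCat.{0})
    (j : Spec A ⟶ X) [IsOpenImmersion j] (φ : CommRingCat.of k ⟶ A) (h : j ≫ sX = Spec.map φ) : φ.hom.FiniteType := by
  have : LocallyOfFiniteType (Spec.map φ) := by rw [← h]; infer_instance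
  exact (HasRingHomProperty.Spec_iff (P := @LocallyOfFiniteType)).1 this

theorem chart_smooth {X : Scheme.{0}} {k : Type} [CommRing k] (sX : X ⟶ Spec (CommRingCat.of k)) [Smooth sX] (A : CommRingCat.{0})
    (j : Spec A ⟶ X) [IsOpenImmersion j] (φ : CommRingCat.of k ⟶ A) (h : j ≫ sX = Spec.map φ) : φ.hom.Smooth := by
  have : Smooth (Spec.map φ) := by rw [← h]; infer_instance
  exact (HasRingHomProperty.Spec_iff (P := @Smooth)).1 this

theorem chart_domain {X : Scheme.{0}} [IsIntegral X] (A : CommRingCat.{0}) (j : Spec A ⟶ X) [IsOpenImmersion j]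
    [Nonempty (Spec A)] : IsDomain A :=
  (affine_isIntegral_iff A).1 (isIntegral_of_isOpenImmersion j)

theorem pushout_gen {P Q R H : CommRingCat.{0}} {f : P ⟶ Q} {g : P ⟶ R} {a : Q ⟶ H} {b : R ⟶ H} (h : IsPushout f g a b)
    (S : Subring H) (ha : ∀ x, a.hom x ∈ S) (hb : ∀ x, b.hom x ∈ S) (x : H) : x ∈ S := by
  let a' : Q ⟶ CommRingCat.of S := CommRingCat.ofHom (a.hom.codRestrict S ha)
  let b' : R ⟶ CommRingCat.of S := CommRingCat.ofHom (b.hom.codRestrict S hb)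
  let ι : CommRingCat.of S ⟶ H := CommRingCat.ofHom S.subtype
  have ha' : a' ≫ ι = a := by ext x; rfl
  have hb' : b' ≫ ι = b := by ext x; rfl
  have hι : Function.Injective ι.hom := Subtype.val_injective
  have hw : f ≫ a' = g ≫ b' := by
    ext x
    have := congrArg (fun z => z.hom x) h.w
    exact this
  let r := h.desc a' b' hw
  have hr : r ≫ ι = 𝟙 H := by
    apply h.hom_ext
    · simp [r, ha']
    · simp [r, hb']
  have := congrArg (fun z => z.hom x) hr
  change ι.hom (r.hom x) = x at this
  rw [← this]
  exact (r.hom x).2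
end PartEighteen

section PartNineteen
set_option linter.style.haveILetI false
open AlgebraicGeometry CategoryTheory CategoryTheory.Limits

theorem lift_gen {X : Scheme.{0}} [IsIntegral X] {A : CommRingCat.{0}} (j : Spec A ⟶ X) [IsOpenImmersion j]
    [hne : Nonempty (Spec A)] {K : Type} [Field K] (e : Spec (CommRingCat.of K) ⟶ X) (he : ∀ t, e t = genericPoint X) :
    ∃ α : A ⟶ CommRingCat.of K, Spec.map α ≫ j = e ∧ Function.Injective α.hom := by
  haveI : IsDomain A := chart_domain A j
  haveI : IsIntegral (Spec A) := isIntegral_of_isOpenImmersion j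
  have hgen : j (genericPoint (Spec A)) = genericPoint X := genericPoint_eq_of_isOpenImmersion j
  have hr : Set.range e ⊆ Set.range j := by
    rintro _ ⟨t, rfl⟩
    rw [he t, ← hgen]
    exact ⟨_, rfl⟩
  let l := IsOpenImmersion.lift j e hr
  have hl : l ≫ j = e := IsOpenImmersion.lift_fac j e hr
  obtain ⟨α, hα⟩ := Spec.map_surjective l
  refine ⟨α, by rw [hα, hl], ?_⟩
  have h1 : j (Spec.map α (⊥ : PrimeSpectrum K)) = j (genericPoint (Spec A)) := by
    rw [hgen, ← he (⊥ : PrimeSpectrum K), ← hl, hα]; rfl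
  have h2 := j.isOpenEmbedding.injective h1
  rw [genericPoint_eq_bot_of_affine] at h2
  have h3 : RingHom.ker α.hom = ⊥ := congrArg (PrimeSpectrum.asIdeal (R := A)) h2
  exact (RingHom.injective_iff_ker_eq_bot _).2 h3

theorem exists_sigma_geom {U : Scheme.{0}} [IsIntegral U] (sU : U ⟶ Spec (CommRingCat.of ℂ)) [LocallyOfFiniteType sU]
    (h : U ⟶ Spec (CommRingCat.of ℂ)) : ∃ σ : ℂ →+* ℂ, h = sU ≫ Spec.map (CommRingCat.ofHom σ) := by
  obtain ⟨A, j, hj, hx, -⟩ := Scheme.exists_affine_mem_range_and_range_subset (X := U) (U := ⊤) (x := genericPoint U) trivial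
  haveI := hj
  haveI : Nonempty (Spec A) := ⟨hx.choose⟩
  haveI : IsDomain A := chart_domain A j
  obtain ⟨φ, hφ⟩ := Spec.map_surjective (j ≫ sU)
  obtain ⟨χ, hχ⟩ := Spec.map_surjective (j ≫ h)
  letI := φ.hom.toAlgebra
  haveI : Algebra.FiniteType ℂ A := chart_ft sU A j φ hφ.symm
  obtain ⟨σ, hσ⟩ := exists_sigma (R := A) χ.hom
  refine ⟨σ, ?_⟩
  haveI : IsDominant j := by
    refine ⟨?_⟩
    exact j.isOpenEmbedding.isOpen_range.dense ⟨_, hx⟩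
  refine ext_of_isDominant (ι := j) ?_
  rw [← Category.assoc, ← hφ, ← hχ, ← Spec.map_comp]
  congr 1
  ext c
  exact hσ c

theorem mem_domain_of_stalk' {X Y S : Scheme.{0}} [IsIntegral X] [Y.IsSeparated] (sX : X ⟶ S) (sY : Y ⟶ S) [LocallyOfFiniteType sY]
    (f : X ⤏ Y) (x : X) (φ : Spec (X.presheaf.stalk x) ⟶ Y) (h : φ ≫ sY = X.fromSpecStalk x ≫ sX)
    (hf : f.fromFunctionField = Spec.map (X.presheaf.stalkSpecializes ((genericPoint_spec X).specializes trivial)) ≫ φ) :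
    ∃ hx : x ∈ f.domain, f.toPartialMap.hom ⟨x, hx⟩ = φ (IsLocalRing.closedPoint (X.presheaf.stalk x)) := by
  let p := Scheme.PartialMap.ofFromSpecStalk sX sY φ h
  have hx : x ∈ p.domain := Scheme.PartialMap.mem_domain_ofFromSpecStalk sX sY φ h
  have hp : p.fromSpecStalkOfMem hx = φ := Scheme.PartialMap.fromSpecStalkOfMem_ofFromSpecStalk sX sY φ h
  have hpf : p.toRationalMap = f := by
    refine Scheme.RationalMap.eq_of_fromFunctionField_eq _ _ ?_
    rw [Scheme.RationalMap.fromFunctionField_toRationalMap, hf, ← hp]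
    simp only [Scheme.PartialMap.fromFunctionField, Scheme.PartialMap.fromSpecStalkOfMem, ← Category.assoc]
    congr 1
    rw [← cancel_mono p.domain.ι]
    simp
  have hxf : x ∈ f.domain := Scheme.RationalMap.mem_domain.2 ⟨p, hx, hpf⟩
  refine ⟨hxf, ?_⟩
  subst hpf
  have hle : p.domain ≤ p.toRationalMap.toPartialMap.domain := p.le_domain_toRationalMap
  have hres : X.homOfLE hle ≫ p.toRationalMap.toPartialMap.hom = p.hom :=
    Scheme.PartialMap.toPartialMap_toRationalMap_restrict p
  have h1 : p.toRationalMap.toPartialMap.hom (X.homOfLE hle ⟨x, hx⟩) = p.hom ⟨x, hx⟩ := by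
    rw [← hres]; rfl
  have h2 : X.homOfLE hle ⟨x, hx⟩ = ⟨x, hxf⟩ := by
    apply Subtype.ext
    simp
  have h2' : p.toRationalMap.toPartialMap.hom ⟨x, hxf⟩ = p.hom ⟨x, hx⟩ := by
    rw [← h1, h2]
  refine h2'.trans ?_
  rw [← hp]
  change _ = p.hom (p.domain.fromSpecStalkOfMem x hx (IsLocalRing.closedPoint (X.presheaf.stalk x)))
  congr 1
  apply Subtype.ext
  change x = (p.domain.fromSpecStalkOfMem x hx ≫ p.domain.ι) (IsLocalRing.closedPoint (X.presheaf.stalk x))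
  rw [Scheme.Opens.fromSpecStalkOfMem_ι, Scheme.fromSpecStalk_closedPoint]
end PartNineteen

section PartTwenty
set_option linter.style.haveILetI false
open AlgebraicGeometry CategoryTheory CategoryTheory.Limits

theorem exists_frac_chart {X : Scheme.{0}} [IsIntegral X] (x : X) (W : X.Opens) (hx : x ∈ W) :
    ∃ (A : CommRingCat.{0}) (j : Spec A ⟶ X) (α : A ⟶ X.functionField) (αx : A ⟶ X.presheaf.stalk x),
      IsOpenImmersion j ∧ Set.range j ⊆ W ∧ x ∈ Set.range j ∧
      Spec.map α ≫ j = X.fromSpecStalk (genericPoint X) ∧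
      Spec.map αx ≫ j = X.fromSpecStalk x ∧
      αx ≫ X.presheaf.stalkSpecializes ((genericPoint_spec X).specializes trivial) = α ∧
      @IsFractionRing A _ X.functionField _ α.hom.toAlgebra := by
  obtain ⟨V, hV, hxV, hVW⟩ := exists_isAffineOpen_mem_and_subset (X := X) (U := W) hx
  haveI : Nonempty V := ⟨⟨x, hxV⟩⟩
  have hg : genericPoint X ∈ V := ((genericPoint_spec X).mem_open_set_iff V.isOpen).2 (by simpa using ⟨x, hxV⟩)
  refine ⟨Γ(X, V), hV.fromSpec, X.germToFunctionField V, X.presheaf.germ V x hxV, inferInstance, ?_, ?_, ?_, ?_, ?_, ?_⟩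
  · rw [hV.range_fromSpec]; exact hVW
  · rw [hV.range_fromSpec]; exact hxV
  · exact hV.fromSpecStalk_eq_fromSpecStalk hg
  · exact hV.fromSpecStalk_eq_fromSpecStalk hxV
  · exact X.presheaf.germ_stalkSpecializes _ _
  · exact functionField_isFractionRing_of_isAffineOpen X V hV

theorem exists_trans {A H K : Type} [CommRing A] [CommRing H] [Field K] [Algebra A K] [IsFractionRing A K]
   [Algebra ℂ A] [Algebra ℂ H] (h : H →ₐ[ℂ] A) (g : H →+* K) (hg : ∀ x, algebraMap A K (h x) = g x)
   (y : K) (hy : Transcendental g.range y) : ∃ t : A, Transcendental h.range t := by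
  by_contra hcon
  simp only [not_exists, Transcendental, not_not] at hcon
  apply hy
  have key : ∀ t : A, IsAlgebraic g.range (algebraMap A K t) := by
    intro t
    have hinj : Function.Injective (algebraMap A K) := IsFractionRing.injective A K
    let θ : h.range →+* g.range := ((algebraMap A K).comp (algebraMap h.range A)).codRestrict _ (by
      rintro ⟨_, z, rfl⟩
      exact ⟨z, (hg z).symm⟩)
    refine (hcon t).ringHom_of_comp_eq θ (algebraMap A K) ?_ ?_
    · intro u v huv
      have := congrArg Subtype.val huv
      exact Subtype.ext (hinj this)
    · ext u; rfl
  obtain ⟨a, s, -, rfl⟩ := IsFractionRing.div_surjective (A := A) y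
  rw [div_eq_mul_inv]
  exact (key a).mul (key s).inv

theorem fromSpecStalkOfMem_closed {X : Scheme.{0}} (U : X.Opens) (x : X) (hx : x ∈ U) :
    U.fromSpecStalkOfMem x hx (IsLocalRing.closedPoint (X.presheaf.stalk x)) = ⟨x, hx⟩ := by
  apply Subtype.ext
  have h3 := congrArg (fun z => z (IsLocalRing.closedPoint (X.presheaf.stalk x))) (U.fromSpecStalkOfMem_ι x hx)
  have h4 : X.fromSpecStalk x (IsLocalRing.closedPoint (X.presheaf.stalk x)) = x :=
    Scheme.fromSpecStalk_closedPoint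
  exact h3.trans h4

theorem exists_fibre_geom {X B' : Scheme.{0}} [IsIntegral X] (sX : X ⟶ Spec (CommRingCat.of ℂ)) [LocallyOfFiniteType sX]
   (s' : B' ⟶ Spec (CommRingCat.of ℂ)) [LocallyOfFiniteType s'] (U : X.Opens) (hU : genericPoint X ∈ U) (f' : U.toScheme ⟶ B') (hf' : f' ≫ s' = U.ι ≫ sX)
   (H : CommRingCat.{0}) (iH : Spec H ⟶ B') [IsOpenImmersion iH] (g : H ⟶ X.functionField)
   (hg : Spec.map g ≫ iH = U.fromSpecStalkOfMem (genericPoint X) hU ≫ f')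
   (y : X.functionField) (hy : Transcendental g.hom.range y)
   (W : B'.Opens) (hW : f' ⟨genericPoint X, hU⟩ ∈ W) :
   ∃ (z : U) (z' : X), z.1 ⤳ z' ∧ z.1 ≠ z' ∧ IsClosed ({f' z} : Set B') ∧ f' z ∈ W := by
  have heta : f' ⟨genericPoint X, hU⟩ ∈ Set.range iH := by
    have h1 := congrArg (fun z => z (IsLocalRing.closedPoint X.functionField)) hg
    rw [← fromSpecStalkOfMem_closed U (genericPoint X) hU]
    exact ⟨_, h1⟩
  let W1 : B'.Opens := W ⊓ iH.opensRange
  let W2 : X.Opens := U.ι ''ᵁ (f' ⁻¹ᵁ W1)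
  have hW2 : genericPoint X ∈ W2 := ⟨⟨genericPoint X, hU⟩, ⟨hW, heta⟩, rfl⟩
  obtain ⟨A, j, α, -, hj, hjW, hx, hα, -, -, hfrac⟩ := exists_frac_chart (genericPoint X) W2 hW2
  letI := α.hom.toAlgebra
  haveI := hfrac
  haveI : Nonempty (Spec A) := ⟨hx.choose⟩
  haveI : IsDomain A := chart_domain A j
  have hjU : Set.range j ⊆ Set.range U.ι := by
    rintro _ ⟨a, rfl⟩
    obtain ⟨u, -, hu⟩ := hjW ⟨a, rfl⟩
    exact ⟨u, hu⟩
  let jU := IsOpenImmersion.lift U.ι j hjU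
  have hjU' : jU ≫ U.ι = j := IsOpenImmersion.lift_fac U.ι j hjU
  have hjUa : ∀ a, f' (jU a) ∈ W1 := by
    intro a
    obtain ⟨u, hu1, hu⟩ := hjW ⟨a, rfl⟩
    have h1 : U.ι (jU a) = j a := congrArg (fun z => z a) hjU'
    have : jU a = u := U.ι.isOpenEmbedding.injective (h1.trans hu.symm)
    rw [this]; exact hu1
  have hr : Set.range (jU ≫ f') ⊆ Set.range iH := by
    rintro _ ⟨a, rfl⟩
    exact (hjUa a).2
  obtain ⟨h, hh⟩ := Spec.map_surjective (IsOpenImmersion.lift iH (jU ≫ f') hr)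
  have hh' : Spec.map h ≫ iH = jU ≫ f' := by rw [hh, IsOpenImmersion.lift_fac]
  have hgα : h ≫ α = g := by
    apply Spec.map_injective
    rw [← cancel_mono iH, Spec.map_comp, Category.assoc, hh', hg, ← Category.assoc]
    congr 1
    rw [← cancel_mono U.ι, Category.assoc, hjU', hα, U.fromSpecStalkOfMem_ι]
  obtain ⟨φ, hφ⟩ := Spec.map_surjective (j ≫ sX)
  obtain ⟨χ, hχ⟩ := Spec.map_surjective (iH ≫ s')
  have hφχ : χ ≫ h = φ := by
    apply Spec.map_injective
    rw [Spec.map_comp, hφ, hχ, ← Category.assoc, hh', Category.assoc, hf', ← Category.assoc, hjU']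
  letI := φ.hom.toAlgebra
  letI := χ.hom.toAlgebra
  haveI : Algebra.FiniteType ℂ A := chart_ft sX A j φ hφ.symm
  haveI : Algebra.FiniteType ℂ H := chart_ft s' H iH χ hχ.symm
  let h' : H →ₐ[ℂ] A := { h.hom with commutes' := fun c => congrArg (fun z => z.hom c) hφχ }
  obtain ⟨t, ht⟩ := exists_trans h' g.hom (fun x => congrArg (fun z => z.hom x) hgα) y hy
  obtain ⟨P, hP, hPm, hPc⟩ := exists_fibre_prime h' t ht
  obtain ⟨M, hM, hPM⟩ := Ideal.exists_le_maximal P hP.ne_top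
  let zP : Spec A := (⟨P, hP⟩ : PrimeSpectrum A)
  let zM : Spec A := (⟨M, hM.isPrime⟩ : PrimeSpectrum A)
  refine ⟨jU zP, j zM, ?_, ?_, ?_, (hjUa zP).1⟩
  · have h1 : (jU zP).1 = j zP := congrArg (fun z => z zP) hjU'
    rw [h1]
    refine Specializes.map ?_ j.continuous
    exact (PrimeSpectrum.le_iff_specializes (⟨P, hP⟩ : PrimeSpectrum A) ⟨M, hM.isPrime⟩).1 hPM
  · have h1 : (jU zP).1 = j zP := congrArg (fun z => z zP) hjU'
    rw [h1]
    intro h2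
    have h3 := j.isOpenEmbedding.injective h2
    have h4 : P = M := congrArg (PrimeSpectrum.asIdeal (R := A)) h3
    exact hPm (h4 ▸ hM)
  · have h1 : f' (jU zP) = iH (Spec.map h zP) := (congrArg (fun z => z zP) hh').symm
    have h2 : IsClosed ({Spec.map h zP} : Set (Spec H)) :=
      (PrimeSpectrum.isClosed_singleton_iff_isMaximal (Spec.map h zP : PrimeSpectrum H)).2 hPc
    haveI : JacobsonSpace B' := LocallyOfFiniteType.jacobsonSpace s'
    rw [h1]
    apply isClosed_singleton_of_isLocallyClosed_singleton
    rw [← Set.image_singleton]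
    exact h2.isLocallyClosed.image iH.isOpenEmbedding.isInducing iH.isOpenEmbedding.isOpen_range.isLocallyClosed
end PartTwenty

section PartTwentyOne
set_option linter.style.haveILetI false
open AlgebraicGeometry CategoryTheory CategoryTheory.Limits

theorem exists_gamma {X B' : Scheme.{0}} [IsIntegral X] (sX : X ⟶ Spec (CommRingCat.of ℂ)) [IsProper sX]
   (s' : B' ⟶ Spec (CommRingCat.of ℂ)) [IsProper s'] (U : X.Opens) (hU : genericPoint X ∈ U) (f' : U.toScheme ⟶ B') (hf' : f' ≫ s' = U.ι ≫ sX)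
   (H : CommRingCat.{0}) (iH : Spec H ⟶ B') [IsOpenImmersion iH] (g : H ⟶ X.functionField)
   (hg : Spec.map g ≫ iH = U.fromSpecStalkOfMem (genericPoint X) hU ≫ f')
   (y : X.functionField) (hy : Transcendental g.hom.range y)
   (D : Set X) (hD : IsClosed D) (hpos : ∀ T : Set X, IsClosed T → IsIrreducible T →
    1 ≤ topologicalKrullDim T → (T ∩ D).Nonempty) :
   ∃ γ : (pullback sX s' : Scheme.{0}), pullback.lift U.ι f' hf'.symm ⟨genericPoint X, hU⟩ ⤳ γ ∧
     pullback.fst sX s' γ ∈ D ∧ pullback.snd sX s' γ = f' ⟨genericPoint X, hU⟩ := by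
  let j := pullback.lift U.ι f' hf'.symm
  let η : U := ⟨genericPoint X, hU⟩
  have hq1 : ∀ u, pullback.fst sX s' (j u) = u.1 := fun u => congrArg (fun z => z u) (pullback.lift_fst U.ι f' hf'.symm)
  have hq2 : ∀ u, pullback.snd sX s' (j u) = f' u := fun u => congrArg (fun z => z u) (pullback.lift_snd U.ι f' hf'.symm)
  have hc1 : IsClosedMap (pullback.fst sX s') := (pullback.fst sX s').isClosedMap
  have hc2 : IsClosedMap (pullback.snd sX s') := (pullback.snd sX s').isClosedMap
  have hspec : ∀ u : U, η ⤳ u := by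
    intro u
    apply (Topology.IsInducing.subtypeVal).specializes_iff.1
    exact (genericPoint_spec X).specializes trivial
  by_contra hcon
  let Γ : Set (pullback sX s' : Scheme.{0}) := closure {j η}
  have hmem : ∀ u, j u ∈ Γ := fun u => specializes_iff_mem_closure.1 ((hspec u).map j.continuous)
  let C : Set B' := Set.image (pullback.snd sX s') (Γ ∩ (pullback.fst sX s') ⁻¹' D)
  have hC : IsClosed C := hc2 _ (isClosed_closure.inter (hD.preimage (pullback.fst sX s').continuous))
  have hηC : f' η ∉ C := by
    rintro ⟨γ, ⟨h1, h2⟩, h3⟩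
    exact hcon ⟨γ, specializes_iff_mem_closure.2 h1, h2, h3⟩
  obtain ⟨z, z', hzz, hne, hcl, hzW⟩ := exists_fibre_geom sX s' U hU f' hf' H iH g hg y hy ⟨Cᶜ, hC.isOpen_compl⟩ hηC
  obtain ⟨d, hdT, hdD⟩ := hpos (closure {z.1}) isClosed_closure isIrreducible_singleton.closure
    (one_le_dim_closure z.1 z' hzz hne)
  let T : Set X := Set.image (pullback.fst sX s') (Γ ∩ (pullback.snd sX s') ⁻¹' {f' z})
  have hT : IsClosed T := hc1 _ (isClosed_closure.inter (hcl.preimage (pullback.snd sX s').continuous))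
  have hzT : z.1 ∈ T := ⟨j z, ⟨hmem z, hq2 z⟩, hq1 z⟩
  obtain ⟨γ, ⟨h1, h2⟩, h3⟩ := closure_minimal (Set.singleton_subset_iff.2 hzT) hT hdT
  exact hzW ⟨γ, ⟨h1, by rw [Set.mem_preimage, h3]; exact hdD⟩, h2⟩
end PartTwentyOne

section PartTwentyTwo
set_option linter.style.haveILetI false
open AlgebraicGeometry CategoryTheory CategoryTheory.Limits TensorProduct

theorem prod_chart {X Y S V W Z : Scheme.{0}} (sX : X ⟶ S) (sY : Y ⟶ S) (i : V ⟶ X) [IsOpenImmersion i]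
    (k : W ⟶ Y) [IsOpenImmersion k] (a : Z ⟶ V) (b : Z ⟶ W) {v : V ⟶ S} {w : W ⟶ S} (hv : i ≫ sX = v) (hw : k ≫ sY = w)
    (h : IsPullback a b v w) :
    ∃ m : Z ⟶ pullback sX sY, IsOpenImmersion m ∧ m ≫ pullback.fst sX sY = a ≫ i ∧ m ≫ pullback.snd sX sY = b ≫ k := by
  subst hv hw
  refine ⟨h.isoPullback.hom ≫ pullback.map (i ≫ sX) (k ≫ sY) sX sY i k (𝟙 S) (by simp) (by simp), inferInstance, ?_, ?_⟩
  · rw [Category.assoc]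
    have h1 := pullback.lift_fst (f := sX) (g := sY) (pullback.fst (i ≫ sX) (k ≫ sY) ≫ i) (pullback.snd (i ≫ sX) (k ≫ sY) ≫ k)
      (by rw [Category.assoc, Category.assoc, pullback.condition])
    refine (congrArg (fun z => h.isoPullback.hom ≫ z) h1).trans ?_
    change h.isoPullback.hom ≫ (pullback.fst (i ≫ sX) (k ≫ sY) ≫ i) = _
    rw [← Category.assoc, h.isoPullback_hom_fst]
  · rw [Category.assoc]
    have h1 := pullback.lift_snd (f := sX) (g := sY) (pullback.fst (i ≫ sX) (k ≫ sY) ≫ i) (pullback.snd (i ≫ sX) (k ≫ sY) ≫ k)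
      (by rw [Category.assoc, Category.assoc, pullback.condition])
    refine (congrArg (fun z => h.isoPullback.hom ≫ z) h1).trans ?_
    change h.isoPullback.hom ≫ (pullback.snd (i ≫ sX) (k ≫ sY) ≫ k) = _
    rw [← Category.assoc, h.isoPullback_hom_snd]

theorem ker_le_of_spec {G : Scheme.{0}} {R : CommRingCat.{0}} (m : Spec R ⟶ G) [IsOpenImmersion m] {K L : Type}
    [Field K] [Field L] (a : R →+* K) (b : R →+* L) (u v : G)
    (hu : m (Spec.map (CommRingCat.ofHom a) (IsLocalRing.closedPoint K)) = u)
    (hv : m (Spec.map (CommRingCat.ofHom b) (IsLocalRing.closedPoint L)) = v) (h : u ⤳ v) :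
    ∀ t, a t = 0 → b t = 0 := by
  subst hu hv
  have h1 := m.isOpenEmbedding.isInducing.specializes_iff.1 h
  have h2 := (PrimeSpectrum.le_iff_specializes _ _).2 h1
  intro t ht
  have h3 : t ∈ (Spec.map (CommRingCat.ofHom a) (IsLocalRing.closedPoint K)).asIdeal := by
    change a t ∈ IsLocalRing.maximalIdeal K
    rw [ht]; exact zero_mem _
  have h4 : b t ∈ IsLocalRing.maximalIdeal L := h2 h3
  rw [IsLocalRing.maximalIdeal_eq_bot] at h4
  exact h4

theorem lift_of_range {H O K : Type} [CommRing H] [CommRing O] [CommRing K] (ι : O →+* K) (hι : Function.Injective ι)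
    (g : H →+* K) (hg : ∀ x, ∃ o, ι o = g x) : ∃ θ : H →+* O, ι.comp θ = g := by
  choose t ht using hg
  refine ⟨⟨⟨⟨t, ?_⟩, ?_⟩, ?_, ?_⟩, ?_⟩
  · apply hι; rw [ht]; simp
  · intro x y; apply hι; rw [map_mul, ht, ht, ht, map_mul]
  · apply hι; change ι (t 0) = _; rw [ht]; simp
  · intro x y; apply hι; change ι (t _) = ι (t x + t y); rw [map_add, ht, ht, ht, map_add]
  · ext x; exact ht x

theorem thmK_geom {X B' : Scheme.{0}} [IsIntegral X] (sX : X ⟶ Spec (CommRingCat.of ℂ)) [Smooth sX]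
   (s' : B' ⟶ Spec (CommRingCat.of ℂ)) [LocallyOfFiniteType s'] (U : X.Opens) (hU : genericPoint X ∈ U) (f' : U.toScheme ⟶ B') (hf' : f' ≫ s' = U.ι ≫ sX)
   (H : CommRingCat.{0}) (iH : Spec H ⟶ B') [IsOpenImmersion iH] (g : H ⟶ X.functionField)
   (hg : Spec.map g ≫ iH = U.fromSpecStalkOfMem (genericPoint X) hU ≫ f')
   (χ : CommRingCat.of ℂ ⟶ H) (hχ : iH ≫ s' = Spec.map χ)
   (γ : (pullback sX s' : Scheme.{0})) (hγ : pullback.lift U.ι f' hf'.symm ⟨genericPoint X, hU⟩ ⤳ γ)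
   (hγ2 : pullback.snd sX s' γ = f' ⟨genericPoint X, hU⟩) (x : X) (hγx : pullback.fst sX s' γ = x) :
   (∃ θ : H ⟶ X.presheaf.stalk x, θ ≫ X.presheaf.stalkSpecializes ((genericPoint_spec X).specializes trivial) = g ∧
      ∀ h, θ.hom h ∈ IsLocalRing.maximalIdeal (X.presheaf.stalk x) ↔ g.hom h = 0) ∨
    ∃ (k : Type) (_ : Field k) (_ : Algebra ℂ k) (ψ : H →+* RatFunc k), (∀ c, ψ (χ.hom c) = RatFunc.C (algebraMap ℂ k c)) ∧
      (∀ x, ψ x = 0 ↔ g.hom x = 0) ∧ ∃ x, ∀ c, ψ x ≠ RatFunc.C c := by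
  obtain ⟨A, j, α, αx, hj, -, hx, hα, hαx, hαα, hfrac⟩ := exists_frac_chart x ⊤ trivial
  haveI : Nonempty (Spec A) := ⟨hx.choose⟩
  haveI : IsDomain A := chart_domain A j
  obtain ⟨φ, hφ⟩ := Spec.map_surjective (j ≫ sX)
  let G := pullback sX s'
  let k1 := G.residueField γ
  have heU := fromSpecStalkOfMem_closed U (genericPoint X) hU
  -- the two maps to `k1`
  have hεpt : ∀ t, G.fromSpecResidueField γ t = γ := G.fromSpecResidueField_apply γ
  have hrA : Set.range (G.fromSpecResidueField γ ≫ pullback.fst sX s') ⊆ Set.range j := by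
    rintro _ ⟨t, rfl⟩
    change pullback.fst sX s' (G.fromSpecResidueField γ t) ∈ _
    rw [hεpt, hγx]; exact hx
  have hgpt : iH (Spec.map g (IsLocalRing.closedPoint X.functionField)) = f' ⟨genericPoint X, hU⟩ := by
    have := congrArg (fun z => z (IsLocalRing.closedPoint X.functionField)) hg
    refine this.trans ?_
    change f' (U.fromSpecStalkOfMem (genericPoint X) hU (IsLocalRing.closedPoint X.functionField)) = _
    exact congrArg _ heU
  have hrH : Set.range (G.fromSpecResidueField γ ≫ pullback.snd sX s') ⊆ Set.range iH := by
    rintro _ ⟨t, rfl⟩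
    change pullback.snd sX s' (G.fromSpecResidueField γ t) ∈ _
    rw [hεpt, hγ2]; exact ⟨_, hgpt⟩
  obtain ⟨εA, hεA0⟩ := Spec.map_surjective (IsOpenImmersion.lift j _ hrA)
  obtain ⟨εH, hεH0⟩ := Spec.map_surjective (IsOpenImmersion.lift iH _ hrH)
  have hεA : Spec.map εA ≫ j = G.fromSpecResidueField γ ≫ pullback.fst sX s' := by
    rw [hεA0, IsOpenImmersion.lift_fac]
  have hεH : Spec.map εH ≫ iH = G.fromSpecResidueField γ ≫ pullback.snd sX s' := by
    rw [hεH0, IsOpenImmersion.lift_fac]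
  have hεC : χ ≫ εH = φ ≫ εA := by
    apply Spec.map_injective
    rw [Spec.map_comp, Spec.map_comp, ← hχ, hφ, ← Category.assoc, ← Category.assoc, hεA, hεH, Category.assoc,
      Category.assoc, pullback.condition]
  have hgC : χ ≫ g = φ ≫ α := by
    apply Spec.map_injective
    rw [Spec.map_comp, Spec.map_comp, ← hχ, hφ, ← Category.assoc, ← Category.assoc, hα, hg, Category.assoc, hf',
      ← Category.assoc, U.fromSpecStalkOfMem_ι]
  letI : Algebra A X.functionField := α.hom.toAlgebra
  haveI := hfrac
  letI : Algebra ℂ A := φ.hom.toAlgebra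
  letI : Algebra ℂ H := χ.hom.toAlgebra
  letI : Algebra ℂ X.functionField := (φ ≫ α).hom.toAlgebra
  letI : Algebra ℂ k1 := (φ ≫ εA).hom.toAlgebra
  haveI : IsScalarTower ℂ A X.functionField := IsScalarTower.of_algebraMap_eq fun _ => rfl
  haveI : Algebra.Smooth ℂ A := chart_smooth sX A j φ hφ.symm
  haveI : Algebra.FiniteType ℂ H := chart_ft s' H iH χ hχ
  let gg : H →ₐ[ℂ] X.functionField := { g.hom with commutes' := fun c => congrArg (fun z => z.hom c) hgC }
  let eA : A →ₐ[ℂ] k1 := { εA.hom with commutes' := fun c => rfl }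
  let eH : H →ₐ[ℂ] k1 := { εH.hom with commutes' := fun c => congrArg (fun z => z.hom c) hεC }
  let LK := Algebra.TensorProduct.lift (IsScalarTower.toAlgHom ℂ A X.functionField) gg (fun _ _ => Commute.all _ _)
  let Lk := Algebra.TensorProduct.lift eA eH (fun _ _ => Commute.all _ _)
  have hpb := isPullback_SpecMap_of_isPushout _ _ _ _ (CommRingCat.isPushout_tensorProduct ℂ A H)
  obtain ⟨m, hm, hm1, hm2⟩ := prod_chart sX s' j iH _ _ hφ.symm hχ hpb
  have hmK : Spec.map (CommRingCat.ofHom LK.toRingHom) ≫ m =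
      U.fromSpecStalkOfMem (genericPoint X) hU ≫ pullback.lift U.ι f' hf'.symm := by
    apply pullback.hom_ext
    · rw [Category.assoc, hm1, Category.assoc, pullback.lift_fst, U.fromSpecStalkOfMem_ι, ← hα, ← Category.assoc,
        ← Spec.map_comp]
      congr 2
      ext a
      change LK (a ⊗ₜ 1) = _
      simp [LK]
      rfl
    · rw [Category.assoc, hm2, Category.assoc, pullback.lift_snd, ← hg, ← Category.assoc,
        ← Spec.map_comp]
      congr 2
      ext a
      change LK (1 ⊗ₜ a) = _
      simp [LK]
      rfl
  have hmk : Spec.map (CommRingCat.ofHom Lk.toRingHom) ≫ m = G.fromSpecResidueField γ := by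
    apply pullback.hom_ext
    · rw [Category.assoc, hm1, ← hεA, ← Category.assoc, ← Spec.map_comp]
      congr 2
      ext a
      change Lk (a ⊗ₜ 1) = _
      simp [Lk]
      rfl
    · rw [Category.assoc, hm2, ← hεH, ← Category.assoc, ← Spec.map_comp]
      congr 2
      ext a
      change Lk (1 ⊗ₜ a) = _
      simp [Lk]
      rfl
  have hcomp : ∀ t, LK t = 0 → Lk t = 0 := by
    refine ker_le_of_spec (R := CommRingCat.of (A ⊗[ℂ] H)) m LK.toRingHom Lk.toRingHom _ _ ?_ ?_ hγ
    · have := congrArg (fun z => z (IsLocalRing.closedPoint X.functionField)) hmK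
      refine this.trans ?_
      exact congrArg (pullback.lift U.ι f' hf'.symm) heU
    · have := congrArg (fun z => z (IsLocalRing.closedPoint k1)) hmk
      exact this.trans (hεpt _)
  have hεHpt : iH (Spec.map εH (IsLocalRing.closedPoint k1)) = f' ⟨genericPoint X, hU⟩ := by
    have := congrArg (fun z => z (IsLocalRing.closedPoint k1)) hεH
    refine this.trans ?_
    exact (congrArg (pullback.snd sX s') (hεpt (IsLocalRing.closedPoint k1))).trans hγ2
  have hker : ∀ x, εH.hom x = 0 → g.hom x = 0 :=
    ker_le_of_spec iH εH.hom g.hom _ _ hεHpt hgpt (specializes_refl _)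
  have hker' : ∀ x, g.hom x = 0 → εH.hom x = 0 :=
    ker_le_of_spec iH g.hom εH.hom _ _ hgpt hεHpt (specializes_refl _)
  rcases thmK' gg eA eH hcomp hker with h | ⟨k, _, _, ψ, hψ, hψ2⟩
  · left
    have hxA : ∀ a, αx.hom a ∈ IsLocalRing.maximalIdeal (X.presheaf.stalk x) ↔ εA.hom a = 0 := by
      have h1 : j (Spec.map αx (IsLocalRing.closedPoint (X.presheaf.stalk x))) = x := by
        have := congrArg (fun z => z (IsLocalRing.closedPoint (X.presheaf.stalk x))) hαx
        exact this.trans Scheme.fromSpecStalk_closedPoint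
      have h2 : j (Spec.map εA (IsLocalRing.closedPoint k1)) = x := by
        have := congrArg (fun z => z (IsLocalRing.closedPoint k1)) hεA
        refine this.trans ?_
        exact (congrArg (pullback.fst sX s') (hεpt (IsLocalRing.closedPoint k1))).trans hγx
      have h3 := j.isOpenEmbedding.injective (h1.trans h2.symm)
      intro a
      have h4 : a ∈ (Spec.map αx (IsLocalRing.closedPoint (X.presheaf.stalk x))).asIdeal ↔
        a ∈ (Spec.map εA (IsLocalRing.closedPoint k1)).asIdeal := by rw [h3]
      have h5 : a ∈ (Spec.map εA (IsLocalRing.closedPoint k1)).asIdeal ↔ εA.hom a = 0 := by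
        change εA.hom a ∈ IsLocalRing.maximalIdeal k1 ↔ _
        rw [IsLocalRing.maximalIdeal_eq_bot]; rfl
      exact h4.trans h5
    have hιinj : Function.Injective (X.presheaf.stalkSpecializes ((genericPoint_spec X).specializes (trivial : x ∈ ⊤))).hom :=
      IsFractionRing.injective (X.presheaf.stalk x) X.functionField
    generalize hι : X.presheaf.stalkSpecializes ((genericPoint_spec X).specializes (trivial : x ∈ ⊤)) = ι at *
    have hιa : ∀ a, ι.hom (αx.hom a) = α.hom a := fun a => congrArg (fun z => z.hom a) hαα
    have hex : ∀ y, ∃ o, ι.hom o = g.hom y := by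
      intro y
      obtain ⟨s, a, hs, hsa⟩ := h y
      have hs' : IsUnit (αx.hom s) := by
        by_contra hcon
        exact hs ((hxA s).1 hcon)
      obtain ⟨u, hu⟩ := hs'
      refine ⟨↑u⁻¹ * αx.hom a, ?_⟩
      have h1 : ι.hom (αx.hom s) * g.hom y = ι.hom (αx.hom a) := by rw [hιa, hιa]; exact hsa
      rw [map_mul, ← h1, ← mul_assoc, ← map_mul, ← hu, Units.inv_mul, map_one, one_mul]
    obtain ⟨θ, hθ⟩ := lift_of_range ι.hom hιinj g.hom hex
    have hθ' : ∀ y, ι.hom (θ y) = g.hom y := fun y => congrArg (fun z => z y) hθ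
    refine ⟨CommRingCat.ofHom θ, ?_, ?_⟩
    · ext y; exact hθ' y
    · intro y
      change θ y ∈ _ ↔ _
      obtain ⟨s, a, hs, hsa⟩ := h y
      have h1 : αx.hom s * θ y = αx.hom a := by
        apply hιinj
        rw [map_mul, hιa, hιa, hθ']; exact hsa
      have hs' : αx.hom s ∉ IsLocalRing.maximalIdeal (X.presheaf.stalk x) := fun h => hs ((hxA s).1 h)
      have h2 := hcomp (s ⊗ₜ y - a ⊗ₜ 1) (by
        simp only [LK, map_sub, Algebra.TensorProduct.lift_tmul, map_one, mul_one]
        exact sub_eq_zero.2 hsa)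
      simp only [Lk, map_sub, Algebra.TensorProduct.lift_tmul, map_one, mul_one] at h2
      have h3 : eA s * eH y = eA a := sub_eq_zero.1 h2
      have h4 : θ y ∈ IsLocalRing.maximalIdeal (X.presheaf.stalk x) ↔ αx.hom a ∈ IsLocalRing.maximalIdeal (X.presheaf.stalk x) := by
        rw [← h1]
        exact ⟨fun h => Ideal.mul_mem_left _ _ h, fun h => ((Ideal.IsPrime.mem_or_mem inferInstance h).resolve_left hs')⟩
      rw [h4, hxA]
      change eA a = 0 ↔ _
      rw [← h3, mul_eq_zero, or_iff_right hs]
      exact ⟨hker y, hker' y⟩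
  · right
    refine ⟨k, inferInstance, inferInstance, ψ.toRingHom, ?_, hψ, hψ2⟩
    intro c
    exact (ψ.commutes c).trans rfl
end PartTwentyTwo

section PartTwentyThree
set_option linter.style.haveILetI false
open AlgebraicGeometry CategoryTheory CategoryTheory.Limits

theorem exists_trans_of_dim {X B : Scheme.{0}} [IsIntegral X] [IsIntegral B] (sX : X ⟶ Spec (CommRingCat.of ℂ)) [LocallyOfFiniteType sX]
    (sB : B ⟶ Spec (CommRingCat.of ℂ)) [LocallyOfFiniteType sB] (hdim : topologicalKrullDim B < topologicalKrullDim X)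
    (R : CommRingCat.{0}) (iR : Spec R ⟶ B) [IsOpenImmersion iR] [Nonempty (Spec R)] (φR : CommRingCat.of ℂ ⟶ R)
    (hφR : Spec.map φR = iR ≫ sB) (σ : CommRingCat.of ℂ ⟶ CommRingCat.of ℂ) (H : CommRingCat.{0}) (b : R ⟶ H)
    (a : CommRingCat.of ℂ ⟶ H) (hpo : IsPushout φR σ b a)
    (κ : CommRingCat.of ℂ ⟶ X.functionField) (hκ : Spec.map κ = X.fromSpecStalk (genericPoint X) ≫ sX)
    (g : H ⟶ X.functionField) (hga : a ≫ g = κ) :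
    ∃ y : X.functionField, Transcendental g.hom.range y := by
  by_contra hcon
  simp only [not_exists, Transcendental, not_not] at hcon
  refine absurd hdim (not_lt.2 (dim_le_of_charts X _ fun A j hj hne => ?_))
  refine le_trans ?_ (dim_ge_of_chart B R iR)
  haveI : IsDomain A := chart_domain A j
  haveI : IsDomain R := chart_domain R iR
  obtain ⟨φ, hφ⟩ := Spec.map_surjective (j ≫ sX)
  letI : Algebra ℂ A := φ.hom.toAlgebra
  letI : Algebra ℂ R := φR.hom.toAlgebra
  letI : Algebra ℂ X.functionField := κ.hom.toAlgebra
  haveI : Algebra.FiniteType ℂ A := chart_ft sX A j φ hφ.symm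
  haveI : Algebra.FiniteType ℂ R := chart_ft sB R iR φR hφR.symm
  obtain ⟨α, hα, hαinj⟩ := lift_gen (K := X.functionField) j (X.fromSpecStalk (genericPoint X)) (by
    intro t
    have : t = IsLocalRing.closedPoint X.functionField := Subsingleton.elim (α := PrimeSpectrum X.functionField) _ _
    rw [this]; exact Scheme.fromSpecStalk_closedPoint)
  have hφα : φ ≫ α = κ := by
    apply Spec.map_injective
    rw [Spec.map_comp, hφ, hκ, ← Category.assoc, hα]
  let iA : A →ₐ[ℂ] X.functionField := { α.hom with commutes' := fun c => congrArg (fun z => z.hom c) hφα }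
  refine dim_le_of_algebraic iA hαinj (b ≫ g).hom σ.hom ?_ ?_
  · intro c
    have h1 : φR ≫ b ≫ g = σ ≫ κ := by rw [← Category.assoc, hpo.w, Category.assoc, hga]
    exact congrArg (fun z => z.hom c) h1
  · intro y
    let S := Algebra.adjoin ℂ (Set.range (b ≫ g).hom)
    have hS : ∀ h : H, g.hom h ∈ S := by
      intro h
      refine pushout_gen hpo (S.toSubring.comap g.hom) ?_ ?_ h
      · intro r
        exact Algebra.subset_adjoin ⟨r, rfl⟩
      · intro c
        have : g.hom (a.hom c) = algebraMap ℂ X.functionField c := congrArg (fun z => z.hom c) hga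
        change g.hom (a.hom c) ∈ S
        rw [this]; exact S.algebraMap_mem c
    let θ : g.hom.range →+* S := (algebraMap g.hom.range X.functionField).codRestrict S (by
      rintro ⟨_, h, rfl⟩
      exact hS h)
    refine (hcon y).ringHom_of_comp_eq θ (RingHom.id _) ?_ ?_
    · intro u v huv
      have := congrArg (fun z : S => (z : X.functionField)) huv
      exact Subtype.ext this
    · ext u; rfl

theorem main_geom {X B : Scheme.{0}} [IsIntegral X] [IsIntegral B] [B.IsSeparated] (sX : X ⟶ Spec (CommRingCat.of ℂ)) [IsProper sX] [Smooth sX]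
    (sB : B ⟶ Spec (CommRingCat.of ℂ)) [IsProper sB] (hdim : topologicalKrullDim B < topologicalKrullDim X)
    (f : X ⤏ B) (p : X.PartialMap B) (hp : p = f.toPartialMap) (hpf : f.fromFunctionField = p.fromFunctionField)
    (hdom : Dense (Set.range p.hom))
    (D : Set X) (hD : IsClosed D) (hpos : ∀ T : Set X, IsClosed T → IsIrreducible T →
      1 ≤ topologicalKrullDim T → (T ∩ D).Nonempty) (hB : ¬ Uniruled B) :
    ∃ u : p.domain, u.1 ∈ D ∧ p.hom u = genericPoint B := by
  have hU : genericPoint X ∈ p.domain :=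
    ((genericPoint_spec X).mem_open_set_iff p.domain.isOpen).2 (by simpa using p.dense_domain.nonempty)
  haveI : Nonempty p.domain := ⟨⟨_, hU⟩⟩
  let eU := p.domain.fromSpecStalkOfMem (genericPoint X) hU
  have hgen : p.hom ⟨genericPoint X, hU⟩ = genericPoint B := by
    have h1 : IsGenericPoint (p.hom ⟨genericPoint X, hU⟩) (⊤ : Set B) := by
      refine Set.eq_univ_of_univ_subset ?_
      rw [← hdom.closure_eq]
      refine closure_minimal ?_ isClosed_closure
      rintro _ ⟨u, rfl⟩
      refine specializes_iff_mem_closure.1 (Specializes.map ?_ p.hom.continuous)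
      apply (Topology.IsInducing.subtypeVal).specializes_iff.1
      exact (genericPoint_spec X).specializes trivial
    exact h1.eq (genericPoint_spec B)
  have he : ∀ t, (eU ≫ p.hom) t = genericPoint B := by
    intro t
    have : t = IsLocalRing.closedPoint X.functionField := Subsingleton.elim (α := PrimeSpectrum X.functionField) _ _
    rw [this]
    exact (congrArg p.hom (fromSpecStalkOfMem_closed p.domain (genericPoint X) hU)).trans hgen
  obtain ⟨σ0, hσ⟩ := exists_sigma_geom (p.domain.ι ≫ sX) (p.hom ≫ sB)
  let σ : CommRingCat.of ℂ ⟶ CommRingCat.of ℂ := CommRingCat.ofHom σ0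
  change _ = _ ≫ Spec.map σ at hσ
  let s' := pullback.snd sB (Spec.map σ)
  let f' : p.domain.toScheme ⟶ pullback sB (Spec.map σ) := pullback.lift p.hom (p.domain.ι ≫ sX) hσ
  have hf' : f' ≫ s' = p.domain.ι ≫ sX := pullback.lift_snd _ _ _
  obtain ⟨R, iR, hiR, hxR, -⟩ := Scheme.exists_affine_mem_range_and_range_subset (X := B) (U := ⊤) (x := genericPoint B) trivial
  haveI : Nonempty (Spec R) := ⟨hxR.choose⟩
  haveI : IsDomain R := chart_domain R iR
  obtain ⟨φR, hφR⟩ := Spec.map_surjective (iR ≫ sB)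
  obtain ⟨β, hβ, hβinj⟩ := lift_gen (K := X.functionField) iR (eU ≫ p.hom) he
  obtain ⟨κ, hκ⟩ := Spec.map_surjective (X.fromSpecStalk (genericPoint X) ≫ sX)
  have hw : φR ≫ β = σ ≫ κ := by
    apply Spec.map_injective
    rw [Spec.map_comp, Spec.map_comp, hκ, hφR, ← Category.assoc, hβ, Category.assoc, hσ, ← Category.assoc, ← Category.assoc,
      p.domain.fromSpecStalkOfMem_ι]
  let H := pushout φR σ
  let b : R ⟶ H := pushout.inl φR σ
  let a : CommRingCat.of ℂ ⟶ H := pushout.inr φR σ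
  have hpo : IsPushout φR σ b a := IsPushout.of_hasPushout φR σ
  have hpb := isPullback_SpecMap_of_isPushout _ _ _ _ hpo
  obtain ⟨iH, hiH, hiH1, hiH2⟩ := prod_chart sB (Spec.map σ) iR (𝟙 (Spec (CommRingCat.of ℂ))) _ _ hφR.symm (Category.id_comp _) hpb
  rw [Category.comp_id] at hiH2
  let g : H ⟶ X.functionField := hpo.desc β κ hw
  have hgb : b ≫ g = β := hpo.inl_desc _ _ _
  have hga : a ≫ g = κ := hpo.inr_desc _ _ _
  have hg : Spec.map g ≫ iH = eU ≫ f' := by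
    apply pullback.hom_ext
    · rw [Category.assoc, hiH1, Category.assoc, pullback.lift_fst, ← hβ, ← Category.assoc, ← Spec.map_comp, hgb]
    · rw [Category.assoc, hiH2, Category.assoc, pullback.lift_snd, ← Spec.map_comp, hga, hκ, ← Category.assoc,
        p.domain.fromSpecStalkOfMem_ι]
  obtain ⟨y, hy⟩ := exists_trans_of_dim sX sB hdim R iR φR hφR σ H b a hpo κ hκ g hga
  obtain ⟨γ, hγ, hγD, hγ2⟩ := exists_gamma sX s' p.domain hU f' hf' H iH g hg y hy D hD hpos
  generalize hγx : pullback.fst sX s' γ = x at hγD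
  rcases thmK_geom sX s' p.domain hU f' hf' H iH g hg a hiH2 γ hγ hγ2 x hγx with ⟨θ, hθ, hθm⟩ | ⟨k, _, _, ψ, hψc, hψ0, hψ⟩
  · obtain ⟨κx, hκx⟩ := Spec.map_surjective (X.fromSpecStalk x ≫ sX)
    have hιinj : Function.Injective (X.presheaf.stalkSpecializes ((genericPoint_spec X).specializes (trivial : x ∈ ⊤))).hom :=
      IsFractionRing.injective (X.presheaf.stalk x) X.functionField
    have hιx : Spec.map (X.presheaf.stalkSpecializes ((genericPoint_spec X).specializes (trivial : x ∈ ⊤))) ≫ X.fromSpecStalk x =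
      X.fromSpecStalk (genericPoint X) := Scheme.SpecMap_stalkSpecializes_fromSpecStalk _
    have hκκ : κx ≫ X.presheaf.stalkSpecializes ((genericPoint_spec X).specializes (trivial : x ∈ ⊤)) = κ := by
      apply Spec.map_injective
      rw [Spec.map_comp, hκx, hκ, ← Category.assoc, hιx]
    have haθ : a ≫ θ = κx := by
      ext c
      apply hιinj
      have h1 : (a ≫ θ) ≫ X.presheaf.stalkSpecializes ((genericPoint_spec X).specializes (trivial : x ∈ ⊤)) =
        κx ≫ X.presheaf.stalkSpecializes ((genericPoint_spec X).specializes (trivial : x ∈ ⊤)) := by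
        rw [Category.assoc, hθ, hga, hκκ]
      exact congrArg (fun z => z.hom c) h1
    obtain ⟨hx, hfx⟩ := mem_domain_of_stalk' (sX ≫ Spec.map σ) sB f x (Spec.map (b ≫ θ) ≫ iR) (by
        rw [Category.assoc, ← hφR, ← Spec.map_comp, ← Category.assoc φR, hpo.w, Category.assoc, haθ, Spec.map_comp, hκx,
          Category.assoc]) (by
        rw [hpf, ← Category.assoc, ← Spec.map_comp, Category.assoc, hθ, hgb, hβ]
        rfl)
    subst hp
    refine ⟨⟨x, hx⟩, hγD, hfx.trans ?_⟩
    rw [← he (IsLocalRing.closedPoint X.functionField), ← hβ]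
    change iR (Spec.map (b ≫ θ) (IsLocalRing.closedPoint (X.presheaf.stalk x))) = iR (Spec.map β (IsLocalRing.closedPoint X.functionField))
    congr 1
    apply PrimeSpectrum.ext
    ext r
    change θ.hom (b.hom r) ∈ IsLocalRing.maximalIdeal (X.presheaf.stalk x) ↔ β.hom r ∈ IsLocalRing.maximalIdeal X.functionField
    rw [hθm, IsLocalRing.maximalIdeal_eq_bot, Ideal.mem_bot]
    have h1 : g.hom (b.hom r) = β.hom r := congrArg (fun z => z.hom r) hgb
    exact ⟨fun h => h1.symm.trans h, fun h => h1.trans h⟩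
  · exfalso
    apply hB
    letI : Algebra ℂ R := φR.hom.toAlgebra
    haveI : Algebra.FiniteType ℂ R := chart_ft sB R iR φR hφR.symm
    have hb0 : ∃ b0 : R, ∀ c, ψ (b.hom b0) ≠ RatFunc.C c := by
      by_contra hcon
      simp only [not_exists, not_forall, not_not] at hcon
      obtain ⟨h, hh⟩ := hψ
      have : h ∈ (RatFunc.C (K := k)).range.comap ψ := by
        refine pushout_gen hpo _ ?_ ?_ h
        · intro r
          obtain ⟨c, hc⟩ := hcon r
          exact ⟨c, hc.symm⟩
        · intro c
          exact ⟨_, (hψc c).symm⟩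
      obtain ⟨c, hc⟩ := this
      exact hh c hc.symm
    obtain ⟨b0, hb0⟩ := hb0
    refine uniruled_of_ratfunc B sB (R := R) (k := k) iR hφR.symm ((algebraMap ℂ k).comp σ0) (ψ.comp b.hom) ?_ ?_ b0 hb0
    · rw [injective_iff_map_eq_zero]
      intro r hr
      apply (injective_iff_map_eq_zero β.hom).1 hβinj
      have h1 : g.hom (b.hom r) = β.hom r := congrArg (fun z => z.hom r) hgb
      exact h1.symm.trans ((hψ0 _).1 hr)
    · intro c
      have h1 : b.hom (φR.hom c) = a.hom (σ0 c) := congrArg (fun z => z.hom c) hpo.w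
      change ψ (b.hom (φR.hom c)) = _
      rw [h1, hψc]; rfl
end PartTwentyThree

section PartTwentyFour
set_option linter.style.haveILetI false
open AlgebraicGeometry CategoryTheory CategoryTheory.Limits

theorem final_geom {X B : Scheme.{0}} [IsIntegral X] [IsIntegral B] [B.IsSeparated] (sX : X ⟶ Spec (CommRingCat.of ℂ)) [IsProper sX] [Smooth sX]
    (sB : B ⟶ Spec (CommRingCat.of ℂ)) [IsProper sB] (hdim : topologicalKrullDim B < topologicalKrullDim X)
    (f : X ⤏ B) (hdom : f.Dominant)
    (D : Set X) (hD : IsClosed D) (hpos : ∀ T : Set X, IsClosed T → IsIrreducible T →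
      1 ≤ topologicalKrullDim T → (T ∩ D).Nonempty) (hB : ¬ Uniruled B) :
    Dense (f.toPartialMap.hom.base '' (f.toPartialMap.domain.ι.base ⁻¹' D)) := by
  obtain ⟨q, hq, hqd⟩ := hdom
  have hd : Dense (Set.range f.toPartialMap.hom) := by
    subst hq
    have hres : X.homOfLE q.le_domain_toRationalMap ≫ q.toRationalMap.toPartialMap.hom = q.hom :=
      Scheme.PartialMap.toPartialMap_toRationalMap_restrict q
    refine Dense.mono ?_ hqd
    rintro _ ⟨u, rfl⟩
    exact ⟨X.homOfLE q.le_domain_toRationalMap u, congrArg (fun z => z u) hres⟩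
  have hpf : f.fromFunctionField = f.toPartialMap.fromFunctionField := by
    conv_lhs => rw [← Scheme.RationalMap.toRationalMap_toPartialMap f]
    rw [Scheme.RationalMap.fromFunctionField_toRationalMap]
  obtain ⟨u, huD, hu⟩ := main_geom sX sB hdim f f.toPartialMap rfl hpf hd D hD hpos hB
  have h1 : Dense ({genericPoint B} : Set B) := by
    rw [dense_iff_closure_eq]; exact genericPoint_spec B
  refine Dense.mono ?_ h1
  rintro _ rfl
  exact ⟨u, huD, hu⟩

end PartTwentyFour

theorem restriction_to_ample_divisor_dominant
    (X B : Variety)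
    (hXproper : IsProper X.structMap) (hXsmooth : IsSmooth X.structMap)
    (hBproper : IsProper B.structMap) (hBsmooth : IsSmooth B.structMap)
    (hdim : B.dim < X.dim)
    (f : X.X ⤏ B.X) (hdom : f.Dominant)
    (D : AmpleDivisorApprox X) (hB : ¬ Uniruled B.X) :
    haveI := X.isIntegral; haveI := B.isSeparated
    Dense (f.toPartialMap.hom.base ''
      (f.toPartialMap.domain.ι.base ⁻¹' (Set.range D.ι.base))) := by
  haveI := X.isIntegral
  haveI := B.isSeparated
  haveI := B.isIntegral
  haveI := D.closedImmersion
  exact @final_geom X.X B.X _ _ _ X.structMap hXproper hXsmooth B.structMap hBproper hdim f hdom (Set.range D.ι.base)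
    D.ι.isClosedEmbedding.isClosed_range D.positive hB

end
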